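/- Let U be a C²(ℝ^N) stable solution of ΔU + f(U) = 0 in ℝ^N with 0 ≤ U ≤ 1, and assume U is axisymmetric with respect to the x₁-axis, i.e. U(x) depends only on x₁ and |x'| where x' = (x₂,…,x_N). Then either U ≡ 0 in ℝ^N or U ≡ 1 in ℝ^N. -/

import Mathlib

open Set Filter Topology MeasureTheory

noncomputable section

/-- `ℝ^N` with `N = d+1`, Euclidean structure. -/
abbrev Euc (d : ℕ) := EuclideanSpace ℝ (Fin (d + 1))

/-- The Euclidean norm of `x' = (x₂,…,x_N)` for `x = (x₁,x') ∈ ℝ^N`. -/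
def primeNorm {d : ℕ} (x : Euc d) : ℝ :=
  Real.sqrt (∑ i, if i = 0 then 0 else (x i) ^ 2)

/-- The funnel-shaped domain `Ω = {x : |x'| < h(x₁)}`. -/
def funnel (d : ℕ) (h : ℝ → ℝ) : Set (Euc d) := {x | primeNorm x < h (x 0)}

/-- The Laplacian of `g` at `x`, computed with derivatives taken within the set `s`. -/
def lapW {d : ℕ} (s : Set (Euc d)) (g : Euc d → ℝ) (x : Euc d) : ℝ :=
  ∑ i, fderivWithin ℝ (fun y => fderivWithin ℝ g s y (EuclideanSpace.single i 1)) s x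
      (EuclideanSpace.single i 1)

/-- The quantity `ν·∇g` at a boundary point `x` of the funnel domain `Ω_{R,α}`, where
`ν(x) = (1+h'(x₁)²)^{-1/2}·(-h'(x₁), x'/|x'|)` is the outward unit normal. -/
def neumannLHS {d : ℕ} (h : ℝ → ℝ) (g : Euc d → ℝ) (x : Euc d) : ℝ :=
  (Real.sqrt (1 + deriv h (x 0) ^ 2))⁻¹ *
    (-(deriv h (x 0)) * fderivWithin ℝ g (closure (funnel d h)) x (EuclideanSpace.single 0 1)
      + ∑ i, if i = 0 then 0 else
          (x i / primeNorm x) *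
            fderivWithin ℝ g (closure (funnel d h)) x (EuclideanSpace.single i 1))

/-- The bistable nonlinearity `f`, of class `C^{1,1}`, with positive mass, extended affinely
outside `[0,1]`. -/
structure Bistable (f : ℝ → ℝ) (θ : ℝ) : Prop where
  smooth : ContDiff ℝ 1 f
  lip_deriv : ∃ C : NNReal, LipschitzWith C (deriv f)
  f0 : f 0 = 0
  f1 : f 1 = 0
  df0 : deriv f 0 < 0
  df1 : deriv f 1 < 0
  θmem : θ ∈ Ioo (0 : ℝ) 1
  neg : ∀ s ∈ Ioo (0 : ℝ) θ, f s < 0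
  pos : ∀ s ∈ Ioo θ (1 : ℝ), 0 < f s
  dθ : 0 < deriv f θ
  mass : 0 < ∫ s in (0 : ℝ)..1, f s
  ext_neg : ∀ s < (0 : ℝ), f s = deriv f 0 * s
  ext_pos : ∀ s > (1 : ℝ), f s = deriv f 1 * (s - 1)

/-- The planar traveling front `φ(x₁ - ct)`: `φ'' + cφ' + f(φ) = 0`, `φ(-∞) = 1`,
`φ(+∞) = 0`, `0 < φ < 1`, `φ` decreasing, normalized by `φ(0) = θ`, with speed `c > 0`. -/
structure PlanarFront (f : ℝ → ℝ) (θ c : ℝ) (φ : ℝ → ℝ) : Prop where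
  cpos : 0 < c
  mem : ∀ z : ℝ, φ z ∈ Ioo (0 : ℝ) 1
  smooth : ContDiff ℝ 2 φ
  anti : StrictAnti φ
  ode : ∀ z : ℝ, deriv (deriv φ) z + c * deriv φ z + f (φ z) = 0
  lim_bot : Tendsto φ atBot (nhds 1)
  lim_top : Tendsto φ atTop (nhds 0)
  pin : φ 0 = θ

/-- `h : ℝ → ℝ` defines a funnel-shaped domain `Ω_{R,α}` (of dimension `N = d+1 ≥ 2`) with
cylinder radius `R`, opening angle `α` and transition parameter `L`. -/
structure IsFunnel (d : ℕ) (R α L : ℝ) (h : ℝ → ℝ) : Prop where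
  dpos : 1 ≤ d
  Rpos : 0 < R
  αmem : α ∈ Ico (0 : ℝ) (Real.pi / 2)
  RL : R < L
  smooth : ContDiff ℝ 2 h
  holder : ∃ β : NNReal, 0 < β ∧ (β : ℝ) < 1 ∧ ∃ C : NNReal, HolderWith C β (deriv (deriv h))
  deriv_nonneg : ∀ x : ℝ, 0 ≤ deriv h x
  deriv_le : ∀ x : ℝ, deriv h x ≤ Real.tan α
  left : ∀ x ≤ (0 : ℝ), h x = R
  right : ∀ x : ℝ, L * Real.cos α ≤ x → h x = x * Real.tan α

/-- An entire solution of `u_t = Δu + f(u)` in `ℝ × Ω̄` (with values in `[0,1]`),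
Neumann boundary condition `ν·∇u = 0` on `ℝ × ∂Ω`, emanating from the planar front
`φ(x₁ - ct)` as `t → -∞`. -/
structure IsEntireSolution (d : ℕ) (h f : ℝ → ℝ) (c : ℝ) (φ : ℝ → ℝ)
    (u : ℝ → Euc d → ℝ) : Prop where
  range01 : ∀ t : ℝ, ∀ x ∈ closure (funnel d h), u t x ∈ Icc (0 : ℝ) 1
  time_diff : ∀ x ∈ closure (funnel d h), Differentiable ℝ fun t => u t x
  space_reg : ∀ t : ℝ, ContDiffOn ℝ 2 (u t) (closure (funnel d h))
  pde : ∀ t : ℝ, ∀ x ∈ closure (funnel d h),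
      deriv (fun s => u s x) t = lapW (closure (funnel d h)) (u t) x + f (u t x)
  neumann : ∀ t : ℝ, ∀ x ∈ frontier (funnel d h), neumannLHS h (u t) x = 0
  past : ∀ ε > (0 : ℝ), ∃ T : ℝ, ∀ t ≤ T, ∀ x ∈ closure (funnel d h),
      |u t x - φ (x 0 - c * t)| ≤ ε

/-- Complete propagation: `u(t,x) → 1` as `t → +∞` locally uniformly in `x ∈ Ω̄`. -/
def CompletePropagation (d : ℕ) (h : ℝ → ℝ) (u : ℝ → Euc d → ℝ) : Prop :=
  TendstoLocallyUniformlyOn u (fun _ => (1 : ℝ)) atTop (closure (funnel d h))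

/-- Blocking: `u(t,·)` converges uniformly on `Ω̄`, as `t → +∞`, to a stationary solution
`u_∞` with `u_∞(x) → 0` as `x₁ → +∞`. -/
def Blocked (d : ℕ) (h f : ℝ → ℝ) (u : ℝ → Euc d → ℝ) : Prop :=
  ∃ uinf : Euc d → ℝ,
    TendstoUniformlyOn u uinf atTop (closure (funnel d h)) ∧
    ContDiffOn ℝ 2 uinf (closure (funnel d h)) ∧
    (∀ x ∈ closure (funnel d h), lapW (closure (funnel d h)) uinf x + f (uinf x) = 0) ∧
    (∀ x ∈ frontier (funnel d h), neumannLHS h uinf x = 0) ∧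
    (∀ ε > (0 : ℝ), ∃ A : ℝ, ∀ x ∈ closure (funnel d h), A ≤ x 0 → |uinf x| ≤ ε)

/-- Stability of a solution `U` of `ΔU + f(U) = 0` on `s̄`:
`∫_s (|∇ψ|² - f'(U)ψ²) ≥ 0` for all compactly supported `C¹` functions `ψ`. -/
def StableOn {d : ℕ} (s : Set (Euc d)) (f : ℝ → ℝ) (U : Euc d → ℝ) : Prop :=
  ∀ ψ : Euc d → ℝ, ContDiff ℝ 1 ψ → HasCompactSupport ψ →
    0 ≤ ∫ x in s, (‖gradient ψ x‖ ^ 2 - deriv f (U x) * ψ x ^ 2)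

/-- The `i`-th vector of the canonical basis. -/
abbrev basisVec {d : ℕ} (i : Fin (d + 1)) : Euc d := EuclideanSpace.single i 1

/-- The derivative of `g` in the direction `v`, as a function of the point. -/
def dirDeriv {d : ℕ} (v : Euc d) (g : Euc d → ℝ) (x : Euc d) : ℝ := fderiv ℝ g x v

/-- The Laplacian on the whole space. -/
def lap {d : ℕ} (g : Euc d → ℝ) (x : Euc d) : ℝ :=
  ∑ i, dirDeriv (basisVec i) (dirDeriv (basisVec i) g) x

section Calculus

variable {d : ℕ}

lemma lapW_univ (g : Euc d → ℝ) (x : Euc d) : lapW Set.univ g x = lap g x := by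
  simp only [lapW, lap, fderivWithin_univ]
  rfl

lemma ContDiff.dirDeriv {n m : WithTop ℕ∞} {g : Euc d → ℝ} (hg : ContDiff ℝ n g)
    (hmn : m + 1 ≤ n) (v : Euc d) : ContDiff ℝ m (dirDeriv v g) :=
  (hg.fderiv_right hmn).clm_apply contDiff_const

lemma HasCompactSupport.dirDeriv {g : Euc d → ℝ} (hg : HasCompactSupport g) (v : Euc d) :
    HasCompactSupport (dirDeriv v g) :=
  hg.fderiv_apply ℝ v

lemma dirDeriv_dirDeriv_eq {g : Euc d → ℝ} (hg : ContDiff ℝ 2 g) (v w x : Euc d) :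
    dirDeriv w (dirDeriv v g) x = fderiv ℝ (fderiv ℝ g) x w v := by
  have h1 : ContDiff ℝ 1 (fderiv ℝ g) := hg.fderiv_right (by norm_num)
  have := ((h1.differentiable (by norm_num) x).hasFDerivAt.clm_apply
    (hasFDerivAt_const v x)).fderiv
  simp only [dirDeriv]
  erw [this]
  simp

lemma dirDeriv_comm {g : Euc d → ℝ} (hg : ContDiff ℝ 2 g) (v w x : Euc d) :
    dirDeriv w (dirDeriv v g) x = dirDeriv v (dirDeriv w g) x := by
  rw [dirDeriv_dirDeriv_eq hg, dirDeriv_dirDeriv_eq hg]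
  exact (hg.contDiffAt.isSymmSndFDerivAt (by simp)) w v

lemma dirDeriv_eq_sum (g : Euc d → ℝ) (v x : Euc d) :
    dirDeriv v g x = ∑ i, v i * dirDeriv (basisVec i) g x := by
  have : v = ∑ i, v i • basisVec (d := d) i := by
    simpa [EuclideanSpace.basisFun_apply] using
      ((EuclideanSpace.basisFun (Fin (d + 1)) ℝ).sum_repr v).symm
  unfold dirDeriv
  conv_lhs => rw [this]
  simp

lemma norm_gradient_sq (g : Euc d → ℝ) (x : Euc d) :
    ‖gradient g x‖ ^ 2 = ∑ i, dirDeriv (basisVec i) g x ^ 2 := by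
  rw [EuclideanSpace.norm_sq_eq]
  refine Finset.sum_congr rfl fun i _ => ?_
  have h : (gradient g x) i = dirDeriv (basisVec i) g x := by
    have h1 : inner ℝ (gradient g x) (basisVec i) = fderiv ℝ g x (basisVec i) := by
      simp [gradient]
    rw [dirDeriv, ← h1, EuclideanSpace.inner_single_right]
    simp
  rw [h, Real.norm_eq_abs, sq_abs]

lemma hasDerivAt_line {g : Euc d → ℝ} (hg : Differentiable ℝ g) (x v : Euc d) (t : ℝ) :
    HasDerivAt (fun s : ℝ => g (x + s • v)) (dirDeriv v g (x + t • v)) t := by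
  have h1 : HasDerivAt (fun s : ℝ => x + s • v) v t := by
    simpa using ((hasDerivAt_id t).smul_const v).const_add x
  exact (hg (x + t • v)).hasFDerivAt.comp_hasDerivAt t h1

lemma dirDeriv_comp_add_left (v p : Euc d) (g : Euc d → ℝ) (x : Euc d) :
    dirDeriv v (fun y => g (p + y)) x = dirDeriv v g (p + x) := by
  simp only [dirDeriv]
  rw [fderiv_comp_add_left]

lemma lap_comp_add_left (p : Euc d) (g : Euc d → ℝ) (x : Euc d) :
    lap (fun y => g (p + y)) x = lap g (p + x) := by
  unfold lap
  refine Finset.sum_congr rfl fun i _ => ?_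
  have : dirDeriv (basisVec i) (fun y => g (p + y))
      = fun y => dirDeriv (basisVec i) g (p + y) := by
    funext y; exact dirDeriv_comp_add_left _ _ _ _
  rw [this, dirDeriv_comp_add_left]

lemma dirDeriv_add {g h : Euc d → ℝ} (hg : Differentiable ℝ g) (hh : Differentiable ℝ h)
    (v x : Euc d) :
    dirDeriv v (fun y => g y + h y) x = dirDeriv v g x + dirDeriv v h x := by
  simp only [dirDeriv]
  rw [fderiv_fun_add (hg x) (hh x)]
  rfl

lemma dirDeriv_sub {g h : Euc d → ℝ} (hg : Differentiable ℝ g) (hh : Differentiable ℝ h)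
    (v x : Euc d) :
    dirDeriv v (fun y => g y - h y) x = dirDeriv v g x - dirDeriv v h x := by
  simp only [dirDeriv]
  rw [fderiv_fun_sub (hg x) (hh x)]
  rfl

lemma dirDeriv_const_mul {g : Euc d → ℝ} (hg : Differentiable ℝ g) (c : ℝ) (v x : Euc d) :
    dirDeriv v (fun y => c * g y) x = c * dirDeriv v g x := by
  simp only [dirDeriv]
  rw [fderiv_const_mul (hg x)]
  rfl

lemma dirDeriv_mul {g h : Euc d → ℝ} (hg : Differentiable ℝ g) (hh : Differentiable ℝ h)
    (v x : Euc d) :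
    dirDeriv v (fun y => g y * h y) x = g x * dirDeriv v h x + h x * dirDeriv v g x := by
  simp only [dirDeriv]
  rw [fderiv_fun_mul (hg x) (hh x)]
  rfl

lemma dirDeriv_comp_real {φ : ℝ → ℝ} {g : Euc d → ℝ} (hφ : Differentiable ℝ φ)
    (hg : Differentiable ℝ g) (v x : Euc d) :
    dirDeriv v (fun y => φ (g y)) x = deriv φ (g x) * dirDeriv v g x := by
  have h := (hφ (g x)).hasDerivAt.comp_hasFDerivAt x (hg x).hasFDerivAt
  have h2 : fderiv ℝ (fun y => φ (g y)) x = deriv φ (g x) • fderiv ℝ g x := h.fderiv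
  simp only [dirDeriv]
  rw [h2]
  rfl

lemma lap_sub {g h : Euc d → ℝ} (hg : ContDiff ℝ 2 g) (hh : ContDiff ℝ 2 h) (x : Euc d) :
    lap (fun y => g y - h y) x = lap g x - lap h x := by
  unfold lap
  rw [← Finset.sum_sub_distrib]
  refine Finset.sum_congr rfl fun i _ => ?_
  have : dirDeriv (basisVec i) (fun y => g y - h y)
      = fun y => dirDeriv (basisVec i) g y - dirDeriv (basisVec i) h y := by
    funext y
    exact dirDeriv_sub (hg.differentiable (by norm_num)) (hh.differentiable (by norm_num)) _ _
  rw [this, dirDeriv_sub ((hg.dirDeriv (m := 1) (by norm_num) _).differentiable (by norm_num))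
    ((hh.dirDeriv (m := 1) (by norm_num) _).differentiable (by norm_num))]

lemma lap_const_mul {g : Euc d → ℝ} (hg : ContDiff ℝ 2 g) (c : ℝ) (x : Euc d) :
    lap (fun y => c * g y) x = c * lap g x := by
  unfold lap
  rw [Finset.mul_sum]
  refine Finset.sum_congr rfl fun i _ => ?_
  have : dirDeriv (basisVec i) (fun y => c * g y)
      = fun y => c * dirDeriv (basisVec i) g y := by
    funext y
    exact dirDeriv_const_mul (hg.differentiable (by norm_num)) _ _ _
  rw [this, dirDeriv_const_mul
    ((hg.dirDeriv (m := 1) (by norm_num) _).differentiable (by norm_num))]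

/-- At a local maximum of a `C²` function the Laplacian is nonpositive. -/
lemma lap_nonpos_of_isLocalMax {z : Euc d → ℝ} (hz : ContDiff ℝ 2 z) {y : Euc d}
    (hy : IsLocalMax z y) : lap z y ≤ 0 := by
  refine Finset.sum_nonpos fun i _ => ?_
  by_contra! hpos
  set e : Euc d := basisVec i
  set g : ℝ → ℝ := fun s => z (y + s • e) with hg
  have hd1 : deriv g = fun t => dirDeriv e z (y + t • e) := by
    funext t
    exact (hasDerivAt_line (hz.differentiable (by norm_num)) y e t).deriv
  have hd2 : deriv (deriv g) 0 = dirDeriv e (dirDeriv e z) y := by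
    rw [hd1]
    simpa using (hasDerivAt_line
      ((hz.dirDeriv (m := 1) (by norm_num) e).differentiable (by norm_num)) y e 0).deriv
  have hcont : Continuous fun s : ℝ => y + s • e := by fun_prop
  have htend : Tendsto (fun s : ℝ => y + s • e) (𝓝 0) (𝓝 y) := by
    simpa using hcont.tendsto 0
  have hmax : IsLocalMax g 0 := by
    have := htend.eventually hy
    filter_upwards [this] with s hs
    simpa [hg] using hs
  have hmin : IsLocalMin g 0 := by
    refine isLocalMin_of_deriv_deriv_pos (by rw [hd2]; exact hpos) hmax.deriv_eq_zero ?_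
    exact (hz.continuous.comp hcont).continuousAt
  have hconst : g =ᶠ[𝓝 0] fun _ => g 0 := by
    filter_upwards [hmax, hmin] with s h1 h2
    exact le_antisymm h1 h2
  have h0 : deriv (deriv g) 0 = 0 := by
    have := hconst.deriv
    rw [this.deriv_eq]
    simp
  rw [hd2] at h0
  exact hpos.ne' h0

lemma dirDeriv_comp_reflection (i j : Fin (d + 1)) {g : Euc d → ℝ} (hg : Differentiable ℝ g)
    (x : Euc d) :
    dirDeriv (basisVec j) (fun y => g (y - (2 * y i) • basisVec i)) x
      = (if j = i then -1 else 1) *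
        dirDeriv (basisVec j) g (x - (2 * x i) • basisVec i) := by
  set A : Euc d →L[ℝ] Euc d := ContinuousLinearMap.id ℝ _ -
    ((2 : ℝ) • (EuclideanSpace.proj i : Euc d →L[ℝ] ℝ)).smulRight (basisVec i) with hA
  have hAy : ∀ y : Euc d, A y = y - (2 * y i) • basisVec i := by
    intro y; simp [hA]
  have h1 : (fun y => g (y - (2 * y i) • basisVec i)) = g ∘ A := by
    funext y; simp [hAy]
  have h2 : fderiv ℝ (g ∘ A) x = (fderiv ℝ g (A x)).comp A := by
    rw [fderiv_comp x (hg (A x)) A.differentiableAt, A.fderiv]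
  rw [h1]
  simp only [dirDeriv]
  rw [h2, ← hAy, ContinuousLinearMap.comp_apply, hAy (basisVec j)]
  by_cases hji : j = i
  · subst hji
    simp only [basisVec, PiLp.single_apply, if_true, mul_one, map_sub, map_smul, smul_eq_mul]
    ring
  · simp [basisVec, hji, Ne.symm hji]

lemma lap_comp_reflection (i : Fin (d + 1)) {g : Euc d → ℝ} (hg : ContDiff ℝ 2 g) (x : Euc d) :
    lap (fun y => g (y - (2 * y i) • basisVec i)) x = lap g (x - (2 * x i) • basisVec i) := by
  unfold lap
  refine Finset.sum_congr rfl fun j _ => ?_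
  have h1 : dirDeriv (basisVec j) (fun y => g (y - (2 * y i) • basisVec i))
      = fun y => (if j = i then -1 else 1) *
        (fun y => dirDeriv (basisVec j) g (y - (2 * y i) • basisVec i)) y := by
    funext y
    exact dirDeriv_comp_reflection i j (hg.differentiable (by norm_num)) y
  have hd : Differentiable ℝ (dirDeriv (basisVec j) g) :=
    (hg.dirDeriv (m := 1) (by norm_num) _).differentiable (by norm_num)
  rw [h1, dirDeriv_const_mul, dirDeriv_comp_reflection i j hd]
  · split_ifs <;> ring
  · intro y
    have : DifferentiableAt ℝ (fun y : Euc d => y - (2 * y i) • (basisVec i : Euc d)) y := by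
      fun_prop
    exact (hd _).comp y this

lemma dirDeriv_basisVec_coord (i j : Fin (d + 1)) (x : Euc d) :
    dirDeriv (basisVec j) (fun y => y i) x = if i = j then 1 else 0 := by
  have h : (fun y : Euc d => y i) = (EuclideanSpace.proj i : Euc d →L[ℝ] ℝ) := by
    funext y; simp
  simp only [dirDeriv]
  rw [h, ContinuousLinearMap.fderiv]
  simp [PiLp.single_apply]

lemma dirDeriv_norm_sq (v x : Euc d) :
    dirDeriv v (fun y => ‖y‖ ^ 2) x = 2 * inner ℝ x v := by
  simp only [dirDeriv]
  rw [fderiv_norm_sq_apply]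
  simp

lemma lap_norm_sq (x : Euc d) : lap (fun y => ‖y‖ ^ 2) x = 2 * ((d : ℝ) + 1) := by
  have h : ∀ j : Fin (d + 1), dirDeriv (basisVec j) (fun y : Euc d => ‖y‖ ^ 2)
      = fun y => 2 * y j := by
    intro j; funext y
    rw [dirDeriv_norm_sq]
    simp [EuclideanSpace.inner_single_right]
  simp only [lap, h]
  have h2 : ∀ j : Fin (d + 1), dirDeriv (basisVec j) (fun y : Euc d => 2 * y j) x = 2 := by
    intro j
    rw [dirDeriv_const_mul (by fun_prop), dirDeriv_basisVec_coord]
    simp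
  simp [h2]
  ring

end Calculus

section GradientBound

variable {d : ℕ}

lemma le_halfBall_barrier (i : Fin (d + 1)) {v : Euc d → ℝ} (hv : ContDiff ℝ 2 v) {M K : ℝ}
    (hM : ∀ x, v x ≤ M) (hM0 : 0 ≤ M) (hK0 : 0 ≤ K) (hK : ∀ x, -K ≤ lap v x)
    (h0 : ∀ x : Euc d, x i = 0 → v x ≤ 0) {y : Euc d} (hy : ‖y‖ ≤ 1) (hyi : 0 ≤ y i) :
    v y ≤ M * ‖y‖ ^ 2 + (((d : ℝ) + 1) * M + K + 1) * (y i * (2 - y i)) := by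
  set lam : ℝ := ((d : ℝ) + 1) * M + K + 1 with hlam
  have hlam0 : 0 ≤ lam := by positivity
  set b : Euc d → ℝ := fun y => M * ‖y‖ ^ 2 - lam * (y i * (y i - 2)) with hb
  have hb1 : ContDiff ℝ 2 (fun y : Euc d => ‖y‖ ^ 2) := contDiff_norm_sq ℝ
  have hb2 : ContDiff ℝ 2 (fun y : Euc d => y i * (y i - 2)) := by fun_prop
  have hbs : ContDiff ℝ 2 b := (contDiff_const.mul hb1).sub (contDiff_const.mul hb2)
  have hlap2 : ∀ x : Euc d, lap (fun y : Euc d => y i * (y i - 2)) x = 2 := by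
    intro x
    have h1 : ∀ j : Fin (d + 1), dirDeriv (basisVec j) (fun y : Euc d => y i * (y i - 2))
        = fun y => (if i = j then 2 else 0) * (y i - 1) := by
      intro j; funext z
      rw [dirDeriv_mul (by fun_prop) (by fun_prop), dirDeriv_sub (by fun_prop) (by fun_prop),
        dirDeriv_basisVec_coord]
      simp only [dirDeriv, fderiv_const_apply]
      split_ifs <;> simp
      ring
    have h2 : ∀ j : Fin (d + 1),
        dirDeriv (basisVec j) (fun y : Euc d => (if i = j then 2 else 0) * (y i - 1)) x
          = if i = j then 2 else 0 := by
      intro j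
      rw [dirDeriv_const_mul (by fun_prop), dirDeriv_sub (by fun_prop) (by fun_prop),
        dirDeriv_basisVec_coord]
      simp only [dirDeriv, fderiv_const_apply]
      split_ifs <;> simp
    simp only [lap, h1, h2]
    simp
  have hlapb : ∀ x, lap b x = M * (2 * ((d : ℝ) + 1)) - lam * 2 := by
    intro x
    rw [hb, lap_sub (contDiff_const.mul hb1) (contDiff_const.mul hb2),
      lap_const_mul hb1, lap_const_mul hb2, lap_norm_sq, hlap2]
  set z : Euc d → ℝ := fun y => v y - b y with hz
  have hzs : ContDiff ℝ 2 z := hv.sub hbs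
  have hzlap : ∀ x, 0 < lap z x := by
    intro x
    rw [hz, lap_sub hv hbs, hlapb]
    have := hK x
    rw [hlam]
    nlinarith
  set D : Set (Euc d) := {y | ‖y‖ ≤ 1 ∧ 0 ≤ y i} with hD
  have hDc : IsCompact D := by
    refine (isCompact_closedBall (0 : Euc d) 1).of_isClosed_subset ?_ ?_
    · exact (isClosed_le continuous_norm continuous_const).inter
        (isClosed_le continuous_const (by fun_prop : Continuous fun y : Euc d => y i))
    · intro y hy; simpa using hy.1
  obtain ⟨m, hmD, hm⟩ := hDc.exists_isMaxOn ⟨0, by simp [hD]⟩ hzs.continuous.continuousOn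
  have hmi : m i ≤ 1 := (le_abs_self _).trans ((PiLp.norm_apply_le m i).trans hmD.1)
  have hneg : z m ≤ 0 := by
    rcases eq_or_lt_of_le hmD.1 with h1 | h1
    · have : M ≤ b m := by
        simp only [hb, h1]
        nlinarith [mul_nonneg hlam0 (mul_nonneg hmD.2 (by linarith : (0 : ℝ) ≤ 2 - m i))]
      have := hM m
      simp only [hz]; linarith
    · rcases eq_or_lt_of_le hmD.2 with h2 | h2
      · have h3 := h0 m h2.symm
        have : 0 ≤ b m := by
          simp only [hb, ← h2]
          nlinarith [mul_nonneg hM0 (sq_nonneg ‖m‖)]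
        simp only [hz]; linarith
      · exfalso
        have hloc : IsLocalMax z m := by
          have hDn : D ∈ 𝓝 m := by
            have ho : IsOpen {y : Euc d | ‖y‖ < 1 ∧ 0 < y i} :=
              (isOpen_lt continuous_norm continuous_const).inter
                (isOpen_lt continuous_const (by fun_prop : Continuous fun y : Euc d => y i))
            filter_upwards [ho.mem_nhds ⟨h1, h2⟩] with y hy
            exact ⟨hy.1.le, hy.2.le⟩
          exact hm.isLocalMax hDn
        exact absurd (lap_nonpos_of_isLocalMax hzs hloc) (not_le.mpr (hzlap m))
  have h5 : z y ≤ z m := hm ⟨hy, hyi⟩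
  have h6 : z y = v y - (M * ‖y‖ ^ 2 - lam * (y i * (y i - 2))) := rfl
  nlinarith

/-- Interior gradient bound for bounded `C²` functions with bounded Laplacian. -/
lemma dirDeriv_basisVec_le {u : Euc d → ℝ} (hu : ContDiff ℝ 2 u) {M K : ℝ}
    (hM : ∀ x, |u x| ≤ M) (hK : ∀ x, |lap u x| ≤ K) (i : Fin (d + 1)) (x : Euc d) :
    dirDeriv (basisVec i) u x ≤ 2 * (((d : ℝ) + 1) * M + K + 1) := by
  have hM0 : 0 ≤ M := (abs_nonneg _).trans (hM x)
  have hK0 : 0 ≤ K := (abs_nonneg _).trans (hK x)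
  set lam : ℝ := ((d : ℝ) + 1) * M + K + 1 with hlam
  set g : Euc d → ℝ := fun y => u (x + y) with hg
  have hgs : ContDiff ℝ 2 g := hu.comp (contDiff_const.add contDiff_id)
  set gr : Euc d → ℝ := fun y => g (y - (2 * y i) • basisVec i) with hgr
  have hgrs : ContDiff ℝ 2 gr := hgs.comp (by fun_prop)
  set v : Euc d → ℝ := fun y => (1 / 2) * (g y - gr y) with hv
  have hvs : ContDiff ℝ 2 v := contDiff_const.mul (hgs.sub hgrs)
  have hlv : ∀ y, -K ≤ lap v y := by
    intro y
    rw [hv, lap_const_mul (hgs.sub hgrs), lap_sub hgs hgrs, hgr, lap_comp_reflection i hgs, hg,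
      lap_comp_add_left, lap_comp_add_left]
    have h1 := abs_le.mp (hK (x + y))
    have h2 := abs_le.mp (hK (x + (y - (2 * y i) • basisVec i)))
    linarith [h1.1, h2.2]
  have hvM : ∀ y, v y ≤ M := by
    intro y
    have h1 := abs_le.mp (hM (x + y))
    have h2 := abs_le.mp (hM (x + (y - (2 * y i) • basisVec i)))
    simp only [hv, hg, hgr]
    linarith [h1.2, h2.1]
  have hv0 : ∀ y : Euc d, y i = 0 → v y ≤ 0 := by
    intro y hy
    simp [hv, hgr, hy]
  have hdv : dirDeriv (basisVec i) v 0 = dirDeriv (basisVec i) u x := by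
    rw [hv, dirDeriv_const_mul ((hgs.sub hgrs).differentiable (by norm_num)),
      dirDeriv_sub (hgs.differentiable (by norm_num)) (hgrs.differentiable (by norm_num)),
      hgr, dirDeriv_comp_reflection i i (hgs.differentiable (by norm_num)), hg]
    simp only [dirDeriv_comp_add_left]
    simp
    ring
  have hderiv := hasDerivAt_line (hvs.differentiable (by norm_num)) 0 (basisVec i) 0
  simp only [zero_add, zero_smul] at hderiv
  rw [hdv] at hderiv
  have hslope := (hasDerivWithinAt_iff_tendsto_slope.mp
    (hderiv.hasDerivWithinAt (s := Ioi 0)))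
  have hset : (Ioi (0 : ℝ)) \ {0} = Ioi 0 := by simp
  rw [hset] at hslope
  have hlim : Tendsto (fun t : ℝ => M * t + 2 * lam) (𝓝[>] 0) (𝓝 (2 * lam)) := by
    have : Tendsto (fun t : ℝ => M * t + 2 * lam) (𝓝 0) (𝓝 (M * 0 + 2 * lam)) :=
      (by fun_prop : Continuous fun t : ℝ => M * t + 2 * lam).tendsto 0
    simp only [mul_zero, zero_add] at this
    exact this.mono_left nhdsWithin_le_nhds
  refine le_of_tendsto_of_tendsto hslope hlim ?_
  have hev : ∀ᶠ t : ℝ in 𝓝[>] 0, t ∈ Ioo (0 : ℝ) 1 := Ioo_mem_nhdsGT one_pos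
  filter_upwards [hev] with t ht
  have hb := le_halfBall_barrier i hvs hvM hM0 hK0 hlv hv0 (y := t • basisVec i)
    (by simp [norm_smul, abs_of_pos ht.1]; exact ht.2.le) (by simp; exact ht.1.le)
  have hv00 : v 0 = 0 := by simp [hv, hgr]
  rw [slope_def_field]
  simp only [zero_smul, hv00, sub_zero]
  rw [div_le_iff₀ ht.1]
  have h1 : ‖(t • basisVec i : Euc d)‖ = t := by
    simp [norm_smul, abs_of_pos ht.1]
  have h2 : (t • basisVec i : Euc d) i = t := by simp
  rw [h1, h2] at hb
  have hlam0 : 0 ≤ lam := by positivity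
  nlinarith [mul_nonneg hlam0 (sq_nonneg t)]

lemma abs_dirDeriv_basisVec_le {u : Euc d → ℝ} (hu : ContDiff ℝ 2 u) {M K : ℝ}
    (hM : ∀ x, |u x| ≤ M) (hK : ∀ x, |lap u x| ≤ K) (i : Fin (d + 1)) (x : Euc d) :
    |dirDeriv (basisVec i) u x| ≤ 2 * (((d : ℝ) + 1) * M + K + 1) := by
  rw [abs_le']
  refine ⟨dirDeriv_basisVec_le hu hM hK i x, ?_⟩
  have h := dirDeriv_basisVec_le (u := fun y => -1 * u y) (contDiff_const.mul hu) (M := M) (K := K)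
    (by simpa using hM) (fun y => by rw [lap_const_mul hu]; simpa using hK y) i x
  rw [dirDeriv_const_mul (hu.differentiable (by norm_num))] at h
  linarith

lemma abs_dirDeriv_le {u : Euc d → ℝ} {C : ℝ}
    (hC : ∀ i x, |dirDeriv (basisVec i) u x| ≤ C) (v x : Euc d) :
    |dirDeriv v u x| ≤ ((d : ℝ) + 1) * C * ‖v‖ := by
  rw [dirDeriv_eq_sum]
  refine (Finset.abs_sum_le_sum_abs _ _).trans ?_
  have h : ∀ i ∈ Finset.univ, |v i * dirDeriv (basisVec i) u x| ≤ ‖v‖ * C := by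
    intro i _
    rw [abs_mul]
    exact mul_le_mul (PiLp.norm_apply_le v i) (hC i x) (abs_nonneg _) (norm_nonneg _)
  refine (Finset.sum_le_sum h).trans ?_
  simp
  ring_nf
  rfl

end GradientBound

/-- Stable classical solutions of `ΔU + f(U) = 0` in the whole space with values in `[0,1]`. -/
structure IsStableSol {d : ℕ} (f : ℝ → ℝ) (U : Euc d → ℝ) : Prop where
  smooth : ContDiff ℝ 2 U
  range : ∀ x, U x ∈ Icc (0 : ℝ) 1
  pde : ∀ x, lap U x + f (U x) = 0
  stable : StableOn Set.univ f U

/-- Uniform bounds, by `K`, on the first two derivatives of `U` and on the Lipschitz constant of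
the second ones. -/
structure HasC21Bound {d : ℕ} (K : ℝ) (U : Euc d → ℝ) : Prop where
  first : ∀ v x, |dirDeriv v U x| ≤ K * ‖v‖
  second : ∀ v w x, |dirDeriv w (dirDeriv v U) x| ≤ K * ‖v‖ * ‖w‖
  third : ∀ v w x y, |dirDeriv w (dirDeriv v U) x - dirDeriv w (dirDeriv v U) y|
    ≤ K * ‖v‖ * ‖w‖ * ‖x - y‖

section Regularity

variable {d : ℕ}

lemma abs_sub_le_of_dirDeriv_le {g : Euc d → ℝ} (hg : Differentiable ℝ g) {C : ℝ} (hC0 : 0 ≤ C)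
    (hC : ∀ v x, |dirDeriv v g x| ≤ C * ‖v‖) (x y : Euc d) : |g x - g y| ≤ C * ‖x - y‖ := by
  refine Convex.norm_image_sub_le_of_norm_fderiv_le (𝕜 := ℝ) (s := Set.univ)
    (fun z _ => hg z) (fun z _ => ?_) convex_univ (mem_univ _) (mem_univ _)
  exact ContinuousLinearMap.opNorm_le_bound _ hC0 fun v => hC v z

lemma abs_dirDeriv_le_of_lipschitz {g : Euc d → ℝ} {C : ℝ} (hC0 : 0 ≤ C)
    (hC : ∀ x y, |g x - g y| ≤ C * ‖x - y‖) (v x : Euc d) : |dirDeriv v g x| ≤ C * ‖v‖ := by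
  have hl : LipschitzWith C.toNNReal g := LipschitzWith.of_dist_le_mul fun a b => by
    rw [Real.dist_eq, dist_eq_norm, Real.coe_toNNReal _ hC0]
    exact hC a b
  have h := norm_fderiv_le_of_lipschitz ℝ hl (x₀ := x)
  rw [Real.coe_toNNReal _ hC0] at h
  exact ((fderiv ℝ g x).le_opNorm v).trans (mul_le_mul_of_nonneg_right h (norm_nonneg _))

lemma abs_dirDeriv_le_of_scaled_bounds {g : Euc d → ℝ} (hg : ContDiff ℝ 2 g) {A B δ : ℝ}
    (hδ : 0 < δ) (hA : ∀ x, |g x| ≤ A * δ) (hB : ∀ x, |lap g x| ≤ B * δ) (v x : Euc d) :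
    |dirDeriv v g x| ≤ ((d : ℝ) + 1) * (2 * (((d : ℝ) + 1) * A + B + 1)) * δ * ‖v‖ := by
  have h1 : ContDiff ℝ 2 (fun y => δ⁻¹ * g y) := contDiff_const.mul hg
  have h2 : ∀ i x, |dirDeriv (basisVec i) (fun y => δ⁻¹ * g y) x|
      ≤ 2 * (((d : ℝ) + 1) * A + B + 1) := by
    refine abs_dirDeriv_basisVec_le h1 (fun y => ?_) (fun y => ?_)
    · rw [abs_mul, abs_of_pos (inv_pos.mpr hδ), inv_mul_le_iff₀ hδ, mul_comm]
      exact hA y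
    · rw [lap_const_mul hg, abs_mul, abs_of_pos (inv_pos.mpr hδ), inv_mul_le_iff₀ hδ, mul_comm]
      exact hB y
  have h3 := abs_dirDeriv_le h2 v x
  rw [dirDeriv_const_mul (hg.differentiable (by norm_num)), abs_mul,
    abs_of_pos (inv_pos.mpr hδ), inv_mul_le_iff₀ hδ] at h3
  linarith

lemma abs_secondDiff_le {G : Euc d → ℝ} (hG : Differentiable ℝ G) {L : ℝ} (hL : 0 ≤ L)
    (h : ∀ v x y, |dirDeriv v G x - dirDeriv v G y| ≤ L * ‖v‖ * ‖x - y‖) (a b x : Euc d) :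
    |G (a + (b + x)) - G (b + x) - (G (a + x) - G x)| ≤ L * ‖a‖ * ‖b‖ := by
  have hd : Differentiable ℝ (fun y => G (a + y)) := fun y =>
    (hG _).comp y (by fun_prop : DifferentiableAt ℝ (fun y : Euc d => a + y) y)
  have := abs_sub_le_of_dirDeriv_le (g := fun y => G (a + y) - G y) (hd.sub hG)
    (C := L * ‖a‖) (by positivity) (fun v y => by
      rw [dirDeriv_sub hd hG, dirDeriv_comp_add_left]
      have := h v (a + y) y
      rw [add_sub_cancel_right] at this
      linarith) (b + x) x
  rwa [add_sub_cancel_right] at this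

lemma ContDiff.comp_const_add {n : WithTop ℕ∞} {g : Euc d → ℝ} (hg : ContDiff ℝ n g) (p : Euc d) :
    ContDiff ℝ n (fun y => g (p + y)) :=
  hg.comp (contDiff_const.add contDiff_id)

lemma Bistable.exists_bounds {f : ℝ → ℝ} {θ : ℝ} (hf : Bistable f θ) :
    ∃ L : ℝ, 0 ≤ L ∧ (∀ s ∈ Icc (0 : ℝ) 1, |f s| ≤ L) ∧ (∀ s ∈ Icc (0 : ℝ) 1, |deriv f s| ≤ L) ∧
      (∀ s t, |deriv f s - deriv f t| ≤ L * |s - t|) ∧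
      (∀ s ∈ Icc (0 : ℝ) 1, ∀ t ∈ Icc (0 : ℝ) 1, |f s - f t| ≤ L * |s - t|) := by
  obtain ⟨C, hC⟩ := hf.lip_deriv
  have hd : Continuous (deriv f) := hf.smooth.continuous_deriv (by norm_num)
  obtain ⟨A, hA⟩ := (isCompact_Icc (a := (0 : ℝ)) (b := 1)).exists_bound_of_continuousOn
    hf.smooth.continuous.continuousOn
  obtain ⟨B, hB⟩ := (isCompact_Icc (a := (0 : ℝ)) (b := 1)).exists_bound_of_continuousOn
    hd.continuousOn
  have hA0 : 0 ≤ A := (norm_nonneg _).trans (hA 0 (by simp))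
  have hB0 : 0 ≤ B := (norm_nonneg _).trans (hB 0 (by simp))
  have hC0 : (0 : ℝ) ≤ C := C.2
  refine ⟨A + B + C, by positivity, fun s hs => ?_, fun s hs => ?_, fun s t => ?_,
    fun s hs t ht => ?_⟩
  · have := hA s hs; rw [Real.norm_eq_abs] at this; linarith
  · have := hB s hs; rw [Real.norm_eq_abs] at this; linarith
  · have := hC.dist_le_mul s t
    rw [Real.dist_eq, Real.dist_eq] at this
    nlinarith [abs_nonneg (s - t)]
  · have := Convex.norm_image_sub_le_of_norm_deriv_le (f := f) (s := Icc (0 : ℝ) 1)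
      (fun x _ => hf.smooth.differentiable (by norm_num) x) hB (convex_Icc 0 1) ht hs
    rw [Real.norm_eq_abs, Real.norm_eq_abs] at this
    nlinarith [abs_nonneg (s - t)]

/-- Uniform `C^{2,1}` regularity of solutions. -/
lemma IsStableSol.exists_bound {f : ℝ → ℝ} {θ : ℝ} (hf : Bistable f θ) {U : Euc d → ℝ}
    (hU : IsStableSol f U) : ∃ K : ℝ, 0 ≤ K ∧ HasC21Bound K U := by
  obtain ⟨L, hL0, hfL, hf'L, hf'lip, hflip⟩ := hf.exists_bounds
  have hdU : Differentiable ℝ U := hU.smooth.differentiable (by norm_num)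
  have hdfU : Differentiable ℝ (fun y => f (U y)) :=
    (hf.smooth.differentiable (by norm_num)).comp hdU
  have hlapU : ∀ x, lap U x = -f (U x) := fun x => by linarith [hU.pde x]
  set N : ℝ := (d : ℝ) + 1
  have hN : 0 ≤ N := by positivity
  obtain ⟨C₁, hC₁0, hC₁⟩ : ∃ C : ℝ, 0 ≤ C ∧ ∀ v x, |dirDeriv v U x| ≤ C * ‖v‖ := by
    refine ⟨N * (2 * (N * 1 + L + 1)) * 1, by positivity, fun v x => ?_⟩
    refine abs_dirDeriv_le_of_scaled_bounds hU.smooth one_pos (fun y => ?_) (fun y => ?_) v x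
    · have := hU.range y
      rw [abs_of_nonneg this.1]; linarith [this.2]
    · rw [hlapU, abs_neg, mul_one]; exact hfL _ (hU.range y)
  have hUlip := abs_sub_le_of_dirDeriv_le hdU hC₁0 hC₁
  obtain ⟨C₂, hC₂0, hC₂⟩ : ∃ C : ℝ, 0 ≤ C ∧
      ∀ v x y, |dirDeriv v U x - dirDeriv v U y| ≤ C * ‖v‖ * ‖x - y‖ := by
    refine ⟨N * (2 * (N * C₁ + L * C₁ + 1)), by positivity, fun v x y => ?_⟩
    rcases eq_or_ne x y with rfl | hxy
    · simp
    have hpos : 0 < ‖x - y‖ := norm_pos_iff.mpr (sub_ne_zero.mpr hxy)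
    have hs := hU.smooth.comp_const_add (x - y)
    have h := abs_dirDeriv_le_of_scaled_bounds (hs.sub hU.smooth) hpos (A := C₁) (B := L * C₁)
      (fun z => by simpa using hUlip (x - y + z) z)
      (fun z => by
        rw [lap_sub hs hU.smooth, lap_comp_add_left, hlapU, hlapU]
        have h1 := hflip _ (hU.range z) _ (hU.range (x - y + z))
        have h2 := hUlip z (x - y + z)
        have h3 : ‖z - (x - y + z)‖ = ‖x - y‖ := by rw [← norm_neg]; congr 1; abel
        rw [h3] at h2
        calc |-f (U (x - y + z)) - -f (U z)| = |f (U z) - f (U (x - y + z))| := by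
              congr 1; ring
          _ ≤ L * |U z - U (x - y + z)| := h1
          _ ≤ L * (C₁ * ‖x - y‖) := mul_le_mul_of_nonneg_left h2 hL0
          _ = L * C₁ * ‖x - y‖ := by ring) v y
    rw [dirDeriv_sub (hs.differentiable (by norm_num)) hdU, dirDeriv_comp_add_left,
      sub_add_cancel] at h
    exact h.trans (le_of_eq (by ring))
  have hF : ∀ v x y, |dirDeriv v (fun z => f (U z)) x - dirDeriv v (fun z => f (U z)) y|
      ≤ (L * C₁ * C₁ + L * C₂) * ‖v‖ * ‖x - y‖ := by
    intro v x y
    have hdf := hf.smooth.differentiable (by norm_num)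
    rw [dirDeriv_comp_real hdf hdU, dirDeriv_comp_real hdf hdU]
    have e : deriv f (U x) * dirDeriv v U x - deriv f (U y) * dirDeriv v U y
        = (deriv f (U x) - deriv f (U y)) * dirDeriv v U x
          + deriv f (U y) * (dirDeriv v U x - dirDeriv v U y) := by ring
    rw [e]
    refine (abs_add_le _ _).trans ?_
    rw [abs_mul, abs_mul]
    have h1 : |deriv f (U x) - deriv f (U y)| ≤ L * (C₁ * ‖x - y‖) :=
      (hf'lip _ _).trans (mul_le_mul_of_nonneg_left (hUlip x y) hL0)
    have h2 := mul_le_mul h1 (hC₁ v x) (abs_nonneg _) (by positivity)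
    have h3 := mul_le_mul (hf'L _ (hU.range y)) (hC₂ v x y) (abs_nonneg _) hL0
    linarith
  obtain ⟨C₃, hC₃0, hC₃⟩ : ∃ C : ℝ, 0 ≤ C ∧ ∀ v w x y,
      |dirDeriv w (dirDeriv v U) x - dirDeriv w (dirDeriv v U) y| ≤ C * ‖v‖ * ‖w‖ * ‖x - y‖ := by
    set C : ℝ := N * (2 * (N * C₂ + (L * C₁ * C₁ + L * C₂) + 1)) with hCdef
    have hC0 : 0 ≤ C := by positivity
    have key : ∀ v a b x, |dirDeriv v U (a + (b + x)) - dirDeriv v U (b + x)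
        - (dirDeriv v U (a + x) - dirDeriv v U x)| ≤ C * ‖v‖ * ‖a‖ * ‖b‖ := by
      intro v a b x
      rcases eq_or_ne a 0 with rfl | ha
      · simp
      rcases eq_or_ne b 0 with rfl | hb
      · simp
      have hpos : 0 < ‖a‖ * ‖b‖ := mul_pos (norm_pos_iff.mpr ha) (norm_pos_iff.mpr hb)
      have s0 := hU.smooth
      have s1 := hU.smooth.comp_const_add a
      have s2 := hU.smooth.comp_const_add b
      have s3 := s1.comp_const_add b
      have h := abs_dirDeriv_le_of_scaled_bounds ((s3.sub s2).sub (s1.sub s0)) hpos (A := C₂)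
        (B := L * C₁ * C₁ + L * C₂)
        (fun z => by
          rw [← mul_assoc]
          exact abs_secondDiff_le hdU hC₂0 hC₂ a b z)
        (fun z => by
          rw [lap_sub (s3.sub s2) (s1.sub s0), lap_sub s3 s2, lap_sub s1 s0]
          rw [lap_comp_add_left b (fun y => U (a + y))]
          simp only [lap_comp_add_left, hlapU]
          have := abs_secondDiff_le hdfU (by positivity) hF a b z
          rw [← mul_assoc]
          refine le_trans (le_of_eq ?_) this
          rw [← abs_neg]
          congr 1; ring) v x
      have dd : ∀ {g : Euc d → ℝ}, ContDiff ℝ 2 g → Differentiable ℝ g :=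
        fun hg => hg.differentiable (by norm_num)
      rw [dirDeriv_sub (dd (s3.sub s2)) (dd (s1.sub s0)), dirDeriv_sub (dd s3) (dd s2),
        dirDeriv_sub (dd s1) (dd s0), dirDeriv_comp_add_left v b (fun y => U (a + y)),
        dirDeriv_comp_add_left, dirDeriv_comp_add_left, dirDeriv_comp_add_left] at h
      exact h.trans (le_of_eq (by ring))
    refine ⟨C, hC0, fun v w x y => ?_⟩
    have hs := (hU.smooth.dirDeriv (m := 1) (by norm_num) v)
    have hs' := hs.comp_const_add (x - y)
    have h := abs_dirDeriv_le_of_lipschitz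
      (g := fun z => dirDeriv v U (x - y + z) - dirDeriv v U z) (C := C * ‖v‖ * ‖x - y‖)
      (by positivity) (fun z z' => by
        have := key v (x - y) (z - z') z'
        rwa [sub_add_cancel] at this) w y
    rw [dirDeriv_sub (hs'.differentiable (by norm_num)) (hs.differentiable (by norm_num)),
      dirDeriv_comp_add_left, sub_add_cancel] at h
    exact h.trans (le_of_eq (by ring))
  have hsecond : ∀ v w x, |dirDeriv w (dirDeriv v U) x| ≤ C₂ * ‖v‖ * ‖w‖ := fun v w x =>
    abs_dirDeriv_le_of_lipschitz (by positivity) (hC₂ v) w x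
  refine ⟨C₁ + C₂ + C₃, by positivity, ⟨fun v x => ?_, fun v w x => ?_, fun v w x y => ?_⟩⟩
  · exact (hC₁ v x).trans (mul_le_mul_of_nonneg_right (by linarith) (norm_nonneg _))
  · refine (hsecond v w x).trans ?_
    gcongr
    linarith
  · refine (hC₃ v w x y).trans ?_
    gcongr
    linarith

end Regularity

section TranslationLimit

variable {d : ℕ}

lemma integrable_of_eq_zero_off_compact {g : Euc d → ℝ} (hg : Continuous g) {S : Set (Euc d)}
    (hS : IsCompact S) (h : ∀ x ∉ S, g x = 0) : Integrable g :=
  hg.integrable_of_hasCompactSupport (HasCompactSupport.intro hS h)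

lemma dirDeriv_eq_zero_of_notMem {g : Euc d → ℝ} {x : Euc d} (hx : x ∉ tsupport g) (v : Euc d) :
    dirDeriv v g x = 0 := by
  simp [dirDeriv, fderiv_of_notMem_tsupport ℝ hx]

lemma continuous_norm_gradient_sq {ψ : Euc d → ℝ} (hψ : ContDiff ℝ 1 ψ) :
    Continuous fun x => ‖gradient ψ x‖ ^ 2 := by
  simp only [norm_gradient_sq]
  exact continuous_finsetSum _ fun i _ =>
    (hψ.dirDeriv (m := 0) (by norm_num) _).continuous.pow 2

lemma integrable_norm_gradient_sq {ψ : Euc d → ℝ} (hψ : ContDiff ℝ 1 ψ)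
    (hc : HasCompactSupport ψ) : Integrable fun x => ‖gradient ψ x‖ ^ 2 :=
  integrable_of_eq_zero_off_compact (continuous_norm_gradient_sq hψ) hc.isCompact fun x hx => by
    simp [norm_gradient_sq, dirDeriv_eq_zero_of_notMem hx]

lemma integrable_mul_sq {c ψ : Euc d → ℝ} (hcont : Continuous c) (hψ : ContDiff ℝ 1 ψ)
    (hc : HasCompactSupport ψ) : Integrable fun x => c x * ψ x ^ 2 :=
  integrable_of_eq_zero_off_compact (hcont.mul (hψ.continuous.pow 2)) hc.isCompact fun x hx => by
    simp [image_eq_zero_of_notMem_tsupport hx]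

lemma norm_sub_sub_le_of_lipschitz_fderiv {E F : Type*} [NormedAddCommGroup E] [NormedSpace ℝ E]
    [NormedAddCommGroup F] [NormedSpace ℝ F] {G : E → F} (hG : Differentiable ℝ G) {K : ℝ}
    (hK0 : 0 ≤ K) (hK : ∀ x y, ‖fderiv ℝ G x - fderiv ℝ G y‖ ≤ K * ‖x - y‖) (x y : E) :
    ‖G y - G x - fderiv ℝ G x (y - x)‖ ≤ K * ‖y - x‖ * ‖y - x‖ := by
  refine Convex.norm_image_sub_le_of_norm_fderiv_le' (𝕜 := ℝ)
    (s := Metric.closedBall x ‖y - x‖) (fun z _ => hG z) (fun z hz => ?_)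
    (convex_closedBall _ _) (by simp) (by simp [dist_eq_norm])
  refine (hK z x).trans (mul_le_mul_of_nonneg_left ?_ hK0)
  simpa [dist_eq_norm] using hz

lemma hasFDerivAt_of_norm_sub_sub_le {E F : Type*} [NormedAddCommGroup E] [NormedSpace ℝ E]
    [NormedAddCommGroup F] [NormedSpace ℝ F] {G : E → F} {A : E →L[ℝ] F} {K : ℝ} {x : E}
    (h : ∀ y, ‖G y - G x - A (y - x)‖ ≤ K * ‖y - x‖ * ‖y - x‖) : HasFDerivAt G A x := by
  rw [hasFDerivAt_iff_isLittleO]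
  have h1 : (fun y => G y - G x - A (y - x)) =O[𝓝 x] fun y => ‖y - x‖ * ‖y - x‖ :=
    Asymptotics.IsBigO.of_bound K (Eventually.of_forall fun y => by
      have := h y
      rw [norm_mul, norm_norm]; linarith)
  refine h1.trans_isLittleO ?_
  have h2 : (fun y : E => ‖y - x‖) =o[𝓝 x] fun _ => (1 : ℝ) := by
    rw [Asymptotics.isLittleO_one_iff]
    have : Continuous fun y : E => ‖y - x‖ := by fun_prop
    simpa using this.tendsto x
  simpa using (h2.mul_isBigO (Asymptotics.isBigO_refl (fun y : E => ‖y - x‖) (𝓝 x))).norm_right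

lemma exists_tendsto_of_bounded {F : Type*} [NormedAddCommGroup F] [NormedSpace ℝ F]
    [FiniteDimensional ℝ F]
    (𝒰 : Ultrafilter ℕ) {a : ℕ → F} {C : ℝ} (ha : ∀ k, ‖a k‖ ≤ C) :
    ∃ l, Tendsto a 𝒰 (𝓝 l) := by
  have := FiniteDimensional.proper_real F
  obtain ⟨l, -, hl⟩ := (isCompact_closedBall (0 : F) C).ultrafilter_le_nhds (𝒰.map a)
    (by
      rw [le_principal_iff]
      exact Filter.mem_map.mpr (Filter.univ_mem' fun k => by simpa using ha k))
  exact ⟨l, hl⟩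

lemma Filter.Tendsto.clm_apply_const {E F : Type*} [NormedAddCommGroup E] [NormedSpace ℝ E]
    [NormedAddCommGroup F] [NormedSpace ℝ F] {l : Filter ℕ} {a : ℕ → E →L[ℝ] F} {A : E →L[ℝ] F}
    (h : Tendsto a l (𝓝 A)) (v : E) : Tendsto (fun k => a k v) l (𝓝 (A v)) :=
  ((ContinuousLinearMap.apply ℝ F v).continuous.tendsto A).comp h

lemma norm_sub_le_of_tendsto {F : Type*} [NormedAddCommGroup F] {l : Filter ℕ} [l.NeBot]
    {a b : ℕ → F} {A B : F} (ha : Tendsto a l (𝓝 A)) (hb : Tendsto b l (𝓝 B)) {C : ℝ}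
    (h : ∀ k, ‖a k - b k‖ ≤ C) : ‖A - B‖ ≤ C :=
  le_of_tendsto (ha.sub hb).norm (Eventually.of_forall h)

/-- Stability is preserved by translations. -/
lemma StableOn.translate {f : ℝ → ℝ} {U : Euc d → ℝ} (h : StableOn Set.univ f U) (p : Euc d) :
    StableOn Set.univ f (fun x => U (p + x)) := by
  intro ψ hψ hc
  have h1 := h (fun x => ψ (-p + x)) (hψ.comp_const_add (-p))
    (hc.comp_homeomorph (Homeomorph.addLeft (-p)))
  rw [Measure.restrict_univ] at h1 ⊢
  rw [← integral_add_left_eq_self _ p] at h1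
  refine h1.trans (le_of_eq (integral_congr_ae (Eventually.of_forall fun x => ?_)))
  simp only [norm_gradient_sq]
  simp [dirDeriv_comp_add_left]

lemma tendsto_uniform_on_compact {𝒰 : Filter ℕ} {W : ℕ → Euc d → ℝ} {V : Euc d → ℝ} {K : ℝ}
    (hK0 : 0 ≤ K) (hW : ∀ k x y, |W k x - W k y| ≤ K * ‖x - y‖)
    (hV : ∀ x y, |V x - V y| ≤ K * ‖x - y‖)
    (hlim : ∀ x, Tendsto (fun k => W k x) 𝒰 (𝓝 (V x))) {S : Set (Euc d)} (hS : IsCompact S)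
    {ε : ℝ} (hε : 0 < ε) : ∀ᶠ k in 𝒰, ∀ x ∈ S, |W k x - V x| ≤ ε := by
  set δ : ℝ := ε / (3 * (K + 1)) with hδ
  have hδ0 : 0 < δ := by positivity
  obtain ⟨T, -, hTf, hT⟩ := (Metric.totallyBounded_iff.mp hS.totallyBounded δ hδ0).imp
    fun T h => (⟨trivial, h.1, h.2⟩ : True ∧ _ ∧ _)
  have hev : ∀ᶠ k in 𝒰, ∀ y ∈ T, |W k y - V y| < ε / 3 := by
    rw [Filter.eventually_all_finite hTf]
    intro y _
    have := Metric.tendsto_nhds.mp (hlim y) (ε / 3) (by positivity)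
    simpa [Real.dist_eq] using this
  filter_upwards [hev] with k hk x hx
  obtain ⟨y, hyT, hy⟩ := mem_iUnion₂.mp (hT hx)
  have hxy : ‖x - y‖ < δ := by simpa [dist_eq_norm] using hy
  have hKδ : K * ‖x - y‖ ≤ ε / 3 := by
    have h1 : K * ‖x - y‖ ≤ (K + 1) * δ := mul_le_mul (by linarith) hxy.le (norm_nonneg _)
      (by linarith)
    have h2 : (K + 1) * δ = ε / 3 := by rw [hδ]; field_simp
    linarith
  have h1 := hW k x y
  have h2 := hV x y
  have h3 := hk y hyT
  rw [abs_le] at h1 h2 ⊢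
  rw [abs_lt] at h3
  constructor <;> linarith [h1.1, h1.2, h2.1, h2.2, h3.1, h3.2]

/-- Translates of a stable solution converge, along an ultrafilter, to a stable solution. -/
lemma IsStableSol.exists_translation_limit {f : ℝ → ℝ} {θ : ℝ} (hf : Bistable f θ)
    {U : Euc d → ℝ} (hU : IsStableSol f U) (p : ℕ → Euc d) (𝒰 : Ultrafilter ℕ) :
    ∃ V : Euc d → ℝ, IsStableSol f V ∧
      ∀ x, Tendsto (fun k => U (p k + x)) 𝒰 (𝓝 (V x)) := by
  obtain ⟨K, hK0, hK⟩ := hU.exists_bound hf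
  have hs := hU.smooth
  have hdU : Differentiable ℝ U := hs.differentiable (by norm_num)
  have hs1 : ContDiff ℝ 1 (fderiv ℝ U) := hs.fderiv_right (by norm_num)
  have hdU1 : Differentiable ℝ (fderiv ℝ U) := hs1.differentiable (by norm_num)
  have b1 : ∀ x, ‖fderiv ℝ U x‖ ≤ K := fun x =>
    ContinuousLinearMap.opNorm_le_bound _ hK0 fun v => hK.first v x
  have b2 : ∀ x, ‖fderiv ℝ (fderiv ℝ U) x‖ ≤ K := fun x =>
    ContinuousLinearMap.opNorm_le_bound _ hK0 fun w =>
      ContinuousLinearMap.opNorm_le_bound _ (by positivity) fun v => by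
        rw [← dirDeriv_dirDeriv_eq hs, Real.norm_eq_abs]
        exact (hK.second v w x).trans (le_of_eq (by ring))
  have b3 : ∀ x y, ‖fderiv ℝ (fderiv ℝ U) x - fderiv ℝ (fderiv ℝ U) y‖ ≤ K * ‖x - y‖ :=
    fun x y =>
    ContinuousLinearMap.opNorm_le_bound _ (by positivity) fun w =>
      ContinuousLinearMap.opNorm_le_bound _ (by positivity) fun v => by
        simp only [sub_apply]
        rw [← dirDeriv_dirDeriv_eq hs, ← dirDeriv_dirDeriv_eq hs, Real.norm_eq_abs]
        exact (hK.third v w x y).trans (le_of_eq (by ring))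
  have l1 : ∀ x y, ‖fderiv ℝ U x - fderiv ℝ U y‖ ≤ K * ‖x - y‖ := fun x y =>
    Convex.norm_image_sub_le_of_norm_fderiv_le (𝕜 := ℝ) (s := Set.univ)
      (fun z _ => hdU1 z) (fun z _ => b2 z) convex_univ (mem_univ _) (mem_univ _)
  have l0 := abs_sub_le_of_dirDeriv_le hdU hK0 hK.first
  have e0 : ∀ x, ∃ l, Tendsto (fun k => U (p k + x)) 𝒰 (𝓝 l) := fun x =>
    exists_tendsto_of_bounded 𝒰 (C := 1) fun k => by
      have := hU.range (p k + x)
      rw [Real.norm_eq_abs, abs_of_nonneg this.1]; exact this.2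
  have e1 : ∀ x, ∃ l, Tendsto (fun k => fderiv ℝ U (p k + x)) 𝒰 (𝓝 l) := fun x =>
    exists_tendsto_of_bounded 𝒰 (C := K) fun k => b1 _
  have e2 : ∀ x, ∃ l, Tendsto (fun k => fderiv ℝ (fderiv ℝ U) (p k + x)) 𝒰 (𝓝 l) := fun x =>
    exists_tendsto_of_bounded (F := Euc d →L[ℝ] (Euc d →L[ℝ] ℝ)) 𝒰 (C := K) fun k => b2 _
  choose V hV using e0
  choose A hA using e1
  choose B hB using e2
  have hVA : ∀ x, HasFDerivAt V (A x) x := fun x =>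
    hasFDerivAt_of_norm_sub_sub_le (K := K) fun y => by
      refine norm_sub_le_of_tendsto ((hV y).sub (hV x))
        (Tendsto.clm_apply_const (hA x) (y - x)) fun k => ?_
      have := norm_sub_sub_le_of_lipschitz_fderiv hdU hK0 l1 (p k + x) (p k + y)
      simpa using this
  have hAB : ∀ x, HasFDerivAt A (B x) x := fun x =>
    hasFDerivAt_of_norm_sub_sub_le (K := K) fun y => by
      refine norm_sub_le_of_tendsto ((hA y).sub (hA x))
        (Tendsto.clm_apply_const (hB x) (y - x)) fun k => ?_
      have := norm_sub_sub_le_of_lipschitz_fderiv hdU1 hK0 b3 (p k + x) (p k + y)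
      simpa using this
  have hBc : Continuous B := by
    have : LipschitzWith K.toNNReal B := LipschitzWith.of_dist_le_mul fun x y => by
      rw [dist_eq_norm, dist_eq_norm, Real.coe_toNNReal _ hK0]
      refine norm_sub_le_of_tendsto (F := Euc d →L[ℝ] (Euc d →L[ℝ] ℝ)) (hB x) (hB y) fun k => ?_
      simpa using b3 (p k + x) (p k + y)
    exact this.continuous
  have hfV : fderiv ℝ V = A := funext fun x => (hVA x).fderiv
  have hfA : fderiv ℝ A = B := funext fun x => (hAB x).fderiv
  have hA1 : ContDiff ℝ 1 A := contDiff_one_iff_fderiv.mpr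
    ⟨fun x => (hAB x).differentiableAt, by rw [hfA]; exact hBc⟩
  have hV2 : ContDiff ℝ 2 V := by
    have : ContDiff ℝ (1 + 1) V := contDiff_succ_iff_fderiv.mpr
      ⟨fun x => (hVA x).differentiableAt, by simp, by rw [hfV]; exact hA1⟩
    simpa [one_add_one_eq_two] using this
  have hfc : Continuous f := hf.smooth.continuous
  have hf'c : Continuous (deriv f) := hf.smooth.continuous_deriv (by norm_num)
  have lV : ∀ x y, |V x - V y| ≤ K * ‖x - y‖ := fun x y =>
    le_of_tendsto ((hV x).sub (hV y)).norm (Eventually.of_forall fun k => by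
      simpa using l0 (p k + x) (p k + y))
  refine ⟨V, ⟨hV2, fun x => ?_, fun x => ?_, ?_⟩, hV⟩
  · exact isClosed_Icc.mem_of_tendsto (hV x) (Eventually.of_forall fun k => hU.range _)
  · have h1 : Tendsto (fun k => lap U (p k + x) + f (U (p k + x))) 𝒰
        (𝓝 (lap V x + f (V x))) := by
      refine Tendsto.add ?_ ((hfc.tendsto _).comp (hV x))
      unfold lap
      refine tendsto_finsetSum _ fun i _ => ?_
      simp only [dirDeriv_dirDeriv_eq hs, dirDeriv_dirDeriv_eq hV2, hfV, hfA]
      exact Tendsto.clm_apply_const (Tendsto.clm_apply_const (hB x) _) _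
    simp only [hU.pde] at h1
    exact tendsto_nhds_unique h1 tendsto_const_nhds
  · intro ψ hψ hc
    obtain ⟨L, hL0, -, -, hf'lip, -⟩ := hf.exists_bounds
    rw [Measure.restrict_univ]
    refine le_of_forall_pos_le_add fun ε hε => ?_
    set I : ℝ := ∫ x, ψ x ^ 2 with hI
    have hI0 : 0 ≤ I := integral_nonneg fun x => sq_nonneg _
    set δ : ℝ := ε / (L * I + 1) with hδ
    have hδ0 : 0 < δ := by positivity
    obtain ⟨k, hk⟩ := (tendsto_uniform_on_compact (𝒰 := 𝒰) (W := fun k x => U (p k + x)) hK0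
      (fun k x y => by simpa using l0 (p k + x) (p k + y)) lV hV hc.isCompact hδ0).exists
    have h1 := hU.stable.translate (p k) ψ hψ hc
    rw [Measure.restrict_univ] at h1
    have hUc : Continuous fun x => U (p k + x) := (hs.comp_const_add (p k)).continuous
    have iψ : Integrable fun x => ψ x ^ 2 := by
      simpa using integrable_mul_sq (continuous_const (y := (1 : ℝ))) hψ hc
    have i0 : Integrable fun x => ‖gradient ψ x‖ ^ 2 - deriv f (V x) * ψ x ^ 2 :=
      (integrable_norm_gradient_sq hψ hc).sub
      (integrable_mul_sq (hf'c.comp hV2.continuous) hψ hc)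
    have h2 : ∫ x, (‖gradient ψ x‖ ^ 2 - deriv f (U (p k + x)) * ψ x ^ 2)
        ≤ ∫ x, ((‖gradient ψ x‖ ^ 2 - deriv f (V x) * ψ x ^ 2) + L * δ * ψ x ^ 2) := by
      refine integral_mono ((integrable_norm_gradient_sq hψ hc).sub
        (integrable_mul_sq (hf'c.comp hUc) hψ hc)) (i0.add (iψ.const_mul _)) fun x => ?_
      by_cases hx : x ∈ tsupport ψ
      · have h3 := (hf'lip (U (p k + x)) (V x)).trans
          (mul_le_mul_of_nonneg_left (hk x hx) hL0)
        have h4 := (abs_le.mp h3).1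
        nlinarith [sq_nonneg (ψ x)]
      · simp [image_eq_zero_of_notMem_tsupport hx]
    rw [integral_add i0 (iψ.const_mul _), integral_const_mul] at h2
    have h5 : L * δ * I ≤ ε := by
      have : L * δ * I = ε * ((L * I) / (L * I + 1)) := by rw [hδ]; ring
      rw [this]
      refine mul_le_of_le_one_right hε.le ?_
      rw [div_le_one (by positivity)]; linarith
    linarith

end TranslationLimit

section Linearized

variable {d : ℕ}

/-- The pointwise inner product of the gradients of `g` and `h`. -/
def gradDot (g h : Euc d → ℝ) (x : Euc d) : ℝ :=
  ∑ i, dirDeriv (basisVec i) g x * dirDeriv (basisVec i) h x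

lemma norm_gradient_sq_eq_gradDot (g : Euc d → ℝ) (x : Euc d) :
    ‖gradient g x‖ ^ 2 = gradDot g g x := by
  rw [norm_gradient_sq]
  exact Finset.sum_congr rfl fun i _ => sq _

lemma gradDot_self_nonneg (g : Euc d → ℝ) (x : Euc d) : 0 ≤ gradDot g g x :=
  Finset.sum_nonneg fun _ _ => mul_self_nonneg _

lemma ContDiff.continuous_dirDeriv {g : Euc d → ℝ} (hg : ContDiff ℝ 1 g) (v : Euc d) :
    Continuous (_root_.dirDeriv v g) :=
  (hg.dirDeriv (m := 0) (by norm_num) v).continuous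

lemma ContDiff.continuous_lap {g : Euc d → ℝ} (hg : ContDiff ℝ 2 g) : Continuous (lap g) :=
  continuous_finsetSum _ fun _ _ =>
    (hg.dirDeriv (m := 1) (by norm_num) _).continuous_dirDeriv _

lemma continuous_gradDot {g h : Euc d → ℝ} (hg : ContDiff ℝ 1 g) (hh : ContDiff ℝ 1 h) :
    Continuous (gradDot g h) :=
  continuous_finsetSum _ fun _ _ =>
    (hg.continuous_dirDeriv _).mul (hh.continuous_dirDeriv _)

lemma gradDot_eq_zero_of_notMem_right (g : Euc d → ℝ) {h : Euc d → ℝ} {x : Euc d}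
    (hx : x ∉ tsupport h) : gradDot g h x = 0 := by
  simp [gradDot, dirDeriv_eq_zero_of_notMem hx]

lemma lap_eq_zero_of_notMem {g : Euc d → ℝ} {x : Euc d} (hx : x ∉ tsupport g) : lap g x = 0 := by
  refine Finset.sum_eq_zero fun i _ => dirDeriv_eq_zero_of_notMem (fun h => hx ?_) _
  exact closure_minimal (fun y hy => by
    by_contra hn
    exact hy (dirDeriv_eq_zero_of_notMem hn _)) (isClosed_tsupport g) h

/-- Integration by parts against a compactly supported function. -/
lemma integral_mul_dirDeriv_eq_neg {g φ : Euc d → ℝ} (hg : ContDiff ℝ 1 g) (hφ : ContDiff ℝ 1 φ)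
    (hc : HasCompactSupport φ) (v : Euc d) :
    ∫ x, g x * dirDeriv v φ x = -∫ x, dirDeriv v g x * φ x := by
  refine integral_mul_fderiv_eq_neg_fderiv_mul_of_integrable ?_ ?_ ?_
    (fun x _ => hg.differentiable one_ne_zero x) (fun x _ => hφ.differentiable one_ne_zero x)
  · exact integrable_of_eq_zero_off_compact ((hg.continuous_dirDeriv v).mul hφ.continuous)
      hc.isCompact fun x hx => by simp [image_eq_zero_of_notMem_tsupport hx]
  · exact integrable_of_eq_zero_off_compact (hg.continuous.mul (hφ.continuous_dirDeriv v))
      hc.isCompact fun x hx => by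
        rw [← dirDeriv, dirDeriv_eq_zero_of_notMem hx, mul_zero]
  · exact integrable_of_eq_zero_off_compact (hg.continuous.mul hφ.continuous)
      hc.isCompact fun x hx => by simp [image_eq_zero_of_notMem_tsupport hx]

lemma integrable_gradDot {g φ : Euc d → ℝ} (hg : ContDiff ℝ 1 g) (hφ : ContDiff ℝ 1 φ)
    (hc : HasCompactSupport φ) : Integrable (gradDot g φ) :=
  integrable_of_eq_zero_off_compact (continuous_gradDot hg hφ) hc.isCompact fun _ hx =>
    gradDot_eq_zero_of_notMem_right g hx

lemma integrable_mul_of_hasCompactSupport {g φ : Euc d → ℝ} (hg : Continuous g)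
    (hφ : Continuous φ) (hc : HasCompactSupport φ) : Integrable fun x => g x * φ x :=
  integrable_of_eq_zero_off_compact (hg.mul hφ) hc.isCompact fun x hx => by
    simp [image_eq_zero_of_notMem_tsupport hx]

lemma integral_gradDot {g φ : Euc d → ℝ} (hg : ContDiff ℝ 1 g) (hφ : ContDiff ℝ 1 φ)
    (hc : HasCompactSupport φ) : ∫ x, gradDot g φ x =
      ∑ i, ∫ x, dirDeriv (basisVec i) g x * dirDeriv (basisVec i) φ x :=
  integral_finsetSum _ fun _ _ => integrable_mul_of_hasCompactSupport
    (hg.continuous_dirDeriv _) (hφ.continuous_dirDeriv _) (hc.dirDeriv _)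

/-- Green's formula with the Laplacian on the compactly supported function. -/
lemma integral_gradDot_eq_neg_mul_lap {g φ : Euc d → ℝ} (hg : ContDiff ℝ 1 g)
    (hφ : ContDiff ℝ 2 φ) (hc : HasCompactSupport φ) :
    ∫ x, gradDot g φ x = -∫ x, g x * lap φ x := by
  have h2 : ∀ i, ContDiff ℝ 1 (dirDeriv (basisVec i) φ) := fun i => hφ.dirDeriv (by norm_num) _
  rw [integral_gradDot hg (hφ.of_le (by norm_num)) hc]
  simp only [lap, Finset.mul_sum]
  rw [integral_finsetSum _ fun i _ => integrable_mul_of_hasCompactSupport hg.continuous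
    ((h2 i).continuous_dirDeriv _) ((hc.dirDeriv _).dirDeriv _), ← Finset.sum_neg_distrib]
  refine Finset.sum_congr rfl fun i _ => ?_
  rw [integral_mul_dirDeriv_eq_neg hg (h2 i) (hc.dirDeriv _), neg_neg]

/-- Green's formula with the Laplacian on the other function. -/
lemma integral_gradDot_eq_neg_lap_mul {g φ : Euc d → ℝ} (hg : ContDiff ℝ 2 g)
    (hφ : ContDiff ℝ 1 φ) (hc : HasCompactSupport φ) :
    ∫ x, gradDot g φ x = -∫ x, lap g x * φ x := by
  have h2 : ∀ i, ContDiff ℝ 1 (dirDeriv (basisVec i) g) := fun i => hg.dirDeriv (by norm_num) _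
  rw [integral_gradDot (hg.of_le (by norm_num)) hφ hc]
  simp only [lap, Finset.sum_mul]
  rw [integral_finsetSum _ fun i _ => integrable_mul_of_hasCompactSupport
    ((h2 i).continuous_dirDeriv _) hφ.continuous hc, ← Finset.sum_neg_distrib]
  exact Finset.sum_congr rfl fun i _ => integral_mul_dirDeriv_eq_neg (h2 i) hφ hc _

lemma hasDerivAt_integral_translate {g w : Euc d → ℝ} (hg : ContDiff ℝ 1 g) (e : Euc d) {C : ℝ}
    (hC : ∀ x, |dirDeriv e g x| ≤ C) (hw : Continuous w) (hc : HasCompactSupport w) :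
    HasDerivAt (fun t : ℝ => ∫ x, g (t • e + x) * w x) (∫ x, dirDeriv e g x * w x) 0 := by
  have hcont : ∀ t : ℝ, Continuous fun x => g (t • e + x) := fun t =>
    hg.continuous.comp (by fun_prop)
  have hcont' : ∀ t : ℝ, Continuous fun x => dirDeriv e g (t • e + x) := fun t =>
    (hg.continuous_dirDeriv e).comp (by fun_prop)
  have h := (hasDerivAt_integral_of_dominated_loc_of_deriv_le (μ := (volume : Measure (Euc d)))
    (F := fun (t : ℝ) x => g (t • e + x) * w x) (x₀ := (0 : ℝ)) (s := Set.univ)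
    (bound := fun x => C * |w x|) (F' := fun t x => dirDeriv e g (t • e + x) * w x) univ_mem
    (Eventually.of_forall fun t => ((hcont t).mul hw).aestronglyMeasurable)
    (integrable_mul_of_hasCompactSupport (hcont 0) hw hc)
    ((hcont' 0).mul hw).aestronglyMeasurable
    (Eventually.of_forall fun x t _ => by
      rw [Real.norm_eq_abs, abs_mul]
      exact mul_le_mul_of_nonneg_right (hC _) (abs_nonneg _))
    ((hw.integrable_of_hasCompactSupport hc).abs.const_mul C)
    (Eventually.of_forall fun x t _ => by
      have := hasDerivAt_line (hg.differentiable one_ne_zero) x e t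
      simp only [add_comm x] at this
      exact this.mul_const _)).2
  simpa using h

/-- The weak form of the linearized equation satisfied by directional derivatives. -/
lemma IsStableSol.integral_gradDot_dirDeriv {f : ℝ → ℝ} {θ : ℝ} (hf : Bistable f θ)
    {U : Euc d → ℝ} (hU : IsStableSol f U) (e : Euc d) {φ : Euc d → ℝ} (hφ : ContDiff ℝ 1 φ)
    (hc : HasCompactSupport φ) :
    ∫ x, gradDot (dirDeriv e U) φ x = ∫ x, deriv f (U x) * dirDeriv e U x * φ x := by
  obtain ⟨K, hK0, hK⟩ := hU.exists_bound hf
  obtain ⟨L, hL0, -, hL, -, -⟩ := hf.exists_bounds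
  have hs := hU.smooth
  have hs1 : ContDiff ℝ 1 U := hs.of_le (by norm_num)
  have hD : ∀ v, ContDiff ℝ 1 (dirDeriv v U) := fun v => hs.dirDeriv (by norm_num) v
  have hfU : ContDiff ℝ 1 fun x => f (U x) := hf.smooth.comp hs1
  have hdf : ∀ x, dirDeriv e (fun y => f (U y)) x = deriv f (U x) * dirDeriv e U x := fun x =>
    dirDeriv_comp_real (hf.smooth.differentiable one_ne_zero) (hs1.differentiable one_ne_zero) e x
  have h1 := HasDerivAt.fun_sum (u := Finset.univ) fun i _ =>
    hasDerivAt_integral_translate (hD (basisVec i)) e (hK.second (basisVec i) e)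
      (hφ.continuous_dirDeriv (basisVec i)) (hc.dirDeriv _)
  have h2 := hasDerivAt_integral_translate hfU e (C := L * (K * ‖e‖)) (fun x => by
      rw [hdf, abs_mul]
      exact mul_le_mul (hL _ (hU.range x)) (hK.first e x) (abs_nonneg _) hL0) hφ.continuous hc
  have h3 : (fun t : ℝ => ∑ i, ∫ x, dirDeriv (basisVec i) U (t • e + x)
      * dirDeriv (basisVec i) φ x) = fun t : ℝ => ∫ x, f (U (t • e + x)) * φ x := by
    funext t
    have hst := hs.comp_const_add (t • e)
    have h4 := integral_gradDot_eq_neg_lap_mul hst hφ hc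
    rw [integral_gradDot (hst.of_le (by norm_num)) hφ hc, ← integral_neg] at h4
    simp only [dirDeriv_comp_add_left, lap_comp_add_left] at h4
    rw [h4]
    refine integral_congr_ae (Eventually.of_forall fun x => ?_)
    have := hU.pde (t • e + x)
    simp only
    rw [show lap U (t • e + x) = -f (U (t • e + x)) by linarith]
    ring
  rw [h3] at h1
  have h5 := h1.unique h2
  rw [integral_gradDot (hD e) hφ hc]
  simp only [hdf] at h5
  rw [← h5]
  simp only [dirDeriv_comm hs]

end Linearized

section Perturbation

variable {d : ℕ}

lemma perturbed_sq_le {q a η b s ε c t : ℝ} (hs : 0 < s) (hsq : s ^ 2 = q ^ 2 + ε ^ 2)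
    (hbc : b * c = 0) (hηc : η * c = c) :
    (η * (q * a / s) + s * b + t * c) ^ 2
      ≤ a * (a * η ^ 2 + 2 * q * η * b) + (q ^ 2 + ε ^ 2) * b ^ 2
        + 2 * t * (q * a / s * c) + t ^ 2 * c ^ 2 := by
  set p := q * a / s with hp
  have hps : p * s = q * a := by rw [hp]; field_simp
  have hpa : p ^ 2 ≤ a ^ 2 := by
    rw [hp, div_pow, div_le_iff₀ (by positivity), hsq]
    nlinarith [mul_nonneg (sq_nonneg a) (sq_nonneg ε)]
  have h1 : (η * p + s * b + t * c) ^ 2 = η ^ 2 * p ^ 2 + 2 * η * b * (p * s) + s ^ 2 * b ^ 2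
      + 2 * t * p * (η * c) + 2 * t * s * (b * c) + t ^ 2 * c ^ 2 := by ring
  rw [h1, hbc, hηc, hps, hsq]
  nlinarith [mul_le_mul_of_nonneg_left hpa (sq_nonneg η)]

/-- A smooth regularization of `|q|`. -/
def smoothAbs (ε : ℝ) (q : Euc d → ℝ) (x : Euc d) : ℝ := Real.sqrt (q x ^ 2 + ε ^ 2)

lemma smoothAbs_pos {ε : ℝ} (hε : 0 < ε) (q : Euc d → ℝ) (x : Euc d) : 0 < smoothAbs ε q x :=
  Real.sqrt_pos.mpr (by positivity)

lemma smoothAbs_sq (ε : ℝ) (q : Euc d → ℝ) (x : Euc d) :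
    smoothAbs ε q x ^ 2 = q x ^ 2 + ε ^ 2 := Real.sq_sqrt (by positivity)

lemma contDiff_smoothAbs {ε : ℝ} (hε : 0 < ε) {q : Euc d → ℝ} (hq : ContDiff ℝ 1 q) :
    ContDiff ℝ 1 (smoothAbs ε q) :=
  ((hq.pow 2).add contDiff_const).sqrt fun x => by positivity

lemma abs_smoothAbs_sub_abs_le {ε : ℝ} (hε : 0 < ε) (q : Euc d → ℝ) (x : Euc d) :
    |smoothAbs ε q x - abs (q x)| ≤ ε := by
  have h1 : |q x| ≤ smoothAbs ε q x := Real.abs_le_sqrt (by nlinarith [sq_nonneg ε])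
  have h2 : smoothAbs ε q x ≤ |q x| + ε := by
    refine Real.sqrt_le_iff.mpr ⟨by positivity, ?_⟩
    nlinarith [sq_abs (q x), mul_nonneg (abs_nonneg (q x)) hε.le]
  rw [abs_le]
  constructor <;> linarith

lemma dirDeriv_smoothAbs {ε : ℝ} (hε : 0 < ε) {q : Euc d → ℝ} (hq : ContDiff ℝ 1 q)
    (v x : Euc d) :
    dirDeriv v (smoothAbs ε q) x = q x * dirDeriv v q x / smoothAbs ε q x := by
  have hs := (contDiff_smoothAbs hε hq).differentiable one_ne_zero
  have hqd := hq.differentiable one_ne_zero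
  have h1 : dirDeriv v (fun y => smoothAbs ε q y * smoothAbs ε q y) x
      = dirDeriv v (fun y => q y * q y + ε ^ 2) x := by
    congr 1
    funext y
    rw [← sq, smoothAbs_sq, sq (q y)]
  rw [dirDeriv_mul hs hs, dirDeriv_add (hqd.fun_mul hqd) (differentiable_const _),
    dirDeriv_mul hqd hqd] at h1
  have h2 : dirDeriv v (fun _ : Euc d => ε ^ 2) x = 0 := by simp [dirDeriv]
  rw [h2] at h1
  rw [eq_div_iff (smoothAbs_pos hε q x).ne']
  linarith

/-- The stability inequality tested with `√(q²+ε²) η + t ξ`, where `q` is a directional derivative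
of the solution and `η = 1` near the support of `ξ`. -/
lemma IsStableSol.perturbed_stability {f : ℝ → ℝ} {θ : ℝ} (hf : Bistable f θ)
    {U : Euc d → ℝ} (hU : IsStableSol f U) (e : Euc d) {η ξ : Euc d → ℝ} (hη : ContDiff ℝ 1 η)
    (hηc : HasCompactSupport η) (hξ : ContDiff ℝ 2 ξ) (hξc : HasCompactSupport ξ)
    {O : Set (Euc d)} (hO : IsOpen O) (hξO : tsupport ξ ⊆ O) (hη1 : ∀ x ∈ O, η x = 1)
    {ε : ℝ} (hε : 0 < ε) (t : ℝ) :
    0 ≤ (∫ x, dirDeriv e U x ^ 2 * ‖gradient η x‖ ^ 2) + ε ^ 2 * (∫ x, ‖gradient η x‖ ^ 2)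
      - ε ^ 2 * (∫ x, deriv f (U x) * η x ^ 2)
      - 2 * t * (∫ x, smoothAbs ε (dirDeriv e U) x * (lap ξ x + deriv f (U x) * ξ x))
      + t ^ 2 * ∫ x, (‖gradient ξ x‖ ^ 2 - deriv f (U x) * ξ x ^ 2) := by
  have hs := hU.smooth
  set q := dirDeriv e U with hq
  have hq1 : ContDiff ℝ 1 q := hs.dirDeriv (by norm_num) e
  set σ := smoothAbs ε q with hσ
  have hσ1 : ContDiff ℝ 1 σ := contDiff_smoothAbs hε hq1
  have hξ1 : ContDiff ℝ 1 ξ := hξ.of_le (by norm_num)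
  have hf' : Continuous fun x => deriv f (U x) :=
    (hf.smooth.continuous_deriv (by norm_num)).comp hs.continuous
  have dq := hq1.differentiable one_ne_zero
  have dσ := hσ1.differentiable one_ne_zero
  have dη := hη.differentiable one_ne_zero
  have dξ := hξ1.differentiable one_ne_zero
  have hζ : ContDiff ℝ 1 fun x => q x * (η x * η x) := hq1.mul (hη.mul hη)
  have hζc : HasCompactSupport fun x => q x * (η x * η x) :=
    HasCompactSupport.intro hηc.isCompact fun x hx => by
      simp [image_eq_zero_of_notMem_tsupport hx]
  have hψ : ContDiff ℝ 1 fun x => σ x * η x + t * ξ x :=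
    (hσ1.mul hη).add (contDiff_const.mul hξ1)
  have hψc : HasCompactSupport fun x => σ x * η x + t * ξ x :=
    (hηc.mul_left (f := σ)).add (hξc.mul_left (f := fun _ => t))
  have hst := hU.stable _ hψ hψc
  rw [Measure.restrict_univ] at hst
  have hlin := hU.integral_gradDot_dirDeriv hf e hζ hζc
  have hgreen := integral_gradDot_eq_neg_mul_lap hσ1 hξ hξc
  have i1 := integrable_gradDot hq1 hζ hζc
  have i2 : Integrable fun x => deriv f (U x) * q x * (q x * (η x * η x)) :=
    integrable_mul_of_hasCompactSupport (hf'.mul hq1.continuous) hζ.continuous hζc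
  have i3 : Integrable fun x => q x ^ 2 * ‖gradient η x‖ ^ 2 :=
    integrable_of_eq_zero_off_compact ((hq1.continuous.pow 2).mul
      (continuous_norm_gradient_sq hη)) hηc.isCompact fun x hx => by
        simp [norm_gradient_sq, dirDeriv_eq_zero_of_notMem hx]
  have i4 := integrable_norm_gradient_sq hη hηc
  have i5 := integrable_mul_sq hf' hη hηc
  have i6 := integrable_gradDot hσ1 hξ1 hξc
  have i7 : Integrable fun x => σ x * (deriv f (U x) * ξ x) :=
    integrable_of_eq_zero_off_compact (hσ1.continuous.mul (hf'.mul hξ.continuous)) hξc.isCompact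
      fun x hx => by simp [image_eq_zero_of_notMem_tsupport hx]
  have i8 : Integrable fun x => ‖gradient ξ x‖ ^ 2 - deriv f (U x) * ξ x ^ 2 :=
    (integrable_norm_gradient_sq hξ1 hξc).sub (integrable_mul_sq hf' hξ1 hξc)
  have i9 : Integrable fun x => σ x * lap ξ x :=
    integrable_of_eq_zero_off_compact (hσ1.continuous.mul hξ.continuous_lap) hξc.isCompact
      fun x hx => by simp [lap_eq_zero_of_notMem hx]
  have hpt : ∀ x, ‖gradient (fun x => σ x * η x + t * ξ x) x‖ ^ 2
      - deriv f (U x) * (σ x * η x + t * ξ x) ^ 2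
      ≤ (gradDot q (fun x => q x * (η x * η x)) x - deriv f (U x) * q x * (q x * (η x * η x)))
        + (q x ^ 2 * ‖gradient η x‖ ^ 2 + ε ^ 2 * ‖gradient η x‖ ^ 2
          - ε ^ 2 * (deriv f (U x) * η x ^ 2))
        + 2 * t * (gradDot σ ξ x - σ x * (deriv f (U x) * ξ x))
        + t ^ 2 * (‖gradient ξ x‖ ^ 2 - deriv f (U x) * ξ x ^ 2) := by
    intro x
    have hηξ : η x * ξ x = ξ x := by
      by_cases hx : x ∈ tsupport ξ
      · rw [hη1 x (hξO hx), one_mul]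
      · simp [image_eq_zero_of_notMem_tsupport hx]
    have hsq : σ x ^ 2 = q x ^ 2 + ε ^ 2 := smoothAbs_sq ε q x
    have hpot : (σ x * η x + t * ξ x) ^ 2 = q x * (q x * (η x * η x)) + ε ^ 2 * η x ^ 2
        + 2 * t * (σ x * ξ x) + t ^ 2 * ξ x ^ 2 := by
      have : (σ x * η x + t * ξ x) ^ 2 = σ x ^ 2 * η x ^ 2 + 2 * t * σ x * (η x * ξ x)
        + t ^ 2 * ξ x ^ 2 := by ring
      rw [this, hηξ, hsq]; ring
    have hgrad : ‖gradient (fun x => σ x * η x + t * ξ x) x‖ ^ 2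
        ≤ gradDot q (fun x => q x * (η x * η x)) x + (q x ^ 2 + ε ^ 2) * ‖gradient η x‖ ^ 2
          + 2 * t * gradDot σ ξ x + t ^ 2 * ‖gradient ξ x‖ ^ 2 := by
      simp only [norm_gradient_sq, gradDot, Finset.mul_sum, ← Finset.sum_add_distrib]
      refine Finset.sum_le_sum fun i _ => ?_
      rw [dirDeriv_add (dσ.fun_mul dη) (dξ.const_mul t), dirDeriv_mul dσ dη, dirDeriv_const_mul dξ,
        dirDeriv_mul dq (dη.fun_mul dη), dirDeriv_mul dη dη, hσ, dirDeriv_smoothAbs hε hq1, ← hσ]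
      have hb : dirDeriv (basisVec i) η x * dirDeriv (basisVec i) ξ x = 0 ∧
          η x * dirDeriv (basisVec i) ξ x = dirDeriv (basisVec i) ξ x := by
        by_cases hx : x ∈ tsupport ξ
        · have h1 : η =ᶠ[𝓝 x] fun _ => (1 : ℝ) :=
            Filter.eventually_of_mem (hO.mem_nhds (hξO hx)) hη1
          have h2 : dirDeriv (basisVec i) η x = 0 := by
            unfold dirDeriv
            rw [h1.fderiv_eq]
            simp
          rw [h2, hη1 x (hξO hx)]
          simp
        · simp [dirDeriv_eq_zero_of_notMem hx]
      have := perturbed_sq_le (q := q x) (a := dirDeriv (basisVec i) q x) (t := t)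
        (smoothAbs_pos hε q x) (smoothAbs_sq ε q x) hb.1 hb.2
      rw [← hσ] at this
      refine le_trans (le_of_eq ?_) (this.trans (le_of_eq ?_))
      · ring
      · ring
    rw [hpot]
    nlinarith [hgrad]
  have iA : Integrable fun x => gradDot q (fun x => q x * (η x * η x)) x
      - deriv f (U x) * q x * (q x * (η x * η x)) := i1.sub i2
  have iB : Integrable fun x => q x ^ 2 * ‖gradient η x‖ ^ 2 + ε ^ 2 * ‖gradient η x‖ ^ 2
          - ε ^ 2 * (deriv f (U x) * η x ^ 2) :=
    (i3.add (i4.const_mul _)).sub (i5.const_mul _)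
  have iC : Integrable fun x => 2 * t * (gradDot σ ξ x - σ x * (deriv f (U x) * ξ x)) :=
    (i6.sub i7).const_mul _
  have i0 : Integrable fun x => ‖gradient (fun x => σ x * η x + t * ξ x) x‖ ^ 2
      - deriv f (U x) * (σ x * η x + t * ξ x) ^ 2 :=
    (integrable_norm_gradient_sq hψ hψc).sub (integrable_mul_sq hf' hψ hψc)
  have hmono := integral_mono i0 (((iA.fun_add iB).fun_add iC).fun_add (i8.const_mul (t ^ 2)))
    hpt
  have e1 : ∫ x, (gradDot q (fun x => q x * (η x * η x)) x
      - deriv f (U x) * q x * (q x * (η x * η x))) = 0 := by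
    rw [integral_sub i1 i2, hlin, sub_self]
  have e2 : ∫ x, (q x ^ 2 * ‖gradient η x‖ ^ 2 + ε ^ 2 * ‖gradient η x‖ ^ 2
      - ε ^ 2 * (deriv f (U x) * η x ^ 2)) = (∫ x, q x ^ 2 * ‖gradient η x‖ ^ 2)
      + ε ^ 2 * (∫ x, ‖gradient η x‖ ^ 2) - ε ^ 2 * ∫ x, deriv f (U x) * η x ^ 2 := by
    rw [integral_sub (i3.fun_add (i4.const_mul _)) (i5.const_mul _),
      integral_add i3 (i4.const_mul _), integral_const_mul, integral_const_mul]
  have e3 : ∫ x, 2 * t * (gradDot σ ξ x - σ x * (deriv f (U x) * ξ x))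
      = -(2 * t * ∫ x, σ x * (lap ξ x + deriv f (U x) * ξ x)) := by
    simp only [mul_add]
    rw [integral_const_mul, integral_sub i6 i7, hgreen, integral_add i9 i7]
    ring
  rw [integral_add ((iA.fun_add iB).fun_add iC) (i8.const_mul (t ^ 2)),
    integral_add (iA.fun_add iB) iC, integral_add iA iB, e1, e2, e3, integral_const_mul] at hmono
  linarith [hst.trans hmono]

/-- A function `q` admits good cutoffs if there are compactly supported cutoff functions, equal to
`1` on arbitrarily large balls, with `∫ q² |∇η|²` arbitrarily small. -/
def HasGoodCutoffs (q : Euc d → ℝ) : Prop :=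
  ∀ R : ℝ, ∀ δ > 0, ∃ η : Euc d → ℝ, ContDiff ℝ 1 η ∧ HasCompactSupport η ∧
    (∀ x ∈ Metric.ball (0 : Euc d) R, η x = 1) ∧ ∫ x, q x ^ 2 * ‖gradient η x‖ ^ 2 ≤ δ

/-- Absolute values of directional derivatives with good cutoffs are weak supersolutions of the
linearized equation. -/
lemma IsStableSol.integral_abs_dirDeriv_mul_le {f : ℝ → ℝ} {θ : ℝ} (hf : Bistable f θ)
    {U : Euc d → ℝ} (hU : IsStableSol f U) (e : Euc d) (hcut : HasGoodCutoffs (dirDeriv e U))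
    {ξ : Euc d → ℝ} (hξ : ContDiff ℝ 2 ξ) (hξc : HasCompactSupport ξ) :
    ∫ x, |dirDeriv e U x| * (lap ξ x + deriv f (U x) * ξ x) ≤ 0 := by
  have hs := hU.smooth
  set q := dirDeriv e U with hq
  have hq1 : ContDiff ℝ 1 q := hs.dirDeriv (by norm_num) e
  have hf' : Continuous fun x => deriv f (U x) :=
    (hf.smooth.continuous_deriv (by norm_num)).comp hs.continuous
  set w : Euc d → ℝ := fun x => lap ξ x + deriv f (U x) * ξ x with hw
  have hwc : Continuous w := hξ.continuous_lap.add (hf'.mul hξ.continuous)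
  have hws : HasCompactSupport w := HasCompactSupport.intro hξc.isCompact fun x hx => by
    simp [hw, lap_eq_zero_of_notMem hx, image_eq_zero_of_notMem_tsupport hx]
  set J := ∫ x, |q x| * w x with hJ
  set Q := ∫ x, (‖gradient ξ x‖ ^ 2 - deriv f (U x) * ξ x ^ 2) with hQ
  set B := ∫ x, |w x| with hB
  have hε : ∀ ε > 0, J ≤ (∫ x, smoothAbs ε q x * w x) + ε * B := fun ε hε => by
    have i1 := integrable_mul_of_hasCompactSupport
      (contDiff_smoothAbs hε hq1).continuous hwc hws
    have i2 : Integrable fun x => ε * |w x| :=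
      ((hwc.integrable_of_hasCompactSupport hws).abs).const_mul ε
    rw [hJ, hB, ← integral_const_mul, ← integral_add i1 i2]
    refine integral_mono (integrable_mul_of_hasCompactSupport hq1.continuous.abs hwc hws)
      (i1.fun_add i2) fun x => ?_
    have h1 := abs_smoothAbs_sub_abs_le hε q x
    have h2 : |(smoothAbs ε q x - |q x|) * w x| ≤ ε * |w x| := by
      rw [abs_mul]
      exact mul_le_mul_of_nonneg_right h1 (abs_nonneg _)
    have h3 := (abs_le.mp h2).1
    simp only
    nlinarith
  obtain ⟨R, hR⟩ := hξc.isCompact.isBounded.subset_ball (0 : Euc d)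
  have hkey : ∀ t > 0, ∀ δ > 0, 2 * t * J ≤ δ + t ^ 2 * Q := fun t ht δ hδ => by
    obtain ⟨η, hη, hηc, hη1, hηδ⟩ := hcut R δ hδ
    set A := (∫ x, ‖gradient η x‖ ^ 2) - ∫ x, deriv f (U x) * η x ^ 2 with hA
    have h1 : ∀ ε > 0, 2 * t * J ≤ δ + t ^ 2 * Q + (ε ^ 2 * A + 2 * t * (ε * B)) := fun ε h0 => by
      have := hU.perturbed_stability hf e hη hηc hξ hξc Metric.isOpen_ball hR hη1 h0 t
      have h2 := mul_le_mul_of_nonneg_left (hε ε h0) (by positivity : 0 ≤ 2 * t)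
      rw [← hq, ← hQ] at this
      rw [hA]
      linarith
    have h2 : Tendsto (fun ε : ℝ => δ + t ^ 2 * Q + (ε ^ 2 * A + 2 * t * (ε * B))) (𝓝[>] 0)
        (𝓝 (δ + t ^ 2 * Q)) := by
      have : Continuous fun ε : ℝ => δ + t ^ 2 * Q + (ε ^ 2 * A + 2 * t * (ε * B)) := by fun_prop
      simpa using (this.tendsto 0).mono_left nhdsWithin_le_nhds
    exact ge_of_tendsto h2 (eventually_nhdsWithin_of_forall h1)
  have h3 : ∀ t > 0, 2 * J ≤ t * Q := fun t ht => by
    have : 2 * t * J ≤ t ^ 2 * Q := le_of_forall_pos_le_add fun δ hδ => by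
      linarith [hkey t ht δ hδ]
    nlinarith
  have h4 : Tendsto (fun t : ℝ => t * Q) (𝓝[>] 0) (𝓝 0) := by
    have : Continuous fun t : ℝ => t * Q := by fun_prop
    simpa using (this.tendsto 0).mono_left nhdsWithin_le_nhds
  have := ge_of_tendsto h4 (eventually_nhdsWithin_of_forall h3)
  linarith

end Perturbation

section StrongMaximum

variable {d : ℕ}

lemma hasDerivAt_integral_of_compact {F F' : ℝ → Euc d → ℝ} {a b c : ℝ} (hac : a < c)
    (hcb : c < b) {S : Set (Euc d)} (hS : IsCompact S) (hF : ∀ r, Continuous (F r))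
    (hF' : Continuous (Function.uncurry F')) (h0 : ∀ x ∉ S, F c x = 0)
    (h0' : ∀ r ∈ Ioo a b, ∀ x ∉ S, F' r x = 0)
    (hd : ∀ x r, HasDerivAt (fun r => F r x) (F' r x) r) :
    HasDerivAt (fun r => ∫ x, F r x) (∫ x, F' c x) c := by
  obtain ⟨M, hM⟩ := ((isCompact_Icc (a := a) (b := b)).prod hS).exists_bound_of_continuousOn
    hF'.continuousOn
  have hF'c : Continuous (F' c) := hF'.comp (by fun_prop : Continuous fun x : Euc d => (c, x))
  refine (hasDerivAt_integral_of_dominated_loc_of_deriv_le (s := Ioo a b)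
    (bound := S.indicator fun _ => M) (Ioo_mem_nhds hac hcb)
    (Eventually.of_forall fun r => (hF r).aestronglyMeasurable)
    (integrable_of_eq_zero_off_compact (hF c) hS h0) hF'c.aestronglyMeasurable
    (Eventually.of_forall fun x r hr => ?_) ?_ (Eventually.of_forall fun x r _ => hd x r)).2
  · by_cases hx : x ∈ S
    · rw [indicator_of_mem hx]
      exact hM (r, x) ⟨Ioo_subset_Icc_self hr, hx⟩
    · rw [indicator_of_notMem hx, h0' r hr x hx, norm_zero]
  · exact (integrable_indicator_iff hS.measurableSet).mpr
      (integrableOn_const hS.measure_lt_top.ne)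

lemma contDiff_deriv_expNegInvGlue {n : ℕ∞} : ContDiff ℝ n (deriv expNegInvGlue) :=
  ((contDiff_infty_iff_deriv.mp expNegInvGlue.contDiff).2).of_le (by exact_mod_cast le_top)

lemma deriv_expNegInvGlue_of_nonpos {x : ℝ} (hx : x ≤ 0) : deriv expNegInvGlue x = 0 := by
  refine IsLocalMin.deriv_eq_zero (Eventually.of_forall fun y => ?_)
  rw [expNegInvGlue.zero_of_nonpos hx]
  exact expNegInvGlue.nonneg y

lemma deriv_expNegInvGlue_of_pos {x : ℝ} (hx : 0 < x) :
    deriv expNegInvGlue x = expNegInvGlue x * (x ^ 2)⁻¹ := by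
  have h : HasDerivAt (fun y : ℝ => Real.exp (-y⁻¹)) (Real.exp (-x⁻¹) * (x ^ 2)⁻¹) x := by
    have := ((hasDerivAt_inv hx.ne').neg).exp
    simpa using this
  have he : expNegInvGlue =ᶠ[𝓝 x] fun y : ℝ => Real.exp (-y⁻¹) := by
    filter_upwards [Ioi_mem_nhds hx] with y hy
    simp [expNegInvGlue, not_le.mpr (mem_Ioi.mp hy)]
  rw [he.deriv_eq, h.deriv, he.self_of_nhds]

lemma deriv_expNegInvGlue_nonneg (x : ℝ) : 0 ≤ deriv expNegInvGlue x := by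
  rcases le_or_gt x 0 with hx | hx
  · rw [deriv_expNegInvGlue_of_nonpos hx]
  · rw [deriv_expNegInvGlue_of_pos hx]
    have := expNegInvGlue.nonneg x
    positivity

lemma expNegInvGlue_le_deriv {x : ℝ} (hx : x ≤ 1) : expNegInvGlue x ≤ deriv expNegInvGlue x := by
  rcases le_or_gt x 0 with h | h
  · rw [deriv_expNegInvGlue_of_nonpos h, expNegInvGlue.zero_of_nonpos h]
  · rw [deriv_expNegInvGlue_of_pos h]
    refine le_mul_of_one_le_right (expNegInvGlue.nonneg x) (one_le_inv_iff₀.mpr ⟨by positivity, ?_⟩)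
    exact pow_le_one₀ h.le hx

lemma deriv_deriv_expNegInvGlue_of_nonpos {x : ℝ} (hx : x ≤ 0) :
    deriv (deriv expNegInvGlue) x = 0 := by
  refine IsLocalMin.deriv_eq_zero (Eventually.of_forall fun y => ?_)
  rw [deriv_expNegInvGlue_of_nonpos hx]
  exact deriv_expNegInvGlue_nonneg y

lemma contDiff_one_sub_norm_sq (r : ℝ) {n : WithTop ℕ∞} :
    ContDiff ℝ n fun x : Euc d => 1 - r ^ 2 * ‖x‖ ^ 2 :=
  contDiff_const.sub (contDiff_const.mul (contDiff_norm_sq ℝ))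

lemma lap_comp_one_sub_norm_sq {g : ℝ → ℝ} (hg : ContDiff ℝ 2 g) (r : ℝ) (x : Euc d) :
    lap (fun y => g (1 - r ^ 2 * ‖y‖ ^ 2)) x =
      -(2 * ((d : ℝ) + 1) * r ^ 2 * deriv g (1 - r ^ 2 * ‖x‖ ^ 2))
        + 4 * r ^ 4 * ‖x‖ ^ 2 * deriv (deriv g) (1 - r ^ 2 * ‖x‖ ^ 2) := by
  have hu := (contDiff_one_sub_norm_sq (d := d) r (n := 2)).differentiable (by norm_num)
  have hn : Differentiable ℝ fun y : Euc d => ‖y‖ ^ 2 :=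
    (contDiff_norm_sq ℝ (n := 2)).differentiable (by norm_num)
  have hdg : Differentiable ℝ g := hg.differentiable (by norm_num)
  have hg1 : ContDiff ℝ 1 (deriv g) := by
    have h2 : ContDiff ℝ (1 + 1) g := by simpa [one_add_one_eq_two] using hg
    exact (contDiff_succ_iff_deriv.mp h2).2.2
  have hdg1 : Differentiable ℝ (deriv g) := hg1.differentiable (by norm_num)
  have hdu : ∀ (i : Fin (d + 1)) (y : Euc d),
      dirDeriv (basisVec i) (fun y : Euc d => 1 - r ^ 2 * ‖y‖ ^ 2) y = -(2 * r ^ 2) * y i := by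
    intro i y
    rw [dirDeriv_sub (differentiable_const _) (hn.const_mul _), dirDeriv_const_mul hn,
      dirDeriv_norm_sq]
    have : dirDeriv (basisVec i) (fun _ : Euc d => (1 : ℝ)) y = 0 := by simp [dirDeriv]
    rw [this, EuclideanSpace.inner_single_right]
    simp
    ring
  have hco : ∀ i : Fin (d + 1), Differentiable ℝ fun y : Euc d => y i := fun i => by fun_prop
  have h1 : ∀ i : Fin (d + 1), dirDeriv (basisVec i) (fun y : Euc d => g (1 - r ^ 2 * ‖y‖ ^ 2))
      = fun y : Euc d => deriv g (1 - r ^ 2 * ‖y‖ ^ 2) * (-(2 * r ^ 2) * y i) := fun i => by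
    funext y
    rw [dirDeriv_comp_real hdg hu, hdu]
  have h2 : ∀ i : Fin (d + 1), dirDeriv (basisVec i)
      (dirDeriv (basisVec i) (fun y : Euc d => g (1 - r ^ 2 * ‖y‖ ^ 2))) x
      = -(2 * r ^ 2) * deriv g (1 - r ^ 2 * ‖x‖ ^ 2)
        + 4 * r ^ 4 * deriv (deriv g) (1 - r ^ 2 * ‖x‖ ^ 2) * x i ^ 2 := fun i => by
    have dc : Differentiable ℝ fun y : Euc d => deriv g (1 - r ^ 2 * ‖y‖ ^ 2) := hdg1.comp hu
    rw [h1, dirDeriv_mul dc ((hco i).const_mul _), dirDeriv_const_mul (hco i),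
      dirDeriv_basisVec_coord]
    have := dirDeriv_comp_real hdg1 hu (basisVec i) x
    rw [this, hdu]
    simp
    ring
  unfold lap
  simp only [h2, Finset.sum_add_distrib, ← Finset.mul_sum]
  rw [EuclideanSpace.norm_sq_eq]
  simp
  ring

/-- The rescaled profile `r^N h(1 - r²|x|²)`, where `h` is the derivative of `expNegInvGlue`. -/
def bumpKernel (r : ℝ) (x : Euc d) : ℝ :=
  r ^ (d + 1) * deriv expNegInvGlue (1 - r ^ 2 * ‖x‖ ^ 2)

lemma continuous_bumpKernel (r : ℝ) : Continuous (bumpKernel (d := d) r) := by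
  have h := (contDiff_deriv_expNegInvGlue (n := 1)).continuous
  unfold bumpKernel
  fun_prop

lemma bumpKernel_nonneg {r : ℝ} (hr : 0 < r) (x : Euc d) : 0 ≤ bumpKernel r x :=
  mul_nonneg (by positivity) (deriv_expNegInvGlue_nonneg _)

lemma one_sub_sq_nonpos {r R : ℝ} (hr : 0 < r) (hR : 1 ≤ r * R) {x : Euc d}
    (hx : x ∉ Metric.closedBall (0 : Euc d) R) : 1 - r ^ 2 * ‖x‖ ^ 2 ≤ 0 := by
  have hx' : R < ‖x‖ := by simpa using hx
  have h1 : 1 ≤ r * ‖x‖ := hR.trans (mul_le_mul_of_nonneg_left hx'.le hr.le)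
  nlinarith

lemma integral_bumpKernel {r : ℝ} (hr : 0 < r) :
    ∫ x : Euc d, bumpKernel r x = ∫ x : Euc d, bumpKernel 1 x := by
  have h := Measure.integral_comp_smul (volume : Measure (Euc d)) (bumpKernel 1) r
  have hfr : Module.finrank ℝ (Euc d) = d + 1 := by simp
  rw [hfr, abs_of_pos (by positivity)] at h
  have h2 : ∀ x : Euc d, bumpKernel r x = r ^ (d + 1) * bumpKernel 1 (r • x) := fun x => by
    simp [bumpKernel, norm_smul, mul_pow]
  simp only [h2]
  rw [integral_const_mul, h, smul_eq_mul, ← mul_assoc, mul_inv_cancel₀ (by positivity), one_mul]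

/-- Derivative of `r ↦ ∫ σ k_r`, expressed through the Laplacian of the primitive bump. -/
lemma hasDerivAt_integral_bumpKernel {σ : Euc d → ℝ} (hσ : Continuous σ) {c : ℝ} (hc : 0 < c) :
    HasDerivAt (fun r => ∫ x, σ x * bumpKernel r x)
      (-(c ^ (d + 1) / (2 * c ^ 3) *
        ∫ x, σ x * lap (fun y => expNegInvGlue (1 - c ^ 2 * ‖y‖ ^ 2)) x)) c := by
  have h1 := (contDiff_deriv_expNegInvGlue (n := 1))
  have h2 : Continuous (deriv (deriv expNegInvGlue)) := h1.continuous_deriv (by norm_num)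
  have h1c := h1.continuous
  have hd := hasDerivAt_integral_of_compact (a := c / 2) (b := 2 * c) (c := c) (by linarith)
    (by linarith) (isCompact_closedBall (0 : Euc d) (2 / c))
    (F := fun r x => σ x * bumpKernel r x)
    (F' := fun r x => σ x * ((((d : ℝ) + 1) * r ^ d) * deriv expNegInvGlue (1 - r ^ 2 * ‖x‖ ^ 2)
      + r ^ (d + 1) * (deriv (deriv expNegInvGlue) (1 - r ^ 2 * ‖x‖ ^ 2) * (-(2 * r * ‖x‖ ^ 2)))))
    (fun r => hσ.mul (continuous_bumpKernel r))
    (by simp only [Function.uncurry_def]; fun_prop)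
    (fun x hx => by
      have : 1 - c ^ 2 * ‖x‖ ^ 2 ≤ 0 := one_sub_sq_nonpos hc (by field_simp; norm_num) hx
      simp [bumpKernel, deriv_expNegInvGlue_of_nonpos this])
    (fun r hr x hx => by
      have hr0 : 0 < r := lt_trans (by positivity) hr.1
      have : 1 - r ^ 2 * ‖x‖ ^ 2 ≤ 0 := one_sub_sq_nonpos hr0 (by
        rw [mul_div_assoc', le_div_iff₀ hc]; linarith [hr.1]) hx
      simp [deriv_expNegInvGlue_of_nonpos this, deriv_deriv_expNegInvGlue_of_nonpos this])
    (fun x r => by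
      refine HasDerivAt.const_mul _ ?_
      have hu : HasDerivAt (fun r : ℝ => 1 - r ^ 2 * ‖x‖ ^ 2) (-(2 * r * ‖x‖ ^ 2)) r := by
        simpa using ((hasDerivAt_pow 2 r).mul_const (‖x‖ ^ 2)).const_sub 1
      have hh := ((h1.differentiable (by norm_num)) (1 - r ^ 2 * ‖x‖ ^ 2)).hasDerivAt.comp r hu
      have := (hasDerivAt_pow (d + 1) r).fun_mul hh
      simpa [bumpKernel] using this)
  convert hd using 1
  rw [← integral_const_mul, ← integral_neg]
  refine integral_congr_ae (Eventually.of_forall fun x => ?_)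
  simp only
  rw [lap_comp_one_sub_norm_sq (expNegInvGlue.contDiff)]
  field_simp
  ring

/-- Strong maximum principle for nonnegative continuous weak supersolutions, at the origin. -/
lemma eq_zero_of_weak_supersolution_zero {σ : Euc d → ℝ} (hσ : Continuous σ) (h0 : ∀ x, 0 ≤ σ x)
    {C : ℝ} (hC : 0 ≤ C)
    (hsup : ∀ ξ : Euc d → ℝ, ContDiff ℝ 2 ξ → HasCompactSupport ξ → (∀ x, 0 ≤ ξ x) →
      ∫ x, σ x * lap ξ x ≤ C * ∫ x, σ x * ξ x) (hz : σ 0 = 0) (x : Euc d) : σ x = 0 := by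
  set μ : ℝ → ℝ := fun r => ∫ x, σ x * bumpKernel r x with hμ
  have hker : ∀ r > 0, ∀ x ∉ Metric.closedBall (0 : Euc d) r⁻¹, bumpKernel r x = 0 :=
    fun r hr x hx => by
      have := one_sub_sq_nonpos hr (by field_simp; norm_num) hx
      simp [bumpKernel, deriv_expNegInvGlue_of_nonpos this]
  have hint : ∀ r > 0, Integrable fun x => σ x * bumpKernel r x := fun r hr =>
    integrable_of_eq_zero_off_compact (hσ.mul (continuous_bumpKernel r))
      (isCompact_closedBall (0 : Euc d) r⁻¹) fun x hx => by rw [hker r hr x hx, mul_zero]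
  have hμ0 : ∀ r > 0, 0 ≤ μ r := fun r hr => integral_nonneg fun x =>
    mul_nonneg (h0 x) (bumpKernel_nonneg hr x)
  have hderiv : ∀ r > 0, ∃ m', HasDerivAt μ m' r ∧ -(C / 2) * (r ^ 3)⁻¹ * μ r ≤ m' := by
    intro r hr
    refine ⟨_, hasDerivAt_integral_bumpKernel hσ hr, ?_⟩
    have hu : ContDiff ℝ 2 fun y : Euc d => expNegInvGlue (1 - r ^ 2 * ‖y‖ ^ 2) :=
      expNegInvGlue.contDiff.comp (contDiff_one_sub_norm_sq r)
    have huz : ∀ x ∉ Metric.closedBall (0 : Euc d) r⁻¹,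
        expNegInvGlue (1 - r ^ 2 * ‖x‖ ^ 2) = 0 := fun x hx =>
      expNegInvGlue.zero_of_nonpos (one_sub_sq_nonpos hr (by field_simp; norm_num) hx)
    have h1 := hsup _ hu (HasCompactSupport.intro (isCompact_closedBall 0 r⁻¹) huz)
      fun x => expNegInvGlue.nonneg _
    have h2 : r ^ (d + 1) * ∫ x, σ x * expNegInvGlue (1 - r ^ 2 * ‖x‖ ^ 2) ≤ μ r := by
      rw [← integral_const_mul]
      refine integral_mono ((integrable_mul_of_hasCompactSupport hσ hu.continuous
        (HasCompactSupport.intro (isCompact_closedBall 0 r⁻¹) huz)).const_mul _)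
        (hint r hr) fun x => ?_
      have h3 := expNegInvGlue_le_deriv (x := 1 - r ^ 2 * ‖x‖ ^ 2)
        (by nlinarith [sq_nonneg (r * ‖x‖)])
      have h4 := mul_le_mul_of_nonneg_left h3 (by positivity : 0 ≤ r ^ (d + 1))
      have h5 := mul_le_mul_of_nonneg_left h4 (h0 x)
      simp only [bumpKernel]
      linarith
    have h6 : r ^ (d + 1) * ∫ x, σ x * lap (fun y => expNegInvGlue (1 - r ^ 2 * ‖y‖ ^ 2)) x
        ≤ C * μ r := by
      calc _ ≤ r ^ (d + 1) * (C * ∫ x, σ x * expNegInvGlue (1 - r ^ 2 * ‖x‖ ^ 2)) :=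
            mul_le_mul_of_nonneg_left h1 (by positivity)
        _ = C * (r ^ (d + 1) * ∫ x, σ x * expNegInvGlue (1 - r ^ 2 * ‖x‖ ^ 2)) := by ring
        _ ≤ _ := mul_le_mul_of_nonneg_left h2 hC
    have h7 := mul_le_mul_of_nonneg_left h6 (by positivity : 0 ≤ (2 * r ^ 3)⁻¹)
    have e1 : -(C / 2) * (r ^ 3)⁻¹ * μ r = -((2 * r ^ 3)⁻¹ * (C * μ r)) := by
      rw [mul_inv]; ring
    rw [e1, neg_le_neg_iff]
    refine le_trans (le_of_eq ?_) h7
    ring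
  set E : ℝ → ℝ := fun r => μ r * Real.exp (-(C / 4) * (r ^ 2)⁻¹) with hE
  have hEd : ∀ r > 0, ∃ m', HasDerivAt E m' r ∧ 0 ≤ m' := fun r hr => by
    obtain ⟨m', hm, hle⟩ := hderiv r hr
    have h1 : HasDerivAt (fun r : ℝ => -(C / 4) * (r ^ 2)⁻¹) (C / 2 * (r ^ 3)⁻¹) r := by
      have := ((hasDerivAt_pow 2 r).fun_inv (by positivity)).const_mul (-(C / 4))
      refine this.congr_deriv ?_
      simp only [Nat.cast_ofNat, Nat.add_one_sub_one, pow_one]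
      field_simp
      norm_num
    refine ⟨_, hm.mul h1.exp, ?_⟩
    have h2 : 0 < Real.exp (-(C / 4) * (r ^ 2)⁻¹) := Real.exp_pos _
    have h3 : m' * Real.exp (-(C / 4) * (r ^ 2)⁻¹) + μ r * (Real.exp (-(C / 4) * (r ^ 2)⁻¹)
        * (C / 2 * (r ^ 3)⁻¹)) = (m' + C / 2 * (r ^ 3)⁻¹ * μ r)
          * Real.exp (-(C / 4) * (r ^ 2)⁻¹) := by ring
    rw [h3]
    exact mul_nonneg (by linarith) h2.le
  have hmono : MonotoneOn E (Ioi 0) := by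
    refine monotoneOn_of_deriv_nonneg (convex_Ioi 0) (fun r hr => ?_) (fun r hr => ?_)
      (fun r hr => ?_)
    · obtain ⟨m', hm, -⟩ := hEd r hr
      exact hm.continuousAt.continuousWithinAt
    · rw [interior_Ioi] at hr
      obtain ⟨m', hm, -⟩ := hEd r hr
      exact hm.differentiableAt.differentiableWithinAt
    · rw [interior_Ioi] at hr
      obtain ⟨m', hm, h⟩ := hEd r hr
      rwa [hm.deriv]
  set I := ∫ x : Euc d, bumpKernel 1 x with hI
  have hI0 : 0 ≤ I := integral_nonneg fun x => bumpKernel_nonneg one_pos x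
  have hsmall : ∀ ε > 0, ∀ r > 0, E r ≤ ε * I := fun ε hε r hr => by
    obtain ⟨R, hR0, hR⟩ := Metric.continuous_iff.mp hσ 0 ε hε
    set s := max r (2 / R) with hs
    have hs0 : 0 < s := lt_max_of_lt_left hr
    have hsR : s⁻¹ < R := by
      rw [inv_lt_comm₀ hs0 hR0]
      refine lt_of_lt_of_le ?_ (le_max_right _ _)
      rw [div_eq_mul_inv]
      have : 0 < R⁻¹ := by positivity
      linarith
    have h1 : E s ≤ μ s := by
      refine mul_le_of_le_one_right (hμ0 s hs0) (Real.exp_le_one_iff.mpr ?_)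
      have : 0 ≤ C / 4 * (s ^ 2)⁻¹ := by positivity
      linarith
    have h2 : μ s ≤ ε * I := by
      rw [hI, ← integral_bumpKernel hs0, ← integral_const_mul]
      refine integral_mono (hint s hs0) ((integrable_of_eq_zero_off_compact
        (continuous_bumpKernel s) (isCompact_closedBall (0 : Euc d) s⁻¹) (hker s hs0)).const_mul ε)
        fun x => ?_
      by_cases hx : x ∈ Metric.closedBall (0 : Euc d) s⁻¹
      · have h3 := hR x (lt_of_le_of_lt (Metric.mem_closedBall.mp hx) hsR)
        rw [hz, Real.dist_eq, sub_zero] at h3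
        exact mul_le_mul_of_nonneg_right ((le_abs_self _).trans h3.le) (bumpKernel_nonneg hs0 x)
      · simp [hker s hs0 x hx]
    exact (hmono hr hs0 (le_max_left _ _)).trans (h1.trans h2)
  have hzero : ∀ r > 0, μ r = 0 := fun r hr => by
    have h1 : E r ≤ 0 := le_of_forall_pos_le_add fun ε hε => by
      have h2 := hsmall (ε / (I + 1)) (by positivity) r hr
      have h3 : ε / (I + 1) * I ≤ ε := by
        rw [div_mul_eq_mul_div, div_le_iff₀ (by positivity)]
        nlinarith
      linarith
    exact le_antisymm (by_contra fun h => absurd h1 (not_le.mpr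
      (mul_pos (not_le.mp h) (Real.exp_pos _)))) (hμ0 r hr)
  set r : ℝ := (‖x‖ + 1)⁻¹ with hr
  have hr0 : 0 < r := by positivity
  have h1 := (Continuous.integral_pos_of_hasCompactSupport_nonneg_nonzero
    (μ := (volume : Measure (Euc d))) (f := fun x => σ x * bumpKernel r x) (x := x)
    (hσ.mul (continuous_bumpKernel r))
    (HasCompactSupport.intro (isCompact_closedBall (0 : Euc d) r⁻¹) fun x hx => by
      rw [hker r hr0 x hx, mul_zero]) (fun x => mul_nonneg (h0 x) (bumpKernel_nonneg hr0 x)))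
  by_contra hne
  have h2 : 0 < bumpKernel r x := by
    have h3 : r * ‖x‖ < 1 := by
      rw [hr, inv_mul_lt_iff₀ (by positivity)]; linarith
    have h4 : 0 < 1 - r ^ 2 * ‖x‖ ^ 2 := by nlinarith [mul_nonneg hr0.le (norm_nonneg x)]
    refine mul_pos (by positivity) ?_
    rw [deriv_expNegInvGlue_of_pos h4]
    have := expNegInvGlue.pos_of_pos h4
    positivity
  exact absurd (hzero r hr0) (h1 (mul_ne_zero hne h2.ne')).ne'

/-- Strong maximum principle for nonnegative continuous weak supersolutions. -/
lemma eq_zero_of_weak_supersolution {σ : Euc d → ℝ} (hσ : Continuous σ) (h0 : ∀ x, 0 ≤ σ x)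
    {C : ℝ} (hC : 0 ≤ C)
    (hsup : ∀ ξ : Euc d → ℝ, ContDiff ℝ 2 ξ → HasCompactSupport ξ → (∀ x, 0 ≤ ξ x) →
      ∫ x, σ x * lap ξ x ≤ C * ∫ x, σ x * ξ x) {p : Euc d} (hz : σ p = 0) (x : Euc d) :
    σ x = 0 := by
  have h := eq_zero_of_weak_supersolution_zero (σ := fun y => σ (p + y)) (hσ.comp (by fun_prop))
    (fun y => h0 _) hC (fun ξ hξ hξc hξ0 => by
      have h1 := hsup _ (hξ.comp_const_add (-p)) (hξc.comp_homeomorph (Homeomorph.addLeft (-p)))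
        fun x => hξ0 _
      rw [← integral_add_left_eq_self _ p, ← integral_add_left_eq_self (fun x => σ x * _) p] at h1
      simpa [lap_comp_add_left] using h1) (by simpa using hz) (-p + x)
  simpa using h

/-- A directional derivative of a stable solution that vanishes somewhere and admits good cutoffs
vanishes identically. -/
lemma IsStableSol.dirDeriv_eq_zero {f : ℝ → ℝ} {θ : ℝ} (hf : Bistable f θ)
    {U : Euc d → ℝ} (hU : IsStableSol f U) {e : Euc d} (hcut : HasGoodCutoffs (dirDeriv e U))
    {p : Euc d} (hp : dirDeriv e U p = 0) (x : Euc d) : dirDeriv e U x = 0 := by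
  obtain ⟨L, hL0, -, hL, -, -⟩ := hf.exists_bounds
  have hq : Continuous (dirDeriv e U) :=
    (hU.smooth.of_le (by norm_num : (1 : WithTop ℕ∞) ≤ 2)).continuous_dirDeriv e
  have hf' : Continuous fun x => deriv f (U x) :=
    (hf.smooth.continuous_deriv (by norm_num)).comp hU.smooth.continuous
  refine abs_eq_zero.mp (eq_zero_of_weak_supersolution (σ := fun x => |dirDeriv e U x|) hq.abs
    (fun x => abs_nonneg _) hL0 (fun ξ hξ hξc hξ0 => ?_) (abs_eq_zero.mpr hp) x)
  have h1 := hU.integral_abs_dirDeriv_mul_le hf e hcut hξ hξc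
  have i1 : Integrable fun x => |dirDeriv e U x| * lap ξ x :=
    integrable_of_eq_zero_off_compact (hq.abs.mul hξ.continuous_lap) hξc.isCompact
      fun x hx => by rw [lap_eq_zero_of_notMem hx, mul_zero]
  have i2 : Integrable fun x => |dirDeriv e U x| * (deriv f (U x) * ξ x) :=
    integrable_of_eq_zero_off_compact (hq.abs.mul (hf'.mul hξ.continuous)) hξc.isCompact
      fun x hx => by simp [image_eq_zero_of_notMem_tsupport hx]
  have i3 : Integrable fun x => |dirDeriv e U x| * ξ x :=
    integrable_mul_of_hasCompactSupport hq.abs hξ.continuous hξc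
  simp only [mul_add] at h1
  rw [integral_add i1 i2] at h1
  have h2 : -∫ x, |dirDeriv e U x| * (deriv f (U x) * ξ x) ≤ L * ∫ x, |dirDeriv e U x| * ξ x := by
    rw [← integral_neg, ← integral_const_mul]
    refine integral_mono i2.neg (i3.const_mul L) fun x => ?_
    have h3 := (abs_le.mp (hL _ (hU.range x))).1
    have h4 := mul_nonneg (abs_nonneg (dirDeriv e U x)) (hξ0 x)
    simp only
    nlinarith
  linarith

end StrongMaximum

section Cutoff

variable {d : ℕ}

/-- A smooth bump equal to `1` on the unit ball and supported in the ball of radius `2`. -/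
def unitBump (d : ℕ) : ContDiffBump (0 : Euc d) := ⟨1, 2, one_pos, one_lt_two⟩

/-- The unit bump rescaled to the ball of radius `R`. -/
def cutoff (R : ℝ) (x : Euc d) : ℝ := unitBump d (R⁻¹ • x)

lemma contDiff_cutoff (R : ℝ) : ContDiff ℝ 1 (cutoff (d := d) R) :=
  (unitBump d).contDiff.comp (contDiff_const_smul _)

lemma cutoff_nonneg (R : ℝ) (x : Euc d) : 0 ≤ cutoff R x := (unitBump d).nonneg

lemma cutoff_le_one (R : ℝ) (x : Euc d) : cutoff R x ≤ 1 := (unitBump d).le_one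

lemma cutoff_eq_one {R : ℝ} (hR : 0 < R) {x : Euc d} (hx : ‖x‖ ≤ R) : cutoff R x = 1 := by
  refine (unitBump d).one_of_mem_closedBall ?_
  rw [mem_closedBall_zero_iff, norm_smul, norm_inv, Real.norm_of_nonneg hR.le]
  change R⁻¹ * ‖x‖ ≤ 1
  rwa [inv_mul_le_iff₀ hR, mul_one]

lemma cutoff_eq_zero {R : ℝ} (hR : 0 < R) {x : Euc d} (hx : 2 * R ≤ ‖x‖) : cutoff R x = 0 := by
  refine (unitBump d).zero_of_le_dist ?_
  rw [dist_zero_right, norm_smul, norm_inv, Real.norm_of_nonneg hR.le]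
  change 2 ≤ R⁻¹ * ‖x‖
  rwa [le_inv_mul_iff₀ hR, mul_comm]

lemma hasCompactSupport_cutoff {R : ℝ} (hR : 0 < R) : HasCompactSupport (cutoff (d := d) R) :=
  HasCompactSupport.intro (isCompact_closedBall 0 (2 * R)) fun x hx =>
    cutoff_eq_zero hR (le_of_lt (by simpa using hx))

lemma dirDeriv_comp_const_smul (c : ℝ) {g : Euc d → ℝ} (hg : Differentiable ℝ g) (v x : Euc d) :
    dirDeriv v (fun y => g (c • y)) x = c * dirDeriv v g (c • x) := by
  have h := ((hg (c • x)).hasFDerivAt.comp x ((hasFDerivAt_id x).const_smul c)).fderiv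
  simp only [dirDeriv]
  have : fderiv ℝ (fun y => g (c • y)) x = _ := h
  rw [this]
  simp

lemma norm_gradient_sq_cutoff (R : ℝ) (x : Euc d) :
    ‖gradient (cutoff R) x‖ ^ 2 = (R⁻¹) ^ 2 * ‖gradient (unitBump d) (R⁻¹ • x)‖ ^ 2 := by
  rw [norm_gradient_sq, norm_gradient_sq, Finset.mul_sum]
  refine Finset.sum_congr rfl fun i _ => ?_
  rw [← mul_pow]
  congr 1
  exact dirDeriv_comp_const_smul _ ((unitBump d).contDiff.differentiable (n := 1) (by norm_num)) _ _

lemma exists_gradient_cutoff_bound (d : ℕ) : ∃ C, 0 ≤ C ∧ ∀ R : ℝ, 0 < R → ∀ x : Euc d,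
    ‖gradient (cutoff R) x‖ ^ 2 ≤ C / R ^ 2 := by
  have hc : HasCompactSupport (unitBump d) := (unitBump d).hasCompactSupport
  have h1 : ContDiff ℝ 1 (unitBump d) := (unitBump d).contDiff
  obtain ⟨C, hC⟩ := hc.isCompact.exists_bound_of_continuousOn
    (continuous_norm_gradient_sq h1).continuousOn
  refine ⟨max C 0, le_max_right _ _, fun R hR x => ?_⟩
  rw [norm_gradient_sq_cutoff, inv_pow, div_eq_inv_mul]
  refine mul_le_mul_of_nonneg_left ?_ (by positivity)
  by_cases hx : R⁻¹ • x ∈ tsupport (unitBump d)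
  · exact ((le_abs_self _).trans (hC _ hx)).trans (le_max_left _ _)
  · rw [norm_gradient_sq]
    simp [dirDeriv_eq_zero_of_notMem hx]

lemma integral_norm_gradient_sq_cutoff {R : ℝ} (hR : 0 < R) :
    ∫ x : Euc 1, ‖gradient (cutoff R) x‖ ^ 2 = ∫ x : Euc 1, ‖gradient (unitBump 1) x‖ ^ 2 := by
  simp only [norm_gradient_sq_cutoff]
  rw [integral_const_mul, Measure.integral_comp_smul (volume : Measure (Euc 1))
    (fun x => ‖gradient (unitBump 1) x‖ ^ 2) R⁻¹]
  have hfr : Module.finrank ℝ (Euc 1) = 2 := by simp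
  rw [hfr, abs_of_pos (by positivity), smul_eq_mul, ← mul_assoc, mul_inv_cancel₀ (by positivity),
    one_mul]

/-- Logarithmic cutoffs in the plane, built by averaging cutoffs with disjoint transition zones. -/
lemma exists_cutoff_energy_le (k : ℕ) (R : ℝ) : ∃ η : Euc 1 → ℝ, ContDiff ℝ 1 η ∧
    HasCompactSupport η ∧ (∀ x ∈ Metric.ball (0 : Euc 1) R, η x = 1) ∧
    ∫ x, ‖gradient η x‖ ^ 2 ≤ (∫ x : Euc 1, ‖gradient (unitBump 1) x‖ ^ 2) / (k + 1) := by
  induction k generalizing R with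
  | zero =>
    have hR : 0 < max R 1 := by positivity
    refine ⟨cutoff (max R 1), contDiff_cutoff _, hasCompactSupport_cutoff hR, fun x hx => ?_, ?_⟩
    · exact cutoff_eq_one hR ((mem_ball_zero_iff.mp hx).le.trans (le_max_left _ _))
    · rw [integral_norm_gradient_sq_cutoff hR]
      simp
  | succ k ih =>
    obtain ⟨η, hη, hηc, hη1, hE⟩ := ih R
    obtain ⟨R', hR'⟩ := hηc.isCompact.isBounded.subset_ball (0 : Euc 1)
    set M := max (max R R') 1 with hM
    have hM0 : 0 < M := by positivity
    have hζ := contDiff_cutoff (d := 1) M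
    have hζc := hasCompactSupport_cutoff (d := 1) hM0
    set I := ∫ x : Euc 1, ‖gradient (unitBump 1) x‖ ^ 2
    set a : ℝ := (k + 1) / (k + 2) with ha
    set b : ℝ := 1 / (k + 2) with hb
    have hab : a + b = 1 := by rw [ha, hb]; field_simp; ring
    have hdη := hη.differentiable (by norm_num)
    have hdζ := hζ.differentiable (by norm_num)
    have hgrad : ∀ x, ‖gradient (fun x => a * η x + b * cutoff M x) x‖ ^ 2
        = a ^ 2 * ‖gradient η x‖ ^ 2 + b ^ 2 * ‖gradient (cutoff M) x‖ ^ 2 := fun x => by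
      simp only [norm_gradient_sq, Finset.mul_sum, ← Finset.sum_add_distrib]
      refine Finset.sum_congr rfl fun i _ => ?_
      rw [dirDeriv_add (hdη.const_mul a) (hdζ.const_mul b), dirDeriv_const_mul hdη,
        dirDeriv_const_mul hdζ]
      by_cases hx : x ∈ tsupport η
      · have h0 : dirDeriv (basisVec i) (cutoff M) x = 0 := by
          have : cutoff M =ᶠ[𝓝 x] fun _ => (1 : ℝ) := by
            filter_upwards [Metric.isOpen_ball.mem_nhds (hR' hx)] with y hy
            exact cutoff_eq_one hM0 ((mem_ball_zero_iff.mp hy).le.trans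
              ((le_max_right _ _).trans (le_max_left _ _)))
          simp [dirDeriv, this.fderiv_eq]
        rw [h0]; ring
      · rw [dirDeriv_eq_zero_of_notMem hx]; ring
    refine ⟨fun x => a * η x + b * cutoff M x, (contDiff_const.mul hη).add (contDiff_const.mul hζ),
      (hηc.mul_left (f := fun _ => a)).add (hζc.mul_left (f := fun _ => b)), fun x hx => ?_, ?_⟩
    · simp only
      rw [hη1 x hx, cutoff_eq_one hM0 ((mem_ball_zero_iff.mp hx).le.trans
        ((le_max_left _ _).trans (le_max_left _ _))), mul_one, mul_one, hab]
    · simp only [hgrad]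
      rw [integral_add ((integrable_norm_gradient_sq hη hηc).const_mul _)
        ((integrable_norm_gradient_sq hζ hζc).const_mul _), integral_const_mul, integral_const_mul,
        integral_norm_gradient_sq_cutoff hM0]
      have h1 := mul_le_mul_of_nonneg_left hE (sq_nonneg a)
      have h2 : a ^ 2 * (I / (k + 1)) + b ^ 2 * I = I / ((k + 1 : ℕ) + 1) := by
        rw [ha, hb]; push_cast; field_simp; ring
      linarith

/-- Bounded continuous functions in the plane have good cutoffs. -/
lemma hasGoodCutoffs_of_bounded {q : Euc 1 → ℝ} (hq : Continuous q) {K : ℝ}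
    (hK : ∀ x, |q x| ≤ K) : HasGoodCutoffs q := by
  intro R δ hδ
  set I := ∫ x : Euc 1, ‖gradient (unitBump 1) x‖ ^ 2
  obtain ⟨k, hk⟩ := exists_nat_gt (K ^ 2 * I / δ)
  obtain ⟨η, hη, hηc, hη1, hE⟩ := exists_cutoff_energy_le k R
  refine ⟨η, hη, hηc, hη1, ?_⟩
  have i1 := integrable_norm_gradient_sq hη hηc
  calc ∫ x, q x ^ 2 * ‖gradient η x‖ ^ 2 ≤ ∫ x, K ^ 2 * ‖gradient η x‖ ^ 2 := by
        refine integral_mono (integrable_of_eq_zero_off_compact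
          ((hq.pow 2).mul (continuous_norm_gradient_sq hη)) hηc.isCompact fun x hx => ?_)
          (i1.const_mul _) fun x => ?_
        · simp [norm_gradient_sq, dirDeriv_eq_zero_of_notMem hx]
        · refine mul_le_mul_of_nonneg_right ?_ (by positivity)
          rw [← sq_abs]
          exact pow_le_pow_left₀ (abs_nonneg _) (hK x) 2
    _ = K ^ 2 * ∫ x, ‖gradient η x‖ ^ 2 := integral_const_mul _ _
    _ ≤ K ^ 2 * (I / (k + 1)) := mul_le_mul_of_nonneg_left hE (sq_nonneg K)
    _ ≤ δ := by
        rw [mul_div_assoc', div_le_iff₀ (by positivity)]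
        rw [div_lt_iff₀ hδ] at hk
        nlinarith

end Cutoff

section Planar

lemma exists_seq_tendsto_deriv_zero {g g' : ℝ → ℝ} (hg : ∀ t, HasDerivAt g (g' t) t) {l : ℝ}
    (hl : Tendsto g atTop (𝓝 l)) :
    ∃ ξ : ℕ → ℝ, Tendsto ξ atTop atTop ∧ Tendsto (fun n => g' (ξ n)) atTop (𝓝 0) := by
  have h : ∀ n : ℕ, ∃ c ∈ Ioo (n : ℝ) (n + 1), g' c = (g (n + 1) - g n) / (n + 1 - n) := fun n =>
    exists_hasDerivAt_eq_slope g g' (by linarith)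
      (fun t _ => (hg t).continuousAt.continuousWithinAt) fun t _ => hg t
  choose ξ hξ hξ' using h
  refine ⟨ξ, tendsto_atTop_mono (fun n => (hξ n).1.le) tendsto_natCast_atTop_atTop, ?_⟩
  have h1 : Tendsto (fun n : ℕ => g n) atTop (𝓝 l) := hl.comp tendsto_natCast_atTop_atTop
  have h2 : Tendsto (fun n : ℕ => g ((n : ℝ) + 1)) atTop (𝓝 l) :=
    hl.comp (tendsto_atTop_add_const_right _ 1 tendsto_natCast_atTop_atTop)
  have h3 := h2.sub h1
  rw [sub_self] at h3
  refine h3.congr fun n => ?_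
  rw [hξ' n]
  simp

/-- The primitive of `f` vanishing at `0`. -/
def primitiveOf (f : ℝ → ℝ) (u : ℝ) : ℝ := ∫ s in (0 : ℝ)..u, f s

lemma hasDerivAt_primitiveOf {f : ℝ → ℝ} (hf : Continuous f) (u : ℝ) :
    HasDerivAt (primitiveOf f) (f u) u :=
  (hf.integral_hasStrictDerivAt 0 u).hasDerivAt

lemma Bistable.eq_of_root {f : ℝ → ℝ} {θ : ℝ} (hf : Bistable f θ) {c : ℝ} (hc : c ∈ Icc (0 : ℝ) 1)
    (h : f c = 0) : c = 0 ∨ c = θ ∨ c = 1 := by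
  by_contra! hne
  obtain ⟨h0, hθ, h1⟩ := hne
  rcases lt_or_gt_of_ne hθ with h' | h'
  · exact (hf.neg c ⟨lt_of_le_of_ne hc.1 (Ne.symm h0), h'⟩).ne h
  · exact (hf.pos c ⟨h', lt_of_le_of_ne hc.2 h1⟩).ne' h

lemma Bistable.primitiveOf_theta_neg {f : ℝ → ℝ} {θ : ℝ} (hf : Bistable f θ) :
    primitiveOf f θ < 0 := by
  have h := intervalIntegral.intervalIntegral_pos_of_pos_on (f := fun s => -f s) (a := 0) (b := θ)
    (hf.smooth.continuous.neg.intervalIntegrable _ _)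
    (fun s hs => neg_pos.mpr (hf.neg s hs)) hf.θmem.1
  rw [intervalIntegral.integral_neg] at h
  exact neg_pos.mp h

/-- Distinct zeros of `f` in `[0,1]` lie at distinct levels of the primitive. -/
lemma Bistable.eq_of_primitiveOf_eq {f : ℝ → ℝ} {θ : ℝ} (hf : Bistable f θ) {a b : ℝ}
    (ha : a ∈ Icc (0 : ℝ) 1) (hb : b ∈ Icc (0 : ℝ) 1) (hfa : f a = 0) (hfb : f b = 0)
    (h : primitiveOf f a = primitiveOf f b) : a = b := by
  have hθ := hf.primitiveOf_theta_neg
  have h1 : 0 < primitiveOf f 1 := hf.mass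
  have h0 : primitiveOf f 0 = 0 := intervalIntegral.integral_same
  rcases hf.eq_of_root ha hfa with rfl | rfl | rfl <;>
    rcases hf.eq_of_root hb hfb with rfl | rfl | rfl <;> first | rfl | linarith

/-- Limits at infinity of bounded solutions of `V'' + f(V) = 0`. -/
lemma limit_of_ode {f : ℝ → ℝ} (hf : Continuous f) {V W : ℝ → ℝ}
    (hV : ∀ t, HasDerivAt V (W t) t) (hW : ∀ t, HasDerivAt W (-f (V t)) t) {l E : ℝ}
    (hE : ∀ t, W t ^ 2 / 2 + primitiveOf f (V t) = E) (hl : Tendsto V atTop (𝓝 l)) :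
    f l = 0 ∧ primitiveOf f l = E := by
  have hF : Continuous (primitiveOf f) :=
    continuous_iff_continuousAt.mpr fun u => (hasDerivAt_primitiveOf hf u).continuousAt
  have hFV := (hF.tendsto l).comp hl
  have hEl : primitiveOf f l = E := by
    obtain ⟨ξ, hξ, hξ0⟩ := exists_seq_tendsto_deriv_zero hV hl
    have h1 : Tendsto (fun n => W (ξ n) ^ 2 / 2 + primitiveOf f (V (ξ n))) atTop
        (𝓝 (0 ^ 2 / 2 + primitiveOf f l)) := ((hξ0.pow 2).div_const 2).add (hFV.comp hξ)
    simp only [hE] at h1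
    have := tendsto_nhds_unique h1 tendsto_const_nhds
    linarith
  refine ⟨?_, hEl⟩
  have hW0 : Tendsto W atTop (𝓝 0) := by
    have h2 : Tendsto (fun t => Real.sqrt (2 * (E - primitiveOf f (V t)))) atTop
        (𝓝 (Real.sqrt (2 * (E - primitiveOf f l)))) :=
      (Real.continuous_sqrt.tendsto _).comp ((tendsto_const_nhds.sub hFV).const_mul 2)
    rw [hEl, sub_self, mul_zero, Real.sqrt_zero] at h2
    rw [tendsto_zero_iff_abs_tendsto_zero]
    refine h2.congr fun t => ?_
    rw [← hE t, Function.comp_apply, ← Real.sqrt_sq_eq_abs]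
    congr 1
    ring
  obtain ⟨ξ, hξ, hξ0⟩ := exists_seq_tendsto_deriv_zero hW hW0
  have h3 : Tendsto (fun n => -f (V (ξ n))) atTop (𝓝 (-f l)) :=
    (((hf.tendsto l).comp hl).comp hξ).neg
  have := tendsto_nhds_unique hξ0 h3
  linarith

lemma hasDerivAt_comp_neg {g : ℝ → ℝ} {g' t : ℝ} (h : HasDerivAt g g' (-t)) :
    HasDerivAt (fun t => g (-t)) (-g') t :=
  (h.comp t (hasDerivAt_neg t)).congr_deriv (mul_neg_one g')

lemma hasDerivAt_neg_comp_neg {g : ℝ → ℝ} {g' t : ℝ} (h : HasDerivAt g g' (-t)) :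
    HasDerivAt (fun t => -g (-t)) g' t :=
  (hasDerivAt_comp_neg h).fun_neg.congr_deriv (neg_neg g')

lemma Bistable.not_strictMono_ode {f : ℝ → ℝ} {θ : ℝ} (hf : Bistable f θ) {V W : ℝ → ℝ}
    (hV : ∀ t, HasDerivAt V (W t) t) (hW : ∀ t, HasDerivAt W (-f (V t)) t)
    (hr : ∀ t, V t ∈ Icc (0 : ℝ) 1) : ¬ StrictMono V := fun hmono => by
  have hfc := hf.smooth.continuous
  have hE : ∀ t, W t ^ 2 / 2 + primitiveOf f (V t) = W 0 ^ 2 / 2 + primitiveOf f (V 0) := by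
    have hd : ∀ t, HasDerivAt (fun t => W t ^ 2 / 2 + primitiveOf f (V t)) 0 t := fun t => by
      have h1 := (((hW t).fun_pow 2).div_const 2).fun_add
        ((hasDerivAt_primitiveOf hfc (V t)).comp t (hV t))
      refine h1.congr_deriv ?_
      simp
      ring
    exact fun t => is_const_of_deriv_eq_zero (fun t => (hd t).differentiableAt)
      (fun t => (hd t).deriv) t 0
  have hup : BddAbove (range V) := ⟨1, by rintro _ ⟨t, rfl⟩; exact (hr t).2⟩
  have hlo : BddBelow (range V) := ⟨0, by rintro _ ⟨t, rfl⟩; exact (hr t).1⟩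
  have h1 := tendsto_atTop_ciSup hmono.monotone hup
  have h2 := tendsto_atBot_ciInf hmono.monotone hlo
  obtain ⟨hf1, hp1⟩ := limit_of_ode hfc hV hW hE h1
  obtain ⟨hf2, hp2⟩ := limit_of_ode hfc (V := fun t => V (-t)) (W := fun t => -W (-t))
    (fun t => hasDerivAt_comp_neg (hV (-t)))
    (fun t => hasDerivAt_neg_comp_neg (hW (-t)))
    (fun t => by rw [neg_sq]; exact hE (-t)) (h2.comp tendsto_neg_atTop_atBot)
  have hlt : ⨅ t, V t < ⨆ t, V t :=
    ((ciInf_le hlo 0).trans_lt (hmono zero_lt_one)).trans_le (le_ciSup hup 1)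
  refine hlt.ne (hf.eq_of_primitiveOf_eq ⟨le_ciInf fun t => (hr t).1, ?_⟩ ⟨?_, ciSup_le fun t =>
    (hr t).2⟩ hf2 hf1 (hp2.trans hp1.symm))
  · exact (ciInf_le hlo 0).trans (hr 0).2
  · exact (hr 0).1.trans (le_ciSup hup 0)

/-- A bounded solution of `V'' + f(V) = 0` with values in `[0,1]` has a critical point. -/
lemma Bistable.exists_critical_ode {f : ℝ → ℝ} {θ : ℝ} (hf : Bistable f θ) {V W : ℝ → ℝ}
    (hV : ∀ t, HasDerivAt V (W t) t) (hW : ∀ t, HasDerivAt W (-f (V t)) t)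
    (hr : ∀ t, V t ∈ Icc (0 : ℝ) 1) : ∃ t, W t = 0 := by
  by_contra! hne
  have hc : Continuous V := continuous_iff_continuousAt.mpr fun t => (hV t).continuousAt
  have hinj : Function.Injective V := by
    have key : ∀ a b, a < b → V a ≠ V b := fun a b hab h => by
      obtain ⟨c, -, h'⟩ := exists_hasDerivAt_eq_zero hab hc.continuousOn h fun t _ => hV t
      exact hne c h'
    intro a b h
    rcases lt_trichotomy a b with h' | h' | h'
    · exact absurd h (key a b h')
    · exact h'
    · exact absurd h.symm (key b a h')
  rcases hc.strictMono_of_inj hinj with h | h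
  · exact hf.not_strictMono_ode hV hW hr h
  · refine hf.not_strictMono_ode (V := fun t => V (-t)) (W := fun t => -W (-t))
      (fun t => hasDerivAt_comp_neg (hV (-t)))
      (fun t => hasDerivAt_neg_comp_neg (hW (-t))) (fun t => hr _) ?_
    exact fun a b hab => h (neg_lt_neg hab)

/-- The unstable zero of `f` is not a stable solution in the plane. -/
lemma IsStableSol.not_const_theta {f : ℝ → ℝ} {θ : ℝ} (hf : Bistable f θ) {U : Euc 1 → ℝ}
    (hU : IsStableSol f U) : ¬ ∀ x, U x = θ := fun hθ => by
  set I := ∫ x : Euc 1, ‖gradient (unitBump 1) x‖ ^ 2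
  set J := ∫ x : Euc 1, unitBump 1 x ^ 2 with hJ
  have hcont : Continuous fun x => unitBump 1 x ^ 2 := (unitBump 1).continuous.pow 2
  have hJ0 : 0 < J := by
    refine hcont.integral_pos_of_hasCompactSupport_nonneg_nonzero (x := 0) ?_
      (fun x => sq_nonneg _) ?_
    · exact (unitBump 1).hasCompactSupport.comp_left (g := fun t => t ^ 2) (by norm_num)
    · have : unitBump 1 0 = 1 := (unitBump 1).one_of_mem_closedBall (Metric.mem_closedBall_self zero_le_one)
      simp [this]
  have key : ∀ R : ℝ, 0 < R → deriv f θ * (R ^ 2 * J) ≤ I := fun R hR => by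
    have h := hU.stable (cutoff R) (contDiff_cutoff R) (hasCompactSupport_cutoff hR)
    simp only [hθ, Measure.restrict_univ] at h
    rw [integral_sub (integrable_norm_gradient_sq (contDiff_cutoff R) (hasCompactSupport_cutoff hR))
      (integrable_mul_sq continuous_const (contDiff_cutoff R) (hasCompactSupport_cutoff hR)),
      integral_const_mul, integral_norm_gradient_sq_cutoff hR] at h
    have h2 : ∫ x : Euc 1, cutoff R x ^ 2 = R ^ 2 * J := by
      have := Measure.integral_comp_smul (volume : Measure (Euc 1))
        (fun x => unitBump 1 x ^ 2) R⁻¹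
      have hfr : Module.finrank ℝ (Euc 1) = 2 := by simp
      rw [hfr, abs_of_pos (by positivity), inv_pow, inv_inv, smul_eq_mul] at this
      exact this
    rw [h2] at h
    linarith
  have hdθ := hf.dθ
  have hI : 0 ≤ I := integral_nonneg fun x => by positivity
  have hp : 0 < deriv f θ * J := mul_pos hdθ hJ0
  have := key (1 + I / (deriv f θ * J)) (by positivity)
  have h3 : I < deriv f θ * ((1 + I / (deriv f θ * J)) ^ 2 * J) := by
    have h4 : I / (deriv f θ * J) * (deriv f θ * J) = I := div_mul_cancel₀ _ hp.ne'
    set z := I / (deriv f θ * J) with hz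
    have hz0 : 0 ≤ z := by positivity
    nlinarith [mul_nonneg (mul_nonneg hz0 hz0) hp.le]
  linarith

lemma dirDeriv_fin_two (v : Euc 1) (g : Euc 1 → ℝ) (x : Euc 1) :
    dirDeriv v g x = v 0 * dirDeriv (basisVec 0) g x + v 1 * dirDeriv (basisVec 1) g x := by
  rw [dirDeriv_eq_sum, Fin.sum_univ_two]

/-- Stable solutions in the plane are constant equal to a stable zero of `f`. -/
lemma IsStableSol.eq_zero_or_eq_one_of_planar {f : ℝ → ℝ} {θ : ℝ} (hf : Bistable f θ)
    {U : Euc 1 → ℝ} (hU : IsStableSol f U) : (∀ x, U x = 0) ∨ (∀ x, U x = 1) := by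
  obtain ⟨K, hK0, hK⟩ := hU.exists_bound hf
  have hs := hU.smooth
  have h1 : ContDiff ℝ 1 U := hs.of_le (by norm_num)
  have hdU := h1.differentiable (by norm_num)
  have hcut : ∀ e : Euc 1, HasGoodCutoffs (dirDeriv e U) := fun e =>
    hasGoodCutoffs_of_bounded (h1.continuous_dirDeriv e) fun x => hK.first e x
  have hd1 : ∀ i : Fin 2, Differentiable ℝ (dirDeriv (basisVec i) U) := fun i =>
    (hs.dirDeriv (m := 1) (by norm_num) _).differentiable (by norm_num)
  obtain ⟨c, s, hcs, h0⟩ : ∃ c s : ℝ, c ^ 2 + s ^ 2 = 1 ∧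
      c * dirDeriv (basisVec 0) U 0 + s * dirDeriv (basisVec 1) U 0 = 0 := by
    set a := dirDeriv (basisVec 0) U 0
    set b := dirDeriv (basisVec 1) U 0
    by_cases hab : a ^ 2 + b ^ 2 = 0
    · exact ⟨1, 0, by norm_num, by nlinarith [sq_nonneg a, sq_nonneg b]⟩
    · have hn : 0 < a ^ 2 + b ^ 2 := lt_of_le_of_ne (by positivity) (Ne.symm hab)
      refine ⟨-b / √(a ^ 2 + b ^ 2), a / √(a ^ 2 + b ^ 2), ?_, by ring⟩
      rw [div_pow, div_pow, Real.sq_sqrt hn.le]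
      field_simp
      ring
  set e : Euc 1 := !₂[c, s] with he
  set e' : Euc 1 := !₂[-s, c] with he'
  have hdir : ∀ (g : Euc 1 → ℝ) x, dirDeriv e g x
      = c * dirDeriv (basisVec 0) g x + s * dirDeriv (basisVec 1) g x := fun g x => by
    rw [dirDeriv_fin_two]; simp [he]
  have hdir' : ∀ (g : Euc 1 → ℝ) x, dirDeriv e' g x
      = -s * dirDeriv (basisVec 0) g x + c * dirDeriv (basisVec 1) g x := fun g x => by
    rw [dirDeriv_fin_two]; simp [he']
  have hzero : ∀ x, dirDeriv e U x = 0 := hU.dirDeriv_eq_zero hf (hcut e) (p := 0)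
    (by rw [hdir]; exact h0)
  have hlin : ∀ (a b : ℝ) (v x : Euc 1), dirDeriv v (fun y => a * dirDeriv (basisVec 0) U y
      + b * dirDeriv (basisVec 1) U y) x = a * dirDeriv v (dirDeriv (basisVec 0) U) x
      + b * dirDeriv v (dirDeriv (basisVec 1) U) x := fun a b v x => by
    rw [dirDeriv_add ((hd1 0).const_mul a) ((hd1 1).const_mul b), dirDeriv_const_mul (hd1 0),
      dirDeriv_const_mul (hd1 1)]
  have hlap : ∀ x, dirDeriv e' (dirDeriv e' U) x = lap U x := fun x => by
    have e1 : dirDeriv e (dirDeriv e U) x = 0 := by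
      have : dirDeriv e U = fun _ => 0 := funext hzero
      rw [this]; simp [dirDeriv]
    rw [show dirDeriv e U = _ from funext (hdir U), hlin, hdir, hdir] at e1
    rw [show dirDeriv e' U = _ from funext (hdir' U), hlin, hdir', hdir']
    rw [lap, Fin.sum_univ_two]
    have hc := dirDeriv_comm hs (basisVec 0) (basisVec 1) x
    rw [hc] at e1 ⊢
    linear_combination (dirDeriv (basisVec 0) (dirDeriv (basisVec 0) U) x
      + dirDeriv (basisVec 1) (dirDeriv (basisVec 1) U) x) * hcs - e1
  have hV : ∀ t : ℝ, HasDerivAt (fun t : ℝ => U (t • e')) (dirDeriv e' U (t • e')) t := fun t => by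
    simpa [dirDeriv] using hasDerivAt_line hdU 0 e' t
  have hW : ∀ t : ℝ, HasDerivAt (fun t : ℝ => dirDeriv e' U (t • e')) (-f (U (t • e'))) t :=
    fun t => by
      have h2 := hasDerivAt_line ((hs.dirDeriv (m := 1) (by norm_num) e').differentiable
        (by norm_num)) 0 e' t
      have h3 : -f (U (t • e')) = dirDeriv e' (dirDeriv e' U) (t • e') := by
        rw [hlap]; linarith [hU.pde (t • e')]
      rw [h3]
      simpa [dirDeriv] using h2
  obtain ⟨t, ht⟩ := hf.exists_critical_ode hV hW fun t => hU.range _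
  have hzero' : ∀ x, dirDeriv e' U x = 0 := hU.dirDeriv_eq_zero hf (hcut e') ht
  have hall : ∀ v x, dirDeriv v U x = 0 := fun v x => by
    have e1 := hzero x
    have e2 := hzero' x
    rw [hdir] at e1
    rw [hdir'] at e2
    have e3 : dirDeriv (basisVec 0) U x = 0 := by
      linear_combination (-dirDeriv (basisVec 0) U x) * hcs + c * e1 - s * e2
    have e4 : dirDeriv (basisVec 1) U x = 0 := by
      linear_combination (-dirDeriv (basisVec 1) U x) * hcs + s * e1 + c * e2
    rw [dirDeriv_fin_two, e3, e4]; ring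
  have hconst : ∀ x, U x = U 0 := fun x => by
    have := abs_sub_le_of_dirDeriv_le hdU le_rfl (fun x v => by rw [hall]; simp) x 0
    rw [zero_mul] at this
    exact sub_eq_zero.mp (abs_nonpos_iff.mp this)
  have hroot : f (U 0) = 0 := by
    have h2 := hU.pde 0
    have h3 : lap U 0 = 0 := by
      rw [← hlap, show dirDeriv e' U = fun _ => 0 from funext hzero']
      simp [dirDeriv]
    linarith
  rcases hf.eq_of_root (hU.range 0) hroot with h | h | h
  · exact Or.inl fun x => (hconst x).trans h
  · exact absurd (fun x => (hconst x).trans h) (hU.not_const_theta hf)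
  · exact Or.inr fun x => (hconst x).trans h

end Planar

section Reduction

variable {d : ℕ}

/-- Forget the last coordinate. -/
def dropLast (d : ℕ) : Euc (d + 1) →L[ℝ] Euc d :=
  LinearMap.toContinuousLinearMap
    { toFun := fun x => WithLp.toLp 2 fun i => x i.castSucc
      map_add' := fun _ _ => rfl
      map_smul' := fun _ _ => rfl }

/-- Append a vanishing last coordinate. -/
def extendZero (d : ℕ) : Euc d →L[ℝ] Euc (d + 1) :=
  LinearMap.toContinuousLinearMap
    { toFun := fun y => WithLp.toLp 2 (Fin.snoc (α := fun _ => ℝ) (fun i => y i) 0)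
      map_add' := fun x y => by
        ext i
        refine Fin.lastCases ?_ (fun j => ?_) i <;> simp
      map_smul' := fun c x => by
        ext i
        refine Fin.lastCases ?_ (fun j => ?_) i <;> simp }

lemma dropLast_apply (x : Euc (d + 1)) (i : Fin (d + 1)) : dropLast d x i = x i.castSucc := rfl

lemma extendZero_castSucc (y : Euc d) (i : Fin (d + 1)) : extendZero d y i.castSucc = y i := by
  simp [extendZero]

lemma dropLast_extendZero (y : Euc d) : dropLast d (extendZero d y) = y := by
  ext i
  rw [dropLast_apply, extendZero_castSucc]

lemma dropLast_basisVec_castSucc (i : Fin (d + 1)) :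
    dropLast d (basisVec i.castSucc) = basisVec i := by
  ext j
  simp [dropLast_apply, PiLp.single_apply]

lemma dropLast_basisVec_last : dropLast d (basisVec (Fin.last (d + 1))) = 0 := by
  ext j
  simp [dropLast_apply, (Fin.castSucc_lt_last j).ne]

lemma dirDeriv_comp_dropLast {g : Euc d → ℝ} (hg : Differentiable ℝ g) (v x : Euc (d + 1)) :
    dirDeriv v (fun y => g (dropLast d y)) x = dirDeriv (dropLast d v) g (dropLast d x) := by
  have h : HasFDerivAt (fun y => g (dropLast d y)) _ x :=
    (hg (dropLast d x)).hasFDerivAt.comp x (dropLast d).hasFDerivAt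
  simp [dirDeriv, h.fderiv]

lemma lap_comp_dropLast {g : Euc d → ℝ} (hg : ContDiff ℝ 2 g) (x : Euc (d + 1)) :
    lap (fun y => g (dropLast d y)) x = lap g (dropLast d x) := by
  have h1 := hg.differentiable (by norm_num)
  have h2 : ∀ v, Differentiable ℝ (dirDeriv v g) := fun v =>
    (hg.dirDeriv (m := 1) (by norm_num) v).differentiable (by norm_num)
  rw [lap, Fin.sum_univ_castSucc, lap]
  have h3 : ∀ v : Euc (d + 1), dirDeriv v (fun y => g (dropLast d y))
      = fun y => dirDeriv (dropLast d v) g (dropLast d y) := fun v =>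
    funext fun y => dirDeriv_comp_dropLast h1 v y
  simp only [h3, dirDeriv_comp_dropLast (h2 _), dropLast_basisVec_castSucc, dropLast_basisVec_last]
  simp [dirDeriv]

lemma dirDeriv_comp_coord {h : ℝ → ℝ} (hh : Differentiable ℝ h) (i j : Fin (d + 1)) (x : Euc d) :
    dirDeriv (basisVec i) (fun y => h (y j)) x = if i = j then deriv h (x j) else 0 := by
  rw [dirDeriv_comp_real (g := fun y => y j) hh (by fun_prop), dirDeriv_basisVec_coord]
  split_ifs <;> simp_all

lemma integral_dropLast_mul_last (G : Euc d → ℝ) (h : ℝ → ℝ) :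
    ∫ x : Euc (d + 1), G (dropLast d x) * h (x (Fin.last (d + 1)))
      = (∫ y, G y) * ∫ t, h t := by
  have e1 := (EuclideanSpace.volume_preserving_symm_measurableEquiv_toLp (Fin (d + 1 + 1)))
  have e2 := volume_preserving_piFinSuccAbove (fun _ : Fin (d + 1 + 1) => ℝ) (Fin.last (d + 1))
  have e3 := (EuclideanSpace.volume_preserving_symm_measurableEquiv_toLp (Fin (d + 1))).symm
  have h1 := (e2.comp e1).integral_comp
    ((MeasurableEquiv.measurableEmbedding _).comp (MeasurableEquiv.measurableEmbedding _))
    fun p => h p.1 * G (WithLp.toLp 2 p.2)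
  have h2 : ∫ p : ℝ × (Fin (d + 1) → ℝ), h p.1 * G (WithLp.toLp 2 p.2)
      = (∫ t, h t) * ∫ z : Fin (d + 1) → ℝ, G (WithLp.toLp 2 z) :=
    integral_prod_mul (μ := volume) (ν := volume) h fun z : Fin (d + 1) → ℝ => G (WithLp.toLp 2 z)
  have h3 := e3.integral_comp (MeasurableEquiv.measurableEmbedding _) G
  rw [mul_comm, ← h3]
  refine Eq.trans ?_ (h1.trans h2)
  refine integral_congr_ae (Eventually.of_forall fun x => ?_)
  have h4 : dropLast d x = WithLp.toLp 2 ((MeasurableEquiv.piFinSuccAbove (fun _ => ℝ)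
      (Fin.last (d + 1))) ((MeasurableEquiv.toLp 2 (Fin (d + 1 + 1) → ℝ)).symm x)).2 := by
    ext i
    simp [dropLast_apply, MeasurableEquiv.piFinSuccAbove, Fin.init]
  simp only
  rw [mul_comm, h4]
  rfl

lemma norm_sq_dropLast_add (x : Euc (d + 1)) :
    ‖x‖ ^ 2 = ‖dropLast d x‖ ^ 2 + x (Fin.last (d + 1)) ^ 2 := by
  rw [EuclideanSpace.real_norm_sq_eq, EuclideanSpace.real_norm_sq_eq, Fin.sum_univ_castSucc]
  rfl

/-- A compactly supported product of a function of the first coordinates and a function of the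
last one. -/
lemma isCompact_dropLast_mem {S : Set (Euc d)} (hS : IsCompact S) (R : ℝ) :
    IsCompact {x : Euc (d + 1) | dropLast d x ∈ S ∧ |x (Fin.last (d + 1))| ≤ R} := by
  refine Metric.isCompact_of_isClosed_isBounded ?_ ?_
  · have h1 : Continuous fun x : Euc (d + 1) => |x (Fin.last (d + 1))| := by fun_prop
    exact (hS.isClosed.preimage (dropLast d).continuous).inter (isClosed_le h1 continuous_const)
  · obtain ⟨C, hC⟩ := hS.isBounded.subset_closedBall (0 : Euc d)
    refine Metric.isBounded_closedBall (x := (0 : Euc (d + 1))) (r := |C| + |R|) |>.subset ?_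
    rintro x ⟨h1, h2⟩
    have h3 := mem_closedBall_zero_iff.mp (hC h1)
    rw [mem_closedBall_zero_iff]
    refine abs_le_of_sq_le_sq' ?_ (by positivity) |>.2
    rw [norm_sq_dropLast_add]
    have h4 := pow_le_pow_left₀ (norm_nonneg _) (h3.trans (le_abs_self C)) 2
    have h5 := pow_le_pow_left₀ (abs_nonneg _) (h2.trans (le_abs_self R)) 2
    rw [sq_abs] at h5
    nlinarith [mul_nonneg (abs_nonneg C) (abs_nonneg R)]

/-- The test function `ψ(x₁,…,x_{N-1}) χ(x_N / L)` in the stability inequality. -/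
lemma StableOn.integral_product_nonneg {f : ℝ → ℝ} (hf : Continuous (deriv f)) {u : Euc d → ℝ}
    (hu : Continuous u)
    (hs : StableOn Set.univ f fun x : Euc (d + 1) => u (dropLast d x)) {ψ : Euc d → ℝ}
    (hψ : ContDiff ℝ 1 ψ) (hψc : HasCompactSupport ψ) {h : ℝ → ℝ} (hh : ContDiff ℝ 1 h) {R : ℝ}
    (hhR : ∀ t, R < |t| → h t = 0) :
    0 ≤ (∫ y, (‖gradient ψ y‖ ^ 2 - deriv f (u y) * ψ y ^ 2)) * (∫ t, h t ^ 2)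
      + (∫ y, ψ y ^ 2) * ∫ t, deriv h t ^ 2 := by
  have hdψ := hψ.differentiable (by norm_num)
  have hdh := hh.differentiable (by norm_num)
  set Ψ : Euc (d + 1) → ℝ := fun x => ψ (dropLast d x) * h (x (Fin.last (d + 1))) with hΨ
  have hd2 : Differentiable ℝ fun x : Euc (d + 1) => h (x (Fin.last (d + 1))) :=
    hdh.comp (by fun_prop)
  have hd1 : Differentiable ℝ fun x : Euc (d + 1) => ψ (dropLast d x) :=
    hdψ.comp (dropLast d).differentiable
  have hS := isCompact_dropLast_mem hψc.isCompact R
  have hderivh : ∀ t, R < |t| → deriv h t = 0 := fun t ht => by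
    have : h =ᶠ[𝓝 t] fun _ => 0 := by
      filter_upwards [(isOpen_lt continuous_const continuous_abs).mem_nhds ht] with s hs
      exact hhR s hs
    simp [this.deriv_eq]
  have hcd : ContDiff ℝ 1 Ψ :=
    (hψ.comp (dropLast d).contDiff).mul (hh.comp (by fun_prop))
  have hcc : HasCompactSupport Ψ := HasCompactSupport.intro hS fun x hx => by
    by_cases h1 : dropLast d x ∈ tsupport ψ
    · have h2 : R < |x (Fin.last (d + 1))| := not_le.mp fun h3 => hx ⟨h1, h3⟩
      simp [hΨ, hhR _ h2]
    · simp [hΨ, image_eq_zero_of_notMem_tsupport h1]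
  have hgrad : ∀ x, ‖gradient Ψ x‖ ^ 2 = ‖gradient ψ (dropLast d x)‖ ^ 2
      * h (x (Fin.last (d + 1))) ^ 2 + ψ (dropLast d x) ^ 2
        * deriv h (x (Fin.last (d + 1))) ^ 2 := fun x => by
    rw [norm_gradient_sq, norm_gradient_sq, Fin.sum_univ_castSucc, Finset.sum_mul]
    simp only [hΨ, dirDeriv_mul hd1 hd2, dirDeriv_comp_dropLast hdψ, dirDeriv_comp_coord hdh,
      dropLast_basisVec_castSucc, dropLast_basisVec_last, (Fin.castSucc_lt_last _).ne, if_false,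
      if_true]
    congr 1
    · exact Finset.sum_congr rfl fun i _ => by ring
    · simp [dirDeriv]
      ring
  have h0 := hs Ψ hcd hcc
  rw [Measure.restrict_univ] at h0
  have e1 : ∀ x, ‖gradient Ψ x‖ ^ 2 - deriv f (u (dropLast d x)) * Ψ x ^ 2
      = (‖gradient ψ (dropLast d x)‖ ^ 2 - deriv f (u (dropLast d x)) * ψ (dropLast d x) ^ 2)
          * h (x (Fin.last (d + 1))) ^ 2
        + ψ (dropLast d x) ^ 2 * deriv h (x (Fin.last (d + 1))) ^ 2 := fun x => by
    rw [hgrad]; simp only [hΨ]; ring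
  simp only [e1] at h0
  have hcg := continuous_norm_gradient_sq hψ
  have hch' : Continuous (deriv h) := hh.continuous_deriv (by norm_num)
  have hch := hh.continuous
  have hcψ := hψ.continuous
  rw [integral_add, integral_dropLast_mul_last (fun y => ‖gradient ψ y‖ ^ 2
    - deriv f (u y) * ψ y ^ 2) fun t => h t ^ 2, integral_dropLast_mul_last (fun y => ψ y ^ 2)
    fun t => deriv h t ^ 2] at h0
  · exact h0
  · refine integrable_of_eq_zero_off_compact ?_ hS fun x hx => ?_
    · have : Continuous fun y => ‖gradient ψ y‖ ^ 2 - deriv f (u y) * ψ y ^ 2 := by fun_prop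
      exact (this.comp (dropLast d).continuous).mul (by fun_prop)
    · by_cases h1 : dropLast d x ∈ tsupport ψ
      · have h2 : R < |x (Fin.last (d + 1))| := not_le.mp fun h3 => hx ⟨h1, h3⟩
        simp [hhR _ h2]
      · rw [norm_gradient_sq]
        simp [image_eq_zero_of_notMem_tsupport h1, dirDeriv_eq_zero_of_notMem h1]
  · refine integrable_of_eq_zero_off_compact ?_ hS fun x hx => ?_
    · exact ((hcψ.comp (dropLast d).continuous).pow 2).mul (by fun_prop)
    · by_cases h1 : dropLast d x ∈ tsupport ψ
      · have h2 : R < |x (Fin.last (d + 1))| := not_le.mp fun h3 => hx ⟨h1, h3⟩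
        simp [hderivh _ h2]
      · simp [image_eq_zero_of_notMem_tsupport h1]

/-- Stability passes to solutions independent of the last coordinate. -/
lemma StableOn.of_comp_dropLast {f : ℝ → ℝ} (hf : Continuous (deriv f)) {u : Euc d → ℝ}
    (hu : Continuous u)
    (hs : StableOn Set.univ f fun x : Euc (d + 1) => u (dropLast d x)) :
    StableOn Set.univ f u := by
  intro ψ hψ hψc
  rw [Measure.restrict_univ]
  let χ : ContDiffBump (0 : ℝ) := ⟨1, 2, one_pos, one_lt_two⟩
  have hχ : ContDiff ℝ 1 χ := χ.contDiff
  set A := ∫ y, (‖gradient ψ y‖ ^ 2 - deriv f (u y) * ψ y ^ 2)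
  set B := ∫ y, ψ y ^ 2
  set a := ∫ t, χ t ^ 2
  set b := ∫ t, deriv χ t ^ 2
  have ha : 0 < a := by
    refine (χ.continuous.pow 2).integral_pos_of_hasCompactSupport_nonneg_nonzero (x := 0) ?_
      (fun x => sq_nonneg _) ?_
    · exact χ.hasCompactSupport.comp_left (g := fun t => t ^ 2) (by norm_num)
    · have : χ 0 = 1 := χ.one_of_mem_closedBall (Metric.mem_closedBall_self zero_le_one)
      simp [this]
  have key : ∀ L : ℝ, 0 < L → 0 ≤ A * a + B * b * (L⁻¹) ^ 2 := fun L hL => by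
    have h1 := hs.integral_product_nonneg hf hu hψ hψc (h := fun t => χ (L⁻¹ * t)) (R := 2 * L)
      (hχ.comp (by fun_prop)) fun t ht => by
        refine χ.zero_of_le_dist ?_
        change 2 ≤ _
        rw [dist_zero_right, norm_mul, norm_inv, Real.norm_of_nonneg hL.le, Real.norm_eq_abs,
          le_inv_mul_iff₀ hL]
        linarith
    have h2 : ∀ t, deriv (fun t => χ (L⁻¹ * t)) t = L⁻¹ * deriv χ (L⁻¹ * t) := fun t => by
      simpa using deriv_comp_mul_left L⁻¹ χ t
    simp only [h2, mul_pow] at h1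
    rw [integral_const_mul, Measure.integral_comp_mul_left (fun t => χ t ^ 2),
      Measure.integral_comp_mul_left (fun t => deriv χ t ^ 2), inv_inv, abs_of_pos hL,
      smul_eq_mul, smul_eq_mul] at h1
    have h3 : A * (L * a) + B * ((L⁻¹) ^ 2 * (L * b)) = L * (A * a + B * b * (L⁻¹) ^ 2) := by ring
    rw [h3] at h1
    exact nonneg_of_mul_nonneg_right h1 hL
  have hlim : Tendsto (fun L : ℝ => A * a + B * b * (L⁻¹) ^ 2) atTop
      (𝓝 (A * a + B * b * 0 ^ 2)) :=
    ((tendsto_inv_atTop_zero.pow 2).const_mul _).const_add _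
  have h4 := ge_of_tendsto hlim (by filter_upwards [eventually_gt_atTop 0] with L hL using key L hL)
  have h5 : 0 ≤ A * a := by linarith
  exact nonneg_of_mul_nonneg_left h5 ha

/-- A stable solution independent of the last coordinate is a stable solution of the remaining
ones. -/
lemma IsStableSol.comp_extendZero {f : ℝ → ℝ} {θ : ℝ} (hf : Bistable f θ) {U : Euc (d + 1) → ℝ}
    (hU : IsStableSol f U)
    (hind : ∀ x y : Euc (d + 1), dropLast d x = dropLast d y → U x = U y) :
    IsStableSol f fun y => U (extendZero d y) := by
  have hs : ContDiff ℝ 2 fun y => U (extendZero d y) := hU.smooth.comp (extendZero d).contDiff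
  have hUe : (fun x => U (extendZero d (dropLast d x))) = U :=
    funext fun x => hind _ _ (dropLast_extendZero _)
  refine ⟨hs, fun y => hU.range _, fun y => ?_, ?_⟩
  · have h := lap_comp_dropLast hs (extendZero d y)
    rw [hUe, dropLast_extendZero] at h
    rw [← h]
    exact hU.pde _
  · refine StableOn.of_comp_dropLast (hf.smooth.continuous_deriv (by norm_num)) hs.continuous ?_
    rw [hUe]
    exact hU.stable

/-- Stable solutions depending on the first two coordinates only are trivial. -/
lemma IsStableSol.eq_zero_or_eq_one_of_two_coords {f : ℝ → ℝ} {θ : ℝ} (hf : Bistable f θ)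
    (n : ℕ) {U : Euc (n + 1) → ℝ} (hU : IsStableSol f U)
    (hind : ∀ x y : Euc (n + 1), x 0 = y 0 → x 1 = y 1 → U x = U y) :
    (∀ x, U x = 0) ∨ (∀ x, U x = 1) := by
  induction n with
  | zero => exact hU.eq_zero_or_eq_one_of_planar hf
  | succ n ih =>
    have h2 : ∀ x y : Euc (n + 1 + 1), dropLast (n + 1) x = dropLast (n + 1) y → U x = U y :=
      fun x y h => hind x y (congrArg (fun z : Euc (n + 1) => z 0) h)
        (congrArg (fun z : Euc (n + 1) => z 1) h)
    have h3 : ∀ x, U x = U (extendZero (n + 1) (dropLast (n + 1) x)) := fun x =>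
      h2 _ _ (dropLast_extendZero _).symm
    rcases ih (hU.comp_extendZero hf h2) (fun x y h0 h1 => hind _ _
      ((extendZero_castSucc x 0).trans (h0.trans (extendZero_castSucc y 0).symm))
      ((extendZero_castSucc x 1).trans (h1.trans (extendZero_castSucc y 1).symm))) with h | h
    · exact Or.inl fun x => (h3 x).trans (h _)
    · exact Or.inr fun x => (h3 x).trans (h _)

end Reduction

section Asymptotics

variable {n : ℕ}

lemma primeNorm_nonneg {d : ℕ} (x : Euc d) : 0 ≤ primeNorm x := Real.sqrt_nonneg _

lemma primeNorm_sq {d : ℕ} (x : Euc d) : primeNorm x ^ 2 = ∑ i : Fin d, x i.succ ^ 2 := by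
  rw [primeNorm, Real.sq_sqrt (Finset.sum_nonneg fun i _ => by split_ifs <;> positivity),
    Fin.sum_univ_succ]
  simp [Fin.succ_ne_zero]

/-- The point with cylindrical coordinates `(s, r)` in the half-plane spanned by the first two
basis vectors. -/
def polarPoint (n : ℕ) (s r : ℝ) : Euc (n + 1) := s • basisVec 0 + r • basisVec 1

lemma polarPoint_zero (s r : ℝ) : polarPoint n s r 0 = s := by
  simp [polarPoint]

lemma polarPoint_one (s r : ℝ) : polarPoint n s r 1 = r := by
  simp [polarPoint]

lemma polarPoint_succ_succ (s r : ℝ) (i : Fin n) : polarPoint n s r i.succ.succ = 0 := by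
  have h1 : i.succ.succ ≠ 0 := Fin.succ_ne_zero _
  have h2 : i.succ.succ ≠ 1 := by
    rw [← Fin.succ_zero_eq_one, Ne, Fin.succ_inj]; exact Fin.succ_ne_zero _
  simp [polarPoint, h1, h2]

lemma primeNorm_polarPoint_add_sq (s r : ℝ) (x : Euc (n + 1)) :
    primeNorm (polarPoint n s r + x) ^ 2 = primeNorm x ^ 2 + 2 * r * x 1 + r ^ 2 := by
  rw [primeNorm_sq, primeNorm_sq, Fin.sum_univ_succ, Fin.sum_univ_succ]
  simp only [PiLp.add_apply, polarPoint_succ_succ, zero_add, Fin.succ_zero_eq_one, polarPoint_one]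
  ring

lemma primeNorm_polarPoint (s : ℝ) {r : ℝ} (hr : 0 ≤ r) : primeNorm (polarPoint n s r) = r := by
  have h := primeNorm_polarPoint_add_sq s r (0 : Euc (n + 1))
  have h0 : primeNorm (0 : Euc (n + 1)) ^ 2 = 0 := by simp [primeNorm_sq]
  rw [add_zero, h0] at h
  exact (pow_left_inj₀ (primeNorm_nonneg _) hr two_ne_zero).mp (by simpa using h)

lemma le_primeNorm_polarPoint_add (s r : ℝ) (x : Euc (n + 1)) :
    r + x 1 ≤ primeNorm (polarPoint n s r + x) := by
  refine (abs_le_of_sq_le_sq' ?_ (primeNorm_nonneg _)).2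
  rw [primeNorm_polarPoint_add_sq, primeNorm_sq, Fin.sum_univ_succ, Fin.succ_zero_eq_one]
  have : 0 ≤ ∑ i : Fin n, x i.succ.succ ^ 2 := Finset.sum_nonneg fun i _ => sq_nonneg _
  linarith

lemma polarPoint_sub_norm (s r r' : ℝ) :
    ‖polarPoint n s r - polarPoint n s r'‖ = |r - r'| := by
  rw [polarPoint, polarPoint, add_sub_add_left_eq_sub, ← sub_smul, norm_smul]
  simp

/-- Far from the axis an axisymmetric stable solution is close to `0` or to `1`. -/
lemma IsStableSol.near_zero_or_one {f : ℝ → ℝ} {θ : ℝ} (hf : Bistable f θ)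
    {U : Euc (n + 1) → ℝ} (hU : IsStableSol f U)
    (haxi : ∀ x y : Euc (n + 1), x 0 = y 0 → primeNorm x = primeNorm y → U x = U y)
    {δ : ℝ} (hδ : 0 < δ) : ∃ ρ, ∀ x, ρ ≤ primeNorm x → U x < δ ∨ 1 - δ < U x := by
  by_contra! hcon
  obtain ⟨K, hK0, hK⟩ := hU.exists_bound hf
  have hdU := hU.smooth.differentiable (by norm_num)
  choose z hz hzδ hzδ' using fun k : ℕ => hcon k
  set p : ℕ → Euc (n + 1) := fun k => polarPoint n (z k 0) (primeNorm (z k)) with hp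
  have hpz : ∀ k, U (p k) = U (z k) := fun k =>
    haxi _ _ (polarPoint_zero _ _) (primeNorm_polarPoint _ (primeNorm_nonneg _))
  obtain ⟨V, hV, hlim⟩ := hU.exists_translation_limit hf p (hyperfilter ℕ)
  have hle : (hyperfilter ℕ : Filter ℕ) ≤ atTop := Nat.cofinite_eq_atTop ▸ hyperfilter_le_cofinite
  have hpolar : ∀ x, U x = U (polarPoint n (x 0) (primeNorm x)) := fun x =>
    haxi _ _ (polarPoint_zero _ _).symm (primeNorm_polarPoint _ (primeNorm_nonneg _)).symm
  have hind : ∀ x y : Euc (n + 1), x 0 = y 0 → x 1 = y 1 → V x = V y := by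
    intro x y h0 h1
    set C := |primeNorm x ^ 2 - primeNorm y ^ 2|
    have hbound : ∀ k : ℕ, 0 < (k : ℝ) + x 1 →
        |U (p k + x) - U (p k + y)| ≤ K * (C / (k + x 1)) := by
      intro k hk
      set a := primeNorm (p k + x) with ha
      set b := primeNorm (p k + y) with hb
      have e1 : |U (p k + x) - U (p k + y)| ≤ K * |a - b| := by
        rw [hpolar (p k + x), hpolar (p k + y), PiLp.add_apply, PiLp.add_apply, ← h0,
          ← polarPoint_sub_norm (n := n) (p k 0 + x 0) a b]
        exact abs_sub_le_of_dirDeriv_le hdU hK0 hK.first _ _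
      refine e1.trans (mul_le_mul_of_nonneg_left ?_ hK0)
      rw [le_div_iff₀ hk]
      have e2 : a ^ 2 - b ^ 2 = primeNorm x ^ 2 - primeNorm y ^ 2 := by
        rw [ha, hb, hp, primeNorm_polarPoint_add_sq, primeNorm_polarPoint_add_sq, h1]; ring
      have e3 : (k : ℝ) + x 1 ≤ a + b := by
        have := le_primeNorm_polarPoint_add (z k 0) (primeNorm (z k)) x
        linarith [hz k, primeNorm_nonneg (p k + y)]
      calc |a - b| * (k + x 1) ≤ |a - b| * |a + b| :=
            mul_le_mul_of_nonneg_left (e3.trans (le_abs_self _)) (abs_nonneg _)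
        _ = C := by rw [← abs_mul]; exact congrArg abs (by linarith)
    have hzero : Tendsto (fun k : ℕ => K * (C / ((k : ℝ) + x 1))) atTop (𝓝 0) := by
      have h2 := (tendsto_atTop_add_const_right atTop (x 1)
        (tendsto_natCast_atTop_atTop (R := ℝ))).const_div_atTop C
      simpa using h2.const_mul K
    have hev : ∀ᶠ k : ℕ in atTop, 0 < (k : ℝ) + x 1 :=
      (tendsto_atTop_add_const_right atTop (x 1)
        (tendsto_natCast_atTop_atTop (R := ℝ))).eventually_gt_atTop 0
    have hdiff : Tendsto (fun k => U (p k + x) - U (p k + y)) atTop (𝓝 0) :=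
      squeeze_zero_norm' (hev.mono fun k hk => hbound k hk) hzero
    have := tendsto_nhds_unique (hdiff.mono_left hle) ((hlim x).sub (hlim y))
    linarith
  have h0 := hlim 0
  simp only [add_zero, hpz] at h0
  have l1 : δ ≤ V 0 := ge_of_tendsto' h0 hzδ
  have l2 : V 0 ≤ 1 - δ := le_of_tendsto' h0 hzδ'
  rcases hV.eq_zero_or_eq_one_of_two_coords hf n hind with h | h
  · rw [h 0] at l1; linarith
  · rw [h 0] at l2; linarith

/-- Far from the axis an axisymmetric stable solution is uniformly close to a single stable zero
of `f`. -/
lemma IsStableSol.exists_uniform_limit {f : ℝ → ℝ} {θ : ℝ} (hf : Bistable f θ)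
    {U : Euc (n + 1) → ℝ} (hU : IsStableSol f U)
    (haxi : ∀ x y : Euc (n + 1), x 0 = y 0 → primeNorm x = primeNorm y → U x = U y)
    {δ : ℝ} (hδ : 0 < δ) : ∃ l : ℝ, (l = 0 ∨ l = 1) ∧ ∃ ρ, 0 ≤ ρ ∧
      ∀ x, ρ ≤ primeNorm x → |U x - l| ≤ δ := by
  obtain ⟨ρ, hρ⟩ := hU.near_zero_or_one hf haxi (δ := min δ (1 / 2)) (by positivity)
  have hpolar : ∀ x, U x = U (polarPoint n (x 0) (primeNorm x)) := fun x =>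
    haxi _ _ (polarPoint_zero _ _).symm (primeNorm_polarPoint _ (primeNorm_nonneg _)).symm
  have hcont : Continuous fun q : ℝ × ℝ => U (polarPoint n q.1 q.2) := by
    have : Continuous fun q : ℝ × ℝ => polarPoint n q.1 q.2 := by unfold polarPoint; fun_prop
    exact hU.smooth.continuous.comp this
  have hconn : IsPreconnected ((univ : Set ℝ) ×ˢ Ici (max ρ 0)) :=
    isPreconnected_univ.prod isPreconnected_Ici
  have himg := (hconn.image _ hcont.continuousOn).ordConnected
  have hnot : (1 / 2 : ℝ) ∉ (fun q : ℝ × ℝ => U (polarPoint n q.1 q.2)) ''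
      ((univ : Set ℝ) ×ˢ Ici (max ρ 0)) := by
    rintro ⟨q, ⟨-, hq⟩, h⟩
    have hq' : max ρ 0 ≤ q.2 := hq
    have h2 := hρ (polarPoint n q.1 q.2) (by
      rw [primeNorm_polarPoint _ ((le_max_right _ _).trans hq')]
      exact (le_max_left _ _).trans hq')
    simp only at h
    rw [h] at h2
    rcases h2 with h2 | h2 <;> linarith [min_le_right δ (1 / 2)]
  have hmem : ∀ x, max ρ 0 ≤ primeNorm x → U x ∈ (fun q : ℝ × ℝ => U (polarPoint n q.1 q.2)) ''
      ((univ : Set ℝ) ×ˢ Ici (max ρ 0)) := fun x hx =>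
    ⟨(x 0, primeNorm x), ⟨mem_univ _, hx⟩, (hpolar x).symm⟩
  have hside : (∀ x, max ρ 0 ≤ primeNorm x → U x < 1 / 2) ∨
      (∀ x, max ρ 0 ≤ primeNorm x → 1 / 2 < U x) := by
    by_contra! hcon
    obtain ⟨⟨x, hx, hx'⟩, ⟨y, hy, hy'⟩⟩ := hcon
    exact hnot (himg.out (hmem y hy) (hmem x hx) ⟨hy', hx'⟩)
  rcases hside with h | h
  · refine ⟨0, Or.inl rfl, max ρ 0, le_max_right _ _, fun x hx => ?_⟩
    rw [sub_zero, abs_of_nonneg (hU.range x).1]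
    rcases hρ x ((le_max_left _ _).trans hx) with h' | h'
    · exact h'.le.trans (min_le_left _ _)
    · linarith [h x hx, min_le_right δ (1 / 2)]
  · refine ⟨1, Or.inr rfl, max ρ 0, le_max_right _ _, fun x hx => ?_⟩
    rw [abs_sub_comm, abs_of_nonneg (sub_nonneg.mpr (hU.range x).2)]
    rcases hρ x ((le_max_left _ _).trans hx) with h' | h'
    · linarith [h x hx, min_le_right δ (1 / 2)]
    · linarith [min_le_left δ (1 / 2)]

end Asymptotics

section EnergyGrowth

variable {d : ℕ}

lemma Bistable.exists_linear_bound {f : ℝ → ℝ} {θ : ℝ} (hf : Bistable f θ) {l : ℝ}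
    (hl : l = 0 ∨ l = 1) : ∃ c δ, 0 < c ∧ 0 < δ ∧
      ∀ u, |u - l| ≤ δ → (u - l) * f u ≤ -c * (u - l) ^ 2 := by
  have h0 : f l = 0 := by rcases hl with rfl | rfl <;> [exact hf.f0; exact hf.f1]
  have h1 : deriv f l < 0 := by rcases hl with rfl | rfl <;> [exact hf.df0; exact hf.df1]
  have hd : HasDerivAt f (deriv f l) l := (hf.smooth.differentiable (by norm_num) l).hasDerivAt
  set c := -deriv f l / 2 with hc
  have hc0 : 0 < c := by rw [hc]; linarith
  have ho := (hasDerivAt_iff_isLittleO.mp hd).def hc0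
  obtain ⟨ε, hε, hball⟩ := Metric.eventually_nhds_iff.mp ho
  refine ⟨c, ε / 2, hc0, by positivity, fun u hu => ?_⟩
  have h2 := hball (y := u) (by rw [Real.dist_eq]; linarith)
  rw [h0, sub_zero, smul_eq_mul, Real.norm_eq_abs, Real.norm_eq_abs] at h2
  have h3 : (u - l) * (f u - (u - l) * deriv f l) ≤ c * (u - l) ^ 2 := by
    calc (u - l) * (f u - (u - l) * deriv f l)
        ≤ |u - l| * |f u - (u - l) * deriv f l| := (le_abs_self _).trans (abs_mul _ _).le
      _ ≤ |u - l| * (c * |u - l|) := mul_le_mul_of_nonneg_left h2 (abs_nonneg _)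
      _ = c * (u - l) ^ 2 := by rw [← sq_abs (u - l)]; ring
  have h4 : deriv f l = -2 * c := by rw [hc]; ring
  rw [h4] at h3
  linarith

/-- The part of the ball of radius `R` within distance `ρ` of the axis. -/
def axisBox (d : ℕ) (ρ R : ℝ) : Set (Euc d) := {x | |x 0| ≤ R ∧ ∀ i : Fin d, |x i.succ| ≤ ρ}

lemma isClosed_axisBox (ρ R : ℝ) : IsClosed (axisBox d ρ R) := by
  have h : axisBox d ρ R = {x | |x 0| ≤ R} ∩ ⋂ i : Fin d, {x | |x i.succ| ≤ ρ} := by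
    ext x; simp [axisBox]
  rw [h]
  have hc : ∀ i : Fin (d + 1), Continuous fun x : Euc d => |x i| := fun i => by fun_prop
  exact (isClosed_le (hc 0) continuous_const).inter
    (isClosed_iInter fun i => isClosed_le (hc _) continuous_const)

lemma volume_axisBox (ρ R : ℝ) :
    volume (axisBox d ρ R) = ENNReal.ofReal (2 * R) * ENNReal.ofReal (2 * ρ) ^ d := by
  set w : Fin (d + 1) → ℝ := Fin.cons R fun _ => ρ with hw
  have h1 : axisBox d ρ R = (@WithLp.ofLp 2 (Fin (d + 1) → ℝ)) ⁻¹' Icc (-w) w := by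
    ext x
    simp only [axisBox, Set.mem_ofPred_eq, mem_preimage, mem_Icc, Pi.le_def, ← forall_and, Pi.neg_apply,
      ← abs_le]
    rw [Fin.forall_fin_succ]
    simp [hw]
  rw [h1, (PiLp.volume_preserving_ofLp (Fin (d + 1))).measure_preimage
    measurableSet_Icc.nullMeasurableSet, Real.volume_Icc_pi, Fin.prod_univ_succ]
  simp [hw, two_mul]

lemma mem_axisBox {ρ R : ℝ} {x : Euc d} (h1 : primeNorm x ≤ ρ) (h2 : ‖x‖ ≤ R) :
    x ∈ axisBox d ρ R := by
  refine ⟨(PiLp.norm_apply_le x 0).trans h2, fun i => ?_⟩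
  refine le_trans ?_ h1
  refine abs_le_of_sq_le_sq ?_ (primeNorm_nonneg x)
  rw [primeNorm_sq]
  exact Finset.single_le_sum (f := fun i : Fin d => x i.succ ^ 2) (fun j _ => sq_nonneg _)
    (Finset.mem_univ i)

lemma tsupport_cutoff_subset {R : ℝ} (hR : 0 < R) :
    tsupport (cutoff (d := d) R) ⊆ Metric.closedBall 0 (2 * R) := by
  refine closure_minimal (fun x hx => ?_) Metric.isClosed_closedBall
  rw [mem_closedBall_zero_iff]
  exact not_lt.mp fun h => hx (cutoff_eq_zero hR h.le)

/-- The energy density `(U - l)² + |∇U|²`. -/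
def energyDensity (l : ℝ) (U : Euc d → ℝ) (x : Euc d) : ℝ := (U x - l) ^ 2 + gradDot U U x

lemma energyDensity_nonneg (l : ℝ) (U : Euc d → ℝ) (x : Euc d) : 0 ≤ energyDensity l U x :=
  add_nonneg (sq_nonneg _) (gradDot_self_nonneg U x)

/-- The energy contained in the ball of radius `R`. -/
def energyIn (l : ℝ) (U : Euc d → ℝ) (R : ℝ) : ℝ :=
  ∫ x in Metric.closedBall (0 : Euc d) R, energyDensity l U x

lemma continuous_energyDensity (l : ℝ) {U : Euc d → ℝ} (hU : ContDiff ℝ 1 U) :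
    Continuous (energyDensity l U) :=
  ((hU.continuous.sub continuous_const).pow 2).add (continuous_gradDot hU hU)

lemma integrable_indicator_energyDensity (l : ℝ) {U : Euc d → ℝ} (hU : ContDiff ℝ 1 U) (R : ℝ) :
    Integrable ((Metric.closedBall (0 : Euc d) R).indicator (energyDensity l U)) :=
  (integrable_indicator_iff measurableSet_closedBall).mpr
    ((continuous_energyDensity l hU).continuousOn.integrableOn_compact
      (isCompact_closedBall (0 : Euc d) R))

lemma integral_indicator_energyDensity (l : ℝ) (U : Euc d → ℝ) (R : ℝ) :
    ∫ x, (Metric.closedBall (0 : Euc d) R).indicator (energyDensity l U) x = energyIn l U R :=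
  integral_indicator measurableSet_closedBall

lemma norm_gradient_sq_cutoff_mul_le {C R : ℝ} (hR : 0 < R)
    (hC : ∀ x : Euc d, ‖gradient (cutoff R) x‖ ^ 2 ≤ C / R ^ 2) {g h : Euc d → ℝ}
    (hgh : ∀ x, g x ≤ h x) (h0 : ∀ x, 0 ≤ h x) (x : Euc d) :
    g x * ‖gradient (cutoff R) x‖ ^ 2
      ≤ C / R ^ 2 * (Metric.closedBall (0 : Euc d) (2 * R)).indicator h x := by
  by_cases hx : x ∈ Metric.closedBall (0 : Euc d) (2 * R)
  · rw [indicator_of_mem hx]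
    calc g x * ‖gradient (cutoff R) x‖ ^ 2 ≤ h x * ‖gradient (cutoff R) x‖ ^ 2 :=
          mul_le_mul_of_nonneg_right (hgh x) (sq_nonneg _)
      _ ≤ h x * (C / R ^ 2) := mul_le_mul_of_nonneg_left (hC x) (h0 x)
      _ = _ := mul_comm _ _
  · have h1 : x ∉ tsupport (cutoff (d := d) R) := fun h => hx (tsupport_cutoff_subset hR h)
    have h2 : ‖gradient (cutoff R) x‖ ^ 2 = 0 := by
      rw [norm_gradient_sq]; simp [dirDeriv_eq_zero_of_notMem h1]
    rw [h2, indicator_of_notMem hx]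
    simp

lemma gradDot_sub_mul_sq {U η : Euc d → ℝ} (hU : Differentiable ℝ U) (hη : Differentiable ℝ η)
    (l : ℝ) (x : Euc d) : gradDot U (fun y => (U y - l) * η y ^ 2) x
      = η x ^ 2 * gradDot U U x + 2 * (U x - l) * η x * gradDot U η x := by
  have h1 : ∀ v, dirDeriv v (fun y => (U y - l) * η y ^ 2) x
      = η x ^ 2 * dirDeriv v U x + 2 * (U x - l) * η x * dirDeriv v η x := fun v => by
    have hη2 : Differentiable ℝ fun y => η y ^ 2 := hη.pow 2
    have e1 : dirDeriv v (fun y => U y - l) x = dirDeriv v U x := by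
      simp [dirDeriv, fderiv_sub_const]
    have e2 : dirDeriv v (fun y => η y ^ 2) x = 2 * η x * dirDeriv v η x := by
      simp only [sq]
      rw [dirDeriv_mul hη hη]
      ring
    rw [dirDeriv_mul (hU.sub_const l) hη2, e1, e2]
    ring
  simp only [gradDot, h1, Finset.mul_sum, ← Finset.sum_add_distrib]
  exact Finset.sum_congr rfl fun i _ => by ring

lemma half_gradDot_le {U η : Euc d → ℝ} (w e : ℝ) (x : Euc d) :
    1 / 2 * (e ^ 2 * gradDot U U x) ≤ e ^ 2 * gradDot U U x + 2 * w * e * gradDot U η x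
      + 2 * (w ^ 2 * ‖gradient η x‖ ^ 2) := by
  rw [norm_gradient_sq_eq_gradDot]
  have h : e ^ 2 * gradDot U U x + 2 * w * e * gradDot U η x + 2 * (w ^ 2 * gradDot η η x)
      - 1 / 2 * (e ^ 2 * gradDot U U x) = ∑ i, 1 / 2 * (e * dirDeriv (basisVec i) U x
        + 2 * w * dirDeriv (basisVec i) η x) ^ 2 := by
    simp only [gradDot, Finset.mul_sum, ← Finset.sum_add_distrib, ← Finset.sum_sub_distrib]
    exact Finset.sum_congr rfl fun i _ => by ring
  have h2 : 0 ≤ ∑ i, 1 / 2 * (e * dirDeriv (basisVec i) U x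
        + 2 * w * dirDeriv (basisVec i) η x) ^ 2 := Finset.sum_nonneg fun i _ => by positivity
  linarith

/-- Caccioppoli inequality for a solution close to a stable zero of `f` away from the axis. -/
lemma IsStableSol.energyIn_le {f : ℝ → ℝ} {θ : ℝ} (hf : Bistable f θ) {U : Euc d → ℝ}
    (hU : IsStableSol f U) {l : ℝ} (hl : l = 0 ∨ l = 1) {c δ ρ : ℝ} (hc : 0 < c)
    (hlin : ∀ u, |u - l| ≤ δ → (u - l) * f u ≤ -c * (u - l) ^ 2) (hρ : 0 ≤ ρ)
    (hfar : ∀ x, ρ ≤ primeNorm x → |U x - l| ≤ δ) :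
    ∃ A B, 0 ≤ A ∧ 0 ≤ B ∧ ∀ R, 0 < R →
      energyIn l U R ≤ A * R + B / R ^ 2 * energyIn l U (2 * R) := by
  obtain ⟨L, hL0, hL, -, -, -⟩ := hf.exists_bounds
  obtain ⟨C, hC0, hC⟩ := exists_gradient_cutoff_bound d
  set m := min c (1 / 2) with hm
  have hm0 : 0 < m := by positivity
  have hs1 : ContDiff ℝ 1 U := hU.smooth.of_le (by norm_num)
  have hdU := hs1.differentiable (by norm_num)
  have hW : ∀ x, |U x - l| ≤ 1 := fun x => by
    have := hU.range x
    rw [abs_le]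
    rcases hl with rfl | rfl <;> constructor <;> linarith [this.1, this.2]
  have hfc := hf.smooth.continuous
  refine ⟨m⁻¹ * ((L + c) * (4 * (2 * ρ) ^ d)), m⁻¹ * (2 * C), by positivity, by positivity,
    fun R hR => ?_⟩
  set η : Euc d → ℝ := cutoff R with hη
  have hη1 : ContDiff ℝ 1 η := contDiff_cutoff R
  have hηd := hη1.differentiable (by norm_num)
  have hηc : HasCompactSupport η := hasCompactSupport_cutoff hR
  set φ : Euc d → ℝ := fun y => (U y - l) * η y ^ 2 with hφ
  have hφ1 : ContDiff ℝ 1 φ := (hs1.sub contDiff_const).mul (hη1.pow 2)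
  have hφc : HasCompactSupport φ := HasCompactSupport.intro hηc.isCompact fun x hx => by
    simp [hφ, image_eq_zero_of_notMem_tsupport hx]
  set S := axisBox d ρ (2 * R)
  have hSvol : volume.real S = 4 * R * (2 * ρ) ^ d := by
    rw [Measure.real, volume_axisBox, ENNReal.toReal_mul, ENNReal.toReal_pow,
      ENNReal.toReal_ofReal (by positivity), ENNReal.toReal_ofReal (by positivity)]
    ring
  have hSfin : volume S ≠ ⊤ := by
    rw [volume_axisBox]
    exact ENNReal.mul_ne_top ENNReal.ofReal_ne_top (ENNReal.pow_ne_top ENNReal.ofReal_ne_top)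
  have hSm : MeasurableSet S := (isClosed_axisBox ρ _).measurableSet
  have i1 : Integrable fun x => gradDot U φ x := integrable_gradDot hs1 hφ1 hφc
  have i2 : Integrable fun x => f (U x) * φ x :=
    integrable_mul_of_hasCompactSupport (hfc.comp hU.smooth.continuous) hφ1.continuous hφc
  have i3 : Integrable (S.indicator fun _ : Euc d => (1 : ℝ)) :=
    (integrable_indicator_iff hSm).mpr (integrableOn_const hSfin)
  have i4 := integrable_indicator_energyDensity l hs1 (2 * R)
  have i5 := integrable_indicator_energyDensity l hs1 R
  have hpt : ∀ x, m * (Metric.closedBall (0 : Euc d) R).indicator (energyDensity l U) x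
      ≤ gradDot U φ x - f (U x) * φ x + (L + c) * S.indicator (fun _ => (1 : ℝ)) x
        + 2 * C / R ^ 2 * (Metric.closedBall (0 : Euc d) (2 * R)).indicator
          (energyDensity l U) x := by
    intro x
    have hη0 : 0 ≤ η x := cutoff_nonneg R x
    have hη2 : η x ^ 2 ≤ 1 := pow_le_one₀ hη0 (cutoff_le_one R x)
    have e1 : m * (Metric.closedBall (0 : Euc d) R).indicator (energyDensity l U) x
        ≤ 1 / 2 * (η x ^ 2 * gradDot U U x) + c * (U x - l) ^ 2 * η x ^ 2 := by
      have hg := mul_nonneg (sq_nonneg (η x)) (gradDot_self_nonneg U x)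
      have hw := mul_nonneg (sq_nonneg (η x)) (sq_nonneg (U x - l))
      by_cases hx : x ∈ Metric.closedBall (0 : Euc d) R
      · have hx1 : η x = 1 := cutoff_eq_one hR (mem_closedBall_zero_iff.mp hx)
        rw [indicator_of_mem hx, energyDensity]
        rw [hx1] at hg hw ⊢
        nlinarith [min_le_left c (1 / 2), min_le_right c (1 / 2)]
      · rw [indicator_of_notMem hx, mul_zero]
        have := mul_nonneg hc.le hw
        nlinarith
    have e2 := half_gradDot_le (U := U) (η := η) (U x - l) (η x) x
    rw [← gradDot_sub_mul_sq hdU hηd l x] at e2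
    have e3 := norm_gradient_sq_cutoff_mul_le hR (hC R hR) (g := fun x => (U x - l) ^ 2)
      (h := energyDensity l U) (fun x => le_add_of_nonneg_right (gradDot_self_nonneg U x))
      (energyDensity_nonneg l U) x
    have e4 : f (U x) * φ x + c * (U x - l) ^ 2 * η x ^ 2
        ≤ (L + c) * S.indicator (fun _ => (1 : ℝ)) x := by
      have hle : f (U x) * (U x - l) ≤ L := by
        have h1 := hL _ (hU.range x)
        calc f (U x) * (U x - l) ≤ |f (U x)| * |U x - l| := (le_abs_self _).trans (abs_mul _ _).le
          _ ≤ L * 1 := mul_le_mul h1 (hW x) (abs_nonneg _) hL0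
          _ = L := mul_one L
      have hsq : (U x - l) ^ 2 ≤ 1 := by rw [← sq_abs]; exact pow_le_one₀ (abs_nonneg _) (hW x)
      have hrw : f (U x) * φ x + c * (U x - l) ^ 2 * η x ^ 2
          = (f (U x) * (U x - l) + c * (U x - l) ^ 2) * η x ^ 2 := by simp only [hφ]; ring
      rw [hrw]
      by_cases hx : x ∈ S
      · rw [indicator_of_mem hx]
        have h2 : f (U x) * (U x - l) + c * (U x - l) ^ 2 ≤ L + c := by nlinarith
        calc _ ≤ (L + c) * η x ^ 2 := mul_le_mul_of_nonneg_right h2 (sq_nonneg _)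
          _ ≤ (L + c) * 1 := mul_le_mul_of_nonneg_left hη2 (by positivity)
      · rw [indicator_of_notMem hx, mul_zero]
        rcases le_total ρ (primeNorm x) with h | h
        · refine mul_nonpos_of_nonpos_of_nonneg ?_ (sq_nonneg _)
          linarith [hlin _ (hfar x h)]
        · have h3 : 2 * R < ‖x‖ := not_le.mp fun h4 => hx (mem_axisBox h h4)
          have h4 : η x = 0 := cutoff_eq_zero hR h3.le
          rw [h4]; simp
    have e5 : 2 * C / R ^ 2 * (Metric.closedBall (0 : Euc d) (2 * R)).indicator
          (energyDensity l U) x = 2 * (C / R ^ 2 * (Metric.closedBall (0 : Euc d)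
            (2 * R)).indicator (energyDensity l U) x) := by ring
    rw [e5]
    linarith
  have i6 : Integrable fun x => gradDot U φ x - f (U x) * φ x := i1.sub i2
  have i7 : Integrable fun x => gradDot U φ x - f (U x) * φ x
      + (L + c) * S.indicator (fun _ => (1 : ℝ)) x := i6.add (i3.const_mul _)
  have hint := integral_mono (i5.const_mul m) (i7.add (i4.const_mul (2 * C / R ^ 2))) hpt
  have hz : ∫ x, (gradDot U φ x - f (U x) * φ x) = 0 := by
    rw [integral_sub i1 i2, integral_gradDot_eq_neg_lap_mul hU.smooth hφ1 hφc, ← integral_neg,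
      sub_eq_zero]
    refine integral_congr_ae (Eventually.of_forall fun x => ?_)
    simp only
    rw [show lap U x = -f (U x) by linarith [hU.pde x]]
    ring
  simp only [Pi.add_apply] at hint
  rw [integral_add i7 (i4.const_mul _), integral_add i6 (i3.const_mul _), hz, integral_const_mul,
    integral_const_mul, integral_const_mul, integral_indicator_energyDensity,
    integral_indicator_energyDensity, integral_indicator hSm, setIntegral_const, hSvol] at hint
  have h8 := mul_le_mul_of_nonneg_left hint (inv_nonneg.mpr hm0.le)
  rw [← mul_assoc, inv_mul_cancel₀ hm0.ne', one_mul] at h8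
  refine h8.trans (le_of_eq ?_)
  rw [smul_eq_mul]
  ring

lemma IsStableSol.exists_energyIn_le_pow {f : ℝ → ℝ} {θ : ℝ} (hf : Bistable f θ) {U : Euc d → ℝ}
    (hU : IsStableSol f U) {l : ℝ} (hl : l = 0 ∨ l = 1) :
    ∃ C, ∀ R, 1 ≤ R → energyIn l U R ≤ C * R ^ (d + 1) := by
  obtain ⟨K, hK0, hK⟩ := hU.exists_bound hf
  set H : ℝ := 1 + ∑ _i : Fin (d + 1), K ^ 2
  have hH : ∀ x, energyDensity l U x ≤ H := fun x => by
    have := hU.range x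
    refine add_le_add ?_ (Finset.sum_le_sum fun i _ => ?_)
    · rcases hl with rfl | rfl <;> nlinarith [this.1, this.2]
    · rw [← sq, ← sq_abs]
      refine pow_le_pow_left₀ (abs_nonneg _) ?_ 2
      simpa using hK.first (basisVec i) x
  refine ⟨H * volume.real (Metric.closedBall (0 : Euc d) 1), fun R hR => ?_⟩
  have hR0 : 0 < R := by linarith
  have hs1 : ContDiff ℝ 1 U := hU.smooth.of_le (by norm_num)
  have hfin : volume (Metric.closedBall (0 : Euc d) R) ≠ ⊤ := measure_closedBall_lt_top.ne
  have h1 : energyIn l U R ≤ ∫ _ in Metric.closedBall (0 : Euc d) R, H :=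
    setIntegral_mono_on ((continuous_energyDensity l hs1).continuousOn.integrableOn_compact
      (isCompact_closedBall (0 : Euc d) R)) (integrableOn_const hfin) measurableSet_closedBall
      fun x _ => hH x
  refine h1.trans (le_of_eq ?_)
  rw [setIntegral_const, smul_eq_mul, Measure.addHaar_real_closedBall' _ _ hR0.le,
    show Module.finrank ℝ (Euc d) = d + 1 by simp]
  ring

/-- A function of at most polynomial growth satisfying the Caccioppoli recursion grows at most
linearly. -/
lemma linear_growth_of_recursion {F : ℝ → ℝ} {A B : ℝ} (hA : 0 ≤ A) (hB : 0 ≤ B)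
    (hrec : ∀ R, 0 < R → F R ≤ A * R + B / R ^ 2 * F (2 * R)) (k : ℕ) {C : ℝ}
    (hC : ∀ R, 1 ≤ R → F R ≤ C * R ^ (k + 1)) : ∃ C', ∀ R, 1 ≤ R → F R ≤ C' * R := by
  induction k generalizing C with
  | zero => exact ⟨C, fun R hR => by simpa using hC R hR⟩
  | succ k ih =>
    refine ih (C := A + B * |C| * 2 ^ (k + 2)) fun R hR => ?_
    have hR0 : 0 < R := by linarith
    have h1 : F (2 * R) ≤ |C| * (2 * R) ^ (k + 2) :=
      (hC (2 * R) (by linarith)).trans (mul_le_mul_of_nonneg_right (le_abs_self C) (by positivity))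
    have h2 := mul_le_mul_of_nonneg_left h1 (by positivity : 0 ≤ B / R ^ 2)
    have h3 : B / R ^ 2 * (|C| * (2 * R) ^ (k + 2)) = B * |C| * 2 ^ (k + 2) * R ^ k := by
      rw [mul_pow, pow_add R]; field_simp
    have h4 : R ^ k ≤ R ^ (k + 1) := pow_le_pow_right₀ hR (Nat.le_succ k)
    have h5 : R ≤ R ^ (k + 1) := le_self_pow₀ hR (Nat.succ_ne_zero k)
    have h6 := mul_le_mul_of_nonneg_left h5 hA
    have h7 := mul_le_mul_of_nonneg_left h4 (by positivity : 0 ≤ B * |C| * 2 ^ (k + 2))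
    have h8 := hrec R hR0
    rw [add_mul]
    linarith

/-- Linear energy growth provides good cutoffs for the partial derivatives. -/
lemma hasGoodCutoffs_of_linear_growth {U : Euc d → ℝ} (hU : ContDiff ℝ 2 U) {l C : ℝ}
    (hC : ∀ R, 1 ≤ R → energyIn l U R ≤ C * R) (i : Fin (d + 1)) :
    HasGoodCutoffs (dirDeriv (basisVec i) U) := by
  intro R₀ δ hδ
  obtain ⟨C₁, hC₁, hgrad⟩ := exists_gradient_cutoff_bound d
  have hs1 : ContDiff ℝ 1 U := hU.of_le (by norm_num)
  set R : ℝ := max (max R₀ 1) (2 * C₁ * |C| / δ) with hR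
  have hR1 : 1 ≤ R := (le_max_right _ _).trans (le_max_left _ _)
  have hR0 : 0 < R := by linarith
  refine ⟨cutoff R, contDiff_cutoff R, hasCompactSupport_cutoff hR0, fun x hx => ?_, ?_⟩
  · exact cutoff_eq_one hR0 ((mem_ball_zero_iff.mp hx).le.trans
      ((le_max_left _ _).trans (le_max_left _ _)))
  · have hle : ∀ x, dirDeriv (basisVec i) U x ^ 2 ≤ energyDensity l U x := fun x => by
      have h1 : dirDeriv (basisVec i) U x ^ 2 ≤ gradDot U U x := by
        rw [← norm_gradient_sq_eq_gradDot, norm_gradient_sq]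
        exact Finset.single_le_sum (f := fun i => dirDeriv (basisVec i) U x ^ 2)
          (fun j _ => sq_nonneg _) (Finset.mem_univ i)
      exact h1.trans (le_add_of_nonneg_left (sq_nonneg _))
    have h1 : ∫ x, dirDeriv (basisVec i) U x ^ 2 * ‖gradient (cutoff R) x‖ ^ 2
        ≤ ∫ x, C₁ / R ^ 2 * (Metric.closedBall (0 : Euc d) (2 * R)).indicator
          (energyDensity l U) x := by
      refine integral_mono (integrable_of_eq_zero_off_compact
        (((hs1.continuous_dirDeriv _).pow 2).mul (continuous_norm_gradient_sq (contDiff_cutoff R)))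
        (hasCompactSupport_cutoff hR0).isCompact fun x hx => ?_)
        ((integrable_indicator_energyDensity l hs1 _).const_mul _)
        (norm_gradient_sq_cutoff_mul_le hR0 (hgrad R hR0) hle (energyDensity_nonneg l U))
      simp [norm_gradient_sq, dirDeriv_eq_zero_of_notMem hx]
    rw [integral_const_mul, integral_indicator_energyDensity] at h1
    refine h1.trans ?_
    have h2 : energyIn l U (2 * R) ≤ |C| * (2 * R) := (hC (2 * R) (by linarith)).trans
      (mul_le_mul_of_nonneg_right (le_abs_self C) (by positivity))
    have h3 : 2 * C₁ * |C| ≤ R * δ := (div_le_iff₀ hδ).mp (le_max_right _ _)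
    calc C₁ / R ^ 2 * energyIn l U (2 * R) ≤ C₁ / R ^ 2 * (|C| * (2 * R)) :=
          mul_le_mul_of_nonneg_left h2 (by positivity)
      _ = 2 * C₁ * |C| / R := by field_simp
      _ ≤ δ := by rw [div_le_iff₀ hR0]; linarith

end EnergyGrowth

section Conclusion

variable {n : ℕ}

lemma dirDeriv_zero_of_axisymmetric {U : Euc (n + 1) → ℝ} (hU : Differentiable ℝ U)
    (haxi : ∀ x y : Euc (n + 1), x 0 = y 0 → primeNorm x = primeNorm y → U x = U y)
    {i : Fin (n + 2)} (hi : i ≠ 0) : dirDeriv (basisVec i) U 0 = 0 := by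
  have h1 : HasDerivAt (fun t : ℝ => U (t • basisVec i)) (dirDeriv (basisVec i) U 0) 0 := by
    simpa [dirDeriv] using hasDerivAt_line hU 0 (basisVec i) 0
  have heven : (fun t : ℝ => U (-t • basisVec i)) = fun t : ℝ => U (t • basisVec i) :=
    funext fun t => haxi _ _ (by simp [hi.symm]) (by simp [primeNorm])
  have h2 := hasDerivAt_comp_neg (t := 0) (by simpa using h1)
  rw [heven] at h2
  linarith [h1.unique h2]

/-- An axisymmetric stable solution is identically `0` or identically `1`. -/
lemma IsStableSol.eq_zero_or_eq_one_of_axisymmetric {f : ℝ → ℝ} {θ : ℝ} (hf : Bistable f θ)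
    {U : Euc (n + 1) → ℝ} (hU : IsStableSol f U)
    (haxi : ∀ x y : Euc (n + 1), x 0 = y 0 → primeNorm x = primeNorm y → U x = U y) :
    (∀ x, U x = 0) ∨ (∀ x, U x = 1) := by
  have hdU := hU.smooth.differentiable (by norm_num)
  obtain ⟨c₀, δ₀, hc₀, hδ₀, hlin₀⟩ := hf.exists_linear_bound (Or.inl rfl)
  obtain ⟨c₁, δ₁, hc₁, hδ₁, hlin₁⟩ := hf.exists_linear_bound (Or.inr rfl)
  obtain ⟨l, hl, ρ, hρ, hfar⟩ := hU.exists_uniform_limit hf haxi (lt_min hδ₀ hδ₁)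
  obtain ⟨A, B, hA, hB, hrec⟩ : ∃ A B, 0 ≤ A ∧ 0 ≤ B ∧ ∀ R, 0 < R →
      energyIn l U R ≤ A * R + B / R ^ 2 * energyIn l U (2 * R) := by
    rcases hl with rfl | rfl
    · exact hU.energyIn_le hf (Or.inl rfl) hc₀ hlin₀ hρ
        fun x hx => (hfar x hx).trans (min_le_left _ _)
    · exact hU.energyIn_le hf (Or.inr rfl) hc₁ hlin₁ hρ
        fun x hx => (hfar x hx).trans (min_le_right _ _)
  obtain ⟨C, hC⟩ := hU.exists_energyIn_le_pow hf hl
  obtain ⟨C', hC'⟩ := linear_growth_of_recursion hA hB hrec _ hC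
  have hzero : ∀ i : Fin (n + 2), i ≠ 0 → ∀ x, dirDeriv (basisVec i) U x = 0 := fun i hi =>
    hU.dirDeriv_eq_zero hf (hasGoodCutoffs_of_linear_growth hU.smooth hC' i)
      (dirDeriv_zero_of_axisymmetric hdU haxi hi)
  refine hU.eq_zero_or_eq_one_of_two_coords hf n fun x y h0 _ => ?_
  have hd : ∀ t, HasDerivAt (fun t : ℝ => U (x + t • (y - x))) 0 t := fun t => by
    have h1 := hasDerivAt_line hdU x (y - x) t
    have h2 : dirDeriv (y - x) U (x + t • (y - x)) = 0 := by
      rw [dirDeriv_eq_sum]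
      refine Finset.sum_eq_zero fun i _ => ?_
      by_cases hi : i = 0
      · rw [hi, PiLp.sub_apply, h0, sub_self, zero_mul]
      · rw [hzero i hi, mul_zero]
    rwa [h2] at h1
  have h3 := is_const_of_deriv_eq_zero (fun t => (hd t).differentiableAt) (fun t => (hd t).deriv) 0 1
  simpa using h3

end Conclusion

/-- Proposition 1.6: a stable axisymmetric solution `0 ≤ U ≤ 1` of
`ΔU + f(U) = 0` in `ℝ^N` is identically `0` or identically `1`. -/
theorem statement2 (d : ℕ) (hd : 1 ≤ d) (f : ℝ → ℝ) (θ : ℝ) (hf : Bistable f θ)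
    (U : Euc d → ℝ) (hU : ContDiff ℝ 2 U)
    (hrange : ∀ x : Euc d, U x ∈ Icc (0 : ℝ) 1)
    (hpde : ∀ x : Euc d, lapW Set.univ U x + f (U x) = 0)
    (hstable : StableOn Set.univ f U)
    (haxi : ∀ x y : Euc d, x 0 = y 0 → primeNorm x = primeNorm y → U x = U y) :
    (∀ x : Euc d, U x = 0) ∨ (∀ x : Euc d, U x = 1) := by
  obtain ⟨n, rfl⟩ : ∃ n, d = n + 1 := ⟨d - 1, by omega⟩
  exact IsStableSol.eq_zero_or_eq_one_of_axisymmetric hf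
    ⟨hU, hrange, fun x => by rw [← lapW_univ]; exact hpde x, hstable⟩ haxi
end
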